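/- There exist a constant c > 0 and N such that for all n ≥ N and every injective map π : Fin n → ℝ², the number of simple graphs G on vertex set Fin n that admit a polyline drawing with vertex mapping π having total number of bends at most c·n² is less than n!/2^n. -/

import Mathlib

open Finset
open scoped Classical

noncomputable section

/-- The polyline traced by a list of points: the union of the closed segments
between consecutive points. -/
def polylineOf (pts : List (ℝ × ℝ)) : Set (ℝ × ℝ) :=
  ⋃ p ∈ pts.zip pts.tail, segment ℝ p.1 p.2

/-- The curve drawn for the edge `{u, v}`: the polyline through
`π u`, the bend points assigned to `(u, v)`, and `π v`. -/
def edgeCurve {n : ℕ} (π : Fin n → ℝ × ℝ) (bends : Fin n → Fin n → List (ℝ × ℝ))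
    (u v : Fin n) : Set (ℝ × ℝ) :=
  polylineOf (π u :: (bends u v ++ [π v]))

/-- `bends` is a polyline drawing of `G` with vertex mapping `π`:
each edge `{u,v}` of `G` is assigned the finite sequence of bend points `bends u v`
(recorded consistently in both directions); the polyline of every edge is a simple
arc from `π u` to `π v`; the polylines of two distinct edges intersect exactly in
the images under `π` of the shared endpoints; and no polyline passes through the
image of a vertex that is not an endpoint of its edge. -/
structure IsPolylineDrawing {n : ℕ} (G : SimpleGraph (Fin n)) (π : Fin n → ℝ × ℝ)
    (bends : Fin n → Fin n → List (ℝ × ℝ)) : Prop where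
  symm : ∀ u v : Fin n, bends v u = (bends u v).reverse
  arc : ∀ u v : Fin n, G.Adj u v → ∃ γ : ℝ → ℝ × ℝ,
    ContinuousOn γ (Set.Icc 0 1) ∧ Set.InjOn γ (Set.Icc 0 1) ∧
    γ 0 = π u ∧ γ 1 = π v ∧ γ '' Set.Icc 0 1 = edgeCurve π bends u v
  inter : ∀ u v x y : Fin n, G.Adj u v → G.Adj x y → s(u, v) ≠ s(x, y) →
    edgeCurve π bends u v ∩ edgeCurve π bends x y =
      π '' (({u, v} : Set (Fin n)) ∩ ({x, y} : Set (Fin n)))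
  noVertex : ∀ u v w : Fin n, G.Adj u v → w ≠ u → w ≠ v →
    π w ∉ edgeCurve π bends u v

/-- The total number of bends of a drawing: the sum over all edges of the number
of bend points of that edge (each unordered edge is counted once, hence the
division by 2 of the sum over ordered pairs). -/
def totalBends {n : ℕ} (G : SimpleGraph (Fin n))
    (bends : Fin n → Fin n → List (ℝ × ℝ)) : ℝ :=
  (∑ u : Fin n, ∑ v : Fin n,
    if G.Adj u v then ((bends u v).length : ℝ) else 0) / 2

/-- Reachability inside the vertex set `s`. -/
def Reach {V : Type} (G : SimpleGraph V) (s : Set V) : V → V → Prop :=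
  Relation.ReflTransGen (fun a b => G.Adj a b ∧ a ∈ s ∧ b ∈ s)

lemma Reach.symm {V : Type} {G : SimpleGraph V} {s : Set V} {x y : V} (h : Reach G s x y) :
    Reach G s y x := by
  induction h with
  | refl => exact .refl
  | tail _ h ih => exact .head ⟨h.1.symm, h.2.2, h.2.1⟩ ih

lemma Reach.mono {V : Type} {G : SimpleGraph V} {s t : Set V} (hst : s ⊆ t) {x y : V}
    (h : Reach G s x y) : Reach G t x y := by
  induction h with
  | refl => exact .refl
  | tail _ h ih => exact ih.tail ⟨h.1, hst h.2.1, hst h.2.2⟩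

lemma Reach.trans {V : Type} {G : SimpleGraph V} {s : Set V} {x y z : V} (h : Reach G s x y)
    (h' : Reach G s y z) : Reach G s x z :=
  Relation.ReflTransGen.trans h h'

lemma Reach.mem {V : Type} {G : SimpleGraph V} {s : Set V} {x y : V} (h : Reach G s x y)
    (hx : x ∈ s) : y ∈ s := by
  induction h with
  | refl => exact hx
  | tail _ h _ => exact h.2.2

/-- The set `s` is nonempty and induces a connected subgraph of `G`. -/
def ConnOn {V : Type} (G : SimpleGraph V) (s : Set V) : Prop :=
  s.Nonempty ∧ ∀ x ∈ s, ∀ y ∈ s, Reach G s x y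

lemma ConnOn.singleton {V : Type} (G : SimpleGraph V) (v : V) : ConnOn G {v} := by
  refine ⟨⟨v, rfl⟩, ?_⟩
  rintro x rfl y rfl
  exact .refl

lemma ConnOn.of_root {V : Type} {G : SimpleGraph V} {s : Set V} {r : V} (hr : r ∈ s)
    (h : ∀ x ∈ s, Reach G s r x) : ConnOn G s :=
  ⟨⟨r, hr⟩, fun x hx y hy => (h x hx).symm.trans (h y hy)⟩

lemma ConnOn.union {V : Type} {G : SimpleGraph V} {s t : Set V} (hs : ConnOn G s)
    (ht : ConnOn G t) {a b : V} (ha : a ∈ s) (hb : b ∈ t) (hab : G.Adj a b) :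
    ConnOn G (s ∪ t) := by
  refine ConnOn.of_root (r := a) (Or.inl ha) ?_
  rintro x (hx | hx)
  · exact (hs.2 a ha x hx).mono Set.subset_union_left
  · exact (Relation.ReflTransGen.single ⟨hab, Or.inl ha, Or.inr hb⟩).trans
      ((ht.2 b hb x hx).mono Set.subset_union_right)

lemma ConnOn.biUnion {V W : Type} {G : SimpleGraph V} {H : SimpleGraph W} {B : W → Set V}
    (hB : ∀ w, ConnOn G (B w)) (hadj : ∀ w w', H.Adj w w' → ∃ a ∈ B w, ∃ b ∈ B w', G.Adj a b)
    {C : Set W} (hC : ConnOn H C) : ConnOn G (⋃ w ∈ C, B w) := by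
  obtain ⟨w₀, hw₀⟩ := hC.1
  obtain ⟨r, hr⟩ := (hB w₀).1
  have sub : ∀ w ∈ C, B w ⊆ ⋃ w ∈ C, B w := fun w hw => Set.subset_biUnion_of_mem hw
  have key : ∀ w, Reach H C w₀ w → ∀ x ∈ B w, Reach G (⋃ w ∈ C, B w) r x := by
    intro w hw
    induction hw with
    | refl => exact fun x hx => ((hB w₀).2 r hr x hx).mono (sub _ hw₀)
    | tail h1 h2 ih =>
      intro x hx
      obtain ⟨a, ha, b, hb, hab⟩ := hadj _ _ h2.1
      exact ((ih a ha).tail ⟨hab, sub _ h2.2.1 ha, sub _ h2.2.2 hb⟩).trans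
        (((hB _).2 b hb x hx).mono (sub _ h2.2.2))
  refine ConnOn.of_root (sub _ hw₀ hr) fun x hx => ?_
  simp only [Set.mem_iUnion] at hx
  obtain ⟨w, hw, hx⟩ := hx
  exact key w (hC.2 _ hw₀ _ hw) x hx

/-- `H` is a minor of `G`, witnessed by branch sets. -/
def IsMinor {V W : Type} (H : SimpleGraph W) (G : SimpleGraph V) : Prop :=
  ∃ B : W → Set V, (∀ w, ConnOn G (B w)) ∧ (∀ w w', w ≠ w' → Disjoint (B w) (B w')) ∧
    ∀ w w', H.Adj w w' → ∃ a ∈ B w, ∃ b ∈ B w', G.Adj a b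

lemma IsMinor.trans {U V W : Type} {F : SimpleGraph U} {H : SimpleGraph W} {G : SimpleGraph V}
    (h₁ : IsMinor F H) (h₂ : IsMinor H G) : IsMinor F G := by
  obtain ⟨A, hA, dA, eA⟩ := h₁
  obtain ⟨B, hB, dB, eB⟩ := h₂
  refine ⟨fun u => ⋃ w ∈ A u, B w, fun u => ConnOn.biUnion hB eB (hA u), ?_, ?_⟩
  · intro u u' huu'
    simp only [Set.disjoint_iUnion_left, Set.disjoint_iUnion_right]
    intro w hw w' hw'
    refine dB _ _ ?_
    rintro rfl
    exact Set.disjoint_left.1 (dA u u' huu') hw' hw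
  · intro u u' huu'
    obtain ⟨w, hw, w', hw', hww'⟩ := eA u u' huu'
    obtain ⟨a, ha, b, hb, hab⟩ := eB w w' hww'
    exact ⟨a, Set.mem_biUnion hw ha, b, Set.mem_biUnion hw' hb, hab⟩

lemma IsMinor.of_injective_hom {V W : Type} {H : SimpleGraph W} {G : SimpleGraph V} (f : W → V)
    (hf : Function.Injective f) (hadj : ∀ w w', H.Adj w w' → G.Adj (f w) (f w')) :
    IsMinor H G := by
  refine ⟨fun w => {f w}, fun w => ConnOn.singleton _ _, ?_, ?_⟩
  · intro w w' h
    simpa using fun e => h (hf e)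
  · intro w w' h
    exact ⟨_, rfl, _, rfl, hadj _ _ h⟩

/-- `G` has no `K₅` minor. -/
def K5Free {V : Type} (G : SimpleGraph V) : Prop := ¬ IsMinor (⊤ : SimpleGraph (Fin 5)) G

lemma K5Free.minor {V W : Type} {H : SimpleGraph W} {G : SimpleGraph V} (hG : K5Free G)
    (h : IsMinor H G) : K5Free H := fun h' => hG (h'.trans h)

/-- The simple graph obtained from `G` by identifying vertices along `f`. -/
def quotGraph {V W : Type} (G : SimpleGraph V) (f : V → W) : SimpleGraph W where
  Adj w w' := w ≠ w' ∧ ∃ a b, f a = w ∧ f b = w' ∧ G.Adj a b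
  symm := ⟨fun _ _ ⟨h, a, b, ha, hb, hab⟩ => ⟨h.symm, b, a, hb, ha, hab.symm⟩⟩
  loopless := ⟨fun _ h => h.1 rfl⟩

lemma quotGraph_isMinor {V W : Type} {G : SimpleGraph V} {f : V → W}
    (hf : ∀ w, ConnOn G {v | f v = w}) : IsMinor (quotGraph G f) G := by
  refine ⟨fun w => {v | f v = w}, hf, ?_, ?_⟩
  · intro w w' h
    rw [Set.disjoint_left]
    rintro a rfl h'
    exact h h'
  · rintro w w' ⟨-, a, b, ha, hb, hab⟩
    exact ⟨a, ha, b, hb, hab⟩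

/-- The set of ordered pairs of adjacent vertices. -/
def arcs {V : Type} [Fintype V] (G : SimpleGraph V) : Finset (V × V) :=
  univ.filter fun p => G.Adj p.1 p.2

lemma mem_arcs {V : Type} [Fintype V] {G : SimpleGraph V} {p : V × V} :
    p ∈ arcs G ↔ G.Adj p.1 p.2 := by simp [arcs]

lemma IsMinor.cone {V : Type} {G : SimpleGraph V} (x : V) {h : ℕ}
    (hm : IsMinor (⊤ : SimpleGraph (Fin h)) (G.comap ((↑) : {v // G.Adj x v} → V))) :
    IsMinor (⊤ : SimpleGraph (Fin (h + 1))) G := by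
  obtain ⟨B, hB, dB, eB⟩ := hm
  refine ⟨Fin.cons {x} fun i => (↑) '' B i, ?_, ?_, ?_⟩
  · intro w
    refine Fin.cases ?_ (fun i => ?_) w
    · exact ConnOn.singleton _ _
    · simp only [Fin.cons_succ]
      refine ⟨(hB i).1.image _, ?_⟩
      rintro _ ⟨a, ha, rfl⟩ _ ⟨b, hb, rfl⟩
      have := (hB i).2 a ha b hb
      clear hb
      induction this with
      | refl => exact .refl
      | tail _ h2 ih => exact ih.tail ⟨h2.1, ⟨_, h2.2.1, rfl⟩, ⟨_, h2.2.2, rfl⟩⟩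
  · intro w w'
    have nx : ∀ i, x ∉ ((↑) '' B i : Set V) := by
      rintro i ⟨a, -, ha⟩
      exact G.irrefl (ha ▸ a.2)
    refine Fin.cases ?_ (fun i => ?_) w <;> refine Fin.cases ?_ (fun j => ?_) w'
    · simp
    · simp
    · simp
    · intro hij
      simp only [Fin.cons_succ]
      refine (Set.disjoint_image_iff Subtype.val_injective).2 (dB i j ?_)
      rintro rfl
      exact hij rfl
  · intro w w'
    refine Fin.cases ?_ (fun i => ?_) w <;> refine Fin.cases ?_ (fun j => ?_) w'
    · simp
    · intro _
      obtain ⟨b, hb⟩ := (hB j).1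
      exact ⟨x, rfl, b, ⟨b, hb, rfl⟩, b.2⟩
    · intro _
      obtain ⟨b, hb⟩ := (hB i).1
      exact ⟨b, ⟨b, hb, rfl⟩, x, rfl, b.2.symm⟩
    · intro hij
      obtain ⟨a, ha, b, hb, hab⟩ := eB i j (by
        rintro rfl
        simp at hij)
      exact ⟨a, ⟨a, ha, rfl⟩, b, ⟨b, hb, rfl⟩, hab⟩

/-- Contracting an edge loses at most two arcs plus two for each common neighbor. -/
lemma exists_contraction {V : Type} [Fintype V] (G : SimpleGraph V) {x y : V} (hxy : G.Adj x y) :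
    ∃ H : SimpleGraph {v // v ≠ y}, IsMinor H G ∧
      #(arcs G) ≤ #(arcs H) + 2 * (1 + #(univ.filter fun z => G.Adj x z ∧ G.Adj y z)) := by
  set C := univ.filter fun z => G.Adj x z ∧ G.Adj y z with hC
  have hne : x ≠ y := hxy.ne
  set f : V → {v // v ≠ y} := fun v => if h : v = y then ⟨x, hne⟩ else ⟨v, h⟩ with hf
  have fy : f y = ⟨x, hne⟩ := by simp [hf]
  have fo : ∀ v, (h : v ≠ y) → f v = ⟨v, h⟩ := fun v h => by simp [hf, h]
  refine ⟨quotGraph G f, quotGraph_isMinor ?_, ?_⟩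
  · rintro ⟨w, hw⟩
    by_cases h : w = x
    · subst h
      have : {v | f v = ⟨w, hw⟩} = {w} ∪ {y} := by
        ext v
        by_cases hv : v = y
        · subst hv; simp [fy]
        · simp [fo v hv, hv]
      rw [this]
      exact (ConnOn.singleton _ _).union (ConnOn.singleton _ _) rfl rfl hxy
    · have : {v | f v = ⟨w, hw⟩} = {w} := by
        ext v
        by_cases hv : v = y
        · subst hv; simp [fy, Ne.symm h, Ne.symm hw]
        · simp [fo v hv]
      rw [this]
      exact ConnOn.singleton _ _
  · set E : Finset (V × V) := (insert (x, y) (C.image fun z => (z, y))) ∪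
      (insert (y, x) (C.image fun z => (y, z))) with hE
    have cE : #E ≤ 2 * (1 + #C) := by
      refine (card_union_le _ _).trans ?_
      have h1 := (card_insert_le (x, y) (C.image fun z => (z, y)))
      have h2 := (card_insert_le (y, x) (C.image fun z => (y, z)))
      have h3 := card_image_le (s := C) (f := fun z => (z, y))
      have h4 := card_image_le (s := C) (f := fun z => (y, z))
      omega
    have key : #(arcs G \ E) ≤ #(arcs (quotGraph G f)) := by
      refine card_le_card_of_injOn (fun p => (f p.1, f p.2)) ?_ ?_
      · rintro ⟨a, b⟩ hab
        simp only [hE, hC, coe_sdiff, Set.mem_sdiff, mem_coe, mem_arcs, mem_union, mem_insert,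
          mem_image, mem_filter, mem_univ, true_and, not_or, Prod.mk.injEq] at hab
        simp only [mem_coe, mem_arcs]
        refine ⟨?_, a, b, rfl, rfl, hab.1⟩
        intro e
        have := hab.1.ne
        by_cases ha : a = y <;> by_cases hb : b = y
        · exact this (ha.trans hb.symm)
        · rw [ha, fy, fo b hb, Subtype.mk.injEq] at e
          exact hab.2.2.1 ⟨ha, e.symm⟩
        · rw [hb, fy, fo a ha, Subtype.mk.injEq] at e
          exact hab.2.1.1 ⟨e, hb⟩
        · rw [fo a ha, fo b hb, Subtype.mk.injEq] at e
          exact this e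
      · rintro ⟨a, b⟩ hab ⟨a', b'⟩ hab' e
        simp only [hE, hC, coe_sdiff, Set.mem_sdiff, mem_coe, mem_arcs, mem_union, mem_insert,
          mem_image, mem_filter, mem_univ, true_and, not_or, Prod.mk.injEq, not_exists] at hab hab' e
        have fx := fo x hne
        have inj : ∀ u v, f u = f v → u = v ∨ (u = x ∧ v = y) ∨ (u = y ∧ v = x) := by
          intro u v huv
          by_cases hu : u = y <;> by_cases hv : v = y
          · exact Or.inl (hu.trans hv.symm)
          · rw [hu, fy, fo v hv, Subtype.mk.injEq] at huv; exact Or.inr (Or.inr ⟨hu, huv.symm⟩)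
          · rw [hv, fy, fo u hu, Subtype.mk.injEq] at huv; exact Or.inr (Or.inl ⟨huv, hv⟩)
          · rw [fo u hu, fo v hv, Subtype.mk.injEq] at huv; exact Or.inl huv
        obtain ⟨h1, ⟨h2, h3⟩, h4, h5⟩ := hab
        obtain ⟨h1', ⟨h2', h3'⟩, h4', h5'⟩ := hab'
        have s1 := h1.symm
        have s1' := h1'.symm
        have i1 := G.irrefl (v := x)
        have i2 := G.irrefl (v := y)
        rcases inj _ _ e.1 with r | ⟨r, r'⟩ | ⟨r, r'⟩ <;>
          rcases inj _ _ e.2 with q | ⟨q, q'⟩ | ⟨q, q'⟩ <;> grind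
    have := le_card_sdiff E (arcs G)
    omega

/-- A dense graph has a complete minor. -/
theorem complete_minor_of_dense (h : ℕ) : ∀ (n : ℕ) (V : Type) [Fintype V] (G : SimpleGraph V),
    Fintype.card V = n → 0 < n → 2 ^ (h + 1) * n ≤ #(arcs G) →
    IsMinor (⊤ : SimpleGraph (Fin (h + 2))) G := by
  induction h with
  | zero =>
    intro n V _ G _ hn hG
    have : (arcs G).Nonempty := card_pos.1 (by omega)
    obtain ⟨⟨a, b⟩, hab⟩ := this
    rw [mem_arcs] at hab
    refine IsMinor.of_injective_hom ![a, b] ?_ ?_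
    · intro i j
      have := hab.ne
      have := hab.ne'
      fin_cases i <;> fin_cases j <;> simp_all
    · intro i j
      have := hab.symm
      fin_cases i <;> fin_cases j <;> simp_all
  | succ h ih =>
    intro n
    induction n with
    | zero => intro V _ G _ h0; omega
    | succ n ihn =>
      intro V _ G hV _ hG
      have : (arcs G).Nonempty := card_pos.1 (by
        refine lt_of_lt_of_le ?_ hG
        positivity)
      obtain ⟨⟨x₀, y₀⟩, h₀⟩ := this
      rw [mem_arcs] at h₀
      by_cases hc : ∃ x y, G.Adj x y ∧ 1 + #(univ.filter fun z => G.Adj x z ∧ G.Adj y z) ≤ 2 ^ (h + 1)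
      · obtain ⟨x, y, hxy, hc⟩ := hc
        obtain ⟨H, hH, hcard⟩ := exists_contraction G hxy
        have hVy : Fintype.card {v // v ≠ y} = n := by
          rw [Fintype.card_subtype_compl, hV]; simp
        have n0 : 0 < n := by
          rw [← hVy]
          exact Fintype.card_pos_iff.2 ⟨⟨x, hxy.ne⟩⟩
        refine IsMinor.trans (ihn _ H hVy n0 ?_) hH
        have e : 2 ^ (h + 1 + 1) * (n + 1) = 2 ^ (h + 1 + 1) * n + 2 * 2 ^ (h + 1) := by ring
        omega
      · push Not at hc
        refine IsMinor.cone x₀ (ih _ _ _ rfl (Fintype.card_pos_iff.2 ⟨⟨y₀, h₀⟩⟩) ?_)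
        set N := {v // G.Adj x₀ v}
        have hdeg : ∀ v : N, 2 ^ (h + 1) ≤ #(univ.filter fun z : N => G.Adj v z) := by
          intro v
          have h1 := hc x₀ v v.2
          have : #(univ.filter fun z => G.Adj x₀ z ∧ G.Adj v z) ≤
              #(univ.filter fun z : N => G.Adj v z) := by
            rw [← card_image_of_injective (univ.filter fun z : N => G.Adj v z)
              Subtype.val_injective]
            refine card_le_card fun z hz => ?_
            simp only [mem_filter, mem_univ, true_and] at hz
            simp only [mem_image, mem_filter, mem_univ, true_and]
            exact ⟨⟨z, hz.1⟩, hz.2, rfl⟩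
          omega
        have e : arcs (G.comap ((↑) : N → V)) =
            (univ : Finset N).biUnion fun v => (univ.filter fun z : N => G.Adj v z).image
              fun z => (v, z) := by
          ext ⟨a, b⟩
          simp [mem_arcs]
        rw [e, card_biUnion]
        · have : ∀ v : N, #((univ.filter fun z : N => G.Adj v z).image fun z => (v, z)) =
              #(univ.filter fun z : N => G.Adj v z) := by
            intro v
            exact card_image_of_injective _ (Prod.mk_right_injective v)
          simp only [this]
          refine le_trans (le_of_eq ?_) (sum_le_sum fun v _ => hdeg v)
          rw [sum_const, smul_eq_mul, mul_comm, card_univ]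
        · intro a _ b _ hab
          rw [Function.onFun, disjoint_left]
          simp only [mem_image, not_exists, not_and]
          rintro _ ⟨z, -, rfl⟩ z' - e
          exact hab (Prod.mk.inj e).1.symm

lemma K5Free.card_arcs_le {V : Type} [Fintype V] {G : SimpleGraph V} (hG : K5Free G) :
    #(arcs G) ≤ 16 * Fintype.card V := by
  by_contra! h
  rcases Nat.eq_zero_or_pos (Fintype.card V) with h0 | h0
  · have : IsEmpty V := Fintype.card_eq_zero_iff.1 h0
    have : arcs G = ∅ := by
      ext p
      exact isEmptyElim p.1
    simp [this] at h
  · exact hG (complete_minor_of_dense 3 _ V G rfl h0 (by norm_num; omega))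

lemma card_arcs {V : Type} [Fintype V] (G : SimpleGraph V) :
    #(arcs G) = ∑ v, #(univ.filter fun z => G.Adj v z) := by
  simp only [arcs, card_filter, Fintype.sum_prod_type]

lemma K5Free.comap {V W : Type} {G : SimpleGraph V} (hG : K5Free G) {f : W → V}
    (hf : Function.Injective f) : K5Free (G.comap f) :=
  hG.minor (IsMinor.of_injective_hom f hf fun _ _ h => h)

lemma K5Free.exists_degree_le {V : Type} {G : SimpleGraph V} (hG : K5Free G)
    {S : Finset V} (hS : S.Nonempty) : ∃ v ∈ S, #(S.filter fun z => G.Adj v z) ≤ 16 := by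
  by_contra! h
  have h1 := (hG.comap (f := ((↑) : S → V)) Subtype.val_injective).card_arcs_le
  obtain ⟨H, hH⟩ : ∃ H, H = G.comap ((↑) : S → V) := ⟨_, rfl⟩
  rw [← hH, card_arcs, Fintype.card_coe] at h1
  have h2 : ∀ v : S, 17 ≤ #(univ.filter fun z => H.Adj v z) := by
    intro v
    refine (h v v.2).trans_eq ?_
    rw [← card_image_of_injective (univ.filter fun z : S => H.Adj v z) Subtype.val_injective]
    congr 1
    ext z
    simp [hH, and_comm]
  have h3 : ∑ v : S, 17 ≤ ∑ v : S, #(univ.filter fun z => H.Adj v z) :=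
    sum_le_sum fun v _ => h2 v
  have := card_pos.2 hS
  simp only [sum_const, smul_eq_mul, card_univ, Fintype.card_coe] at h3
  omega

/-- The cliques of `G` contained in `S`. -/
def cliquesIn {V : Type} (G : SimpleGraph V) (S : Finset V) : Finset (Finset V) :=
  S.powerset.filter fun K => ∀ x ∈ K, ∀ y ∈ K, x ≠ y → G.Adj x y

lemma K5Free.card_cliquesIn_le {V : Type} {G : SimpleGraph V} (hG : K5Free G) (S : Finset V) :
    #(cliquesIn G S) ≤ 2 ^ 16 * #S + 1 := by
  induction S using Finset.strongInduction with
  | H S ih =>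
    rcases S.eq_empty_or_nonempty with rfl | hS
    · refine (card_filter_le _ _).trans ?_
      simp
    obtain ⟨v, hv, hdeg⟩ := hG.exists_degree_le hS
    have h1 := ih (S.erase v) (erase_ssubset hv)
    have h2 : cliquesIn G S ⊆ cliquesIn G (S.erase v) ∪
        (S.filter fun z => G.Adj v z).powerset.image fun K => insert v K := by
      intro K hK
      simp only [cliquesIn, mem_filter, mem_powerset] at hK
      rw [mem_union]
      by_cases hvK : v ∈ K
      · refine Or.inr (mem_image.2 ⟨K.erase v, ?_, insert_erase hvK⟩)
        rw [mem_powerset]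
        intro z hz
        rw [mem_erase] at hz
        exact mem_filter.2 ⟨hK.1 hz.2, hK.2 v hvK z hz.2 hz.1.symm⟩
      · refine Or.inl ?_
        simp only [cliquesIn, mem_filter, mem_powerset]
        exact ⟨subset_erase.2 ⟨hK.1, hvK⟩, hK.2⟩
    have h3 := card_le_card h2
    have h4 := card_union_le (cliquesIn G (S.erase v))
      ((S.filter fun z => G.Adj v z).powerset.image fun K => insert v K)
    have h5 := card_image_le (s := (S.filter fun z => G.Adj v z).powerset) (f := fun K => insert v K)
    rw [card_powerset] at h5
    have h6 : 2 ^ #(S.filter fun z => G.Adj v z) ≤ 2 ^ 16 := Nat.pow_le_pow_right (by norm_num) hdeg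
    have h7 := card_erase_add_one hv
    omega

/-- In a graph without `K₅` minor, the vertices of an independent set have few distinct
neighborhoods. -/
theorem K5Free.card_neighborhoods_le {V : Type} [Fintype V] {G : SimpleGraph V} (hG : K5Free G)
    (B : Finset V) (hB : ∀ u v, u ∉ B → v ∉ B → ¬ G.Adj u v) :
    #(Bᶜ.image fun v => univ.filter fun z => G.Adj v z) ≤ 2 ^ 17 * #B + 1 := by
  let good : Finset (V × V × V) → Prop := fun T =>
    (∀ p ∈ T, p.1 ∉ B ∧ p.2.1 ≠ p.2.2 ∧ G.Adj p.1 p.2.1 ∧ G.Adj p.1 p.2.2) ∧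
    (∀ p ∈ T, ∀ q ∈ T, p.1 = q.1 → p = q) ∧
    (∀ p ∈ T, ∀ q ∈ T, p.2.1 = q.2.1 → p.2.2 = q.2.2 → p = q) ∧
    (∀ p ∈ T, ∀ q ∈ T, p.2.1 = q.2.2 → p.2.2 = q.2.1 → p = q)
  obtain ⟨T, hT⟩ : ∃ T, Maximal good T := by
    have : (univ.filter good).Nonempty := ⟨∅, by simp [good]⟩
    obtain ⟨T, hT, hmax⟩ := exists_max_image _ card this
    refine ⟨T, (mem_filter.1 hT).2, fun T' hT' hle => ?_⟩
    exact (eq_of_subset_of_card_le hle (hmax T' (mem_filter.2 ⟨mem_univ _, hT'⟩))).ge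
  obtain ⟨⟨t1, t2, t3, t4⟩, hmax⟩ := hT
  have memB : ∀ p ∈ T, p.2.1 ∈ B ∧ p.2.2 ∈ B := fun p hp =>
    ⟨by_contra fun h => hB _ _ (t1 p hp).1 h (t1 p hp).2.2.1,
     by_contra fun h => hB _ _ (t1 p hp).1 h (t1 p hp).2.2.2⟩
  let H : SimpleGraph B :=
    { Adj := fun x y => ∃ v, (v, (x : V), (y : V)) ∈ T ∨ (v, (y : V), (x : V)) ∈ T
      symm := ⟨fun _ _ ⟨v, h⟩ => ⟨v, h.symm⟩⟩
      loopless := ⟨fun x ⟨v, h⟩ => by rcases h with h | h <;> exact (t1 _ h).2.1 rfl⟩ }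
  have hH : IsMinor H G := by
    refine ⟨fun x => insert (x : V) {v | ∃ y, (v, (x : V), y) ∈ T}, ?_, ?_, ?_⟩
    · intro x
      refine ConnOn.of_root (r := (x : V)) (Or.inl rfl) ?_
      rintro v (rfl | ⟨y, hy⟩)
      · exact .refl
      · exact .single ⟨(t1 _ hy).2.2.1.symm, Or.inl rfl, Or.inr ⟨y, hy⟩⟩
    · intro x x' hxx'
      rw [Set.disjoint_left]
      rintro v (rfl | ⟨y, hy⟩) (e | ⟨y', hy'⟩)
      · exact hxx' (Subtype.ext e)
      · exact (t1 _ hy').1 x.2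
      · exact (t1 _ hy).1 (by rw [e]; exact x'.2)
      · have := t2 _ hy _ hy' rfl
        simp only [Prod.mk.injEq, true_and] at this
        exact hxx' (Subtype.ext this.1)
    · rintro x y ⟨v, h | h⟩
      · exact ⟨v, Or.inr ⟨y, h⟩, y, Or.inl rfl, (t1 _ h).2.2.2⟩
      · exact ⟨x, Or.inl rfl, v, Or.inr ⟨x, h⟩, (t1 _ h).2.2.2.symm⟩
  have hT16 : #T ≤ 16 * #B := by
    have := (hG.minor hH).card_arcs_le
    rw [Fintype.card_coe] at this
    refine le_trans ?_ this
    refine card_le_card_of_surjOn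
      (fun p => if h : ∃ v, (v, (p.1 : V), (p.2 : V)) ∈ T then (h.choose, (p.1 : V), (p.2 : V))
        else ((p.1 : V), (p.1 : V), (p.1 : V))) ?_
    intro p hp
    have hm := memB p hp
    refine ⟨(⟨p.2.1, hm.1⟩, ⟨p.2.2, hm.2⟩), ?_, ?_⟩
    · rw [mem_coe, mem_arcs]
      exact ⟨p.1, Or.inl hp⟩
    · have hex : ∃ v, (v, p.2.1, p.2.2) ∈ T := ⟨p.1, hp⟩
      simp only [hex, dite_true]
      exact t3 _ hex.choose_spec _ hp rfl rfl
  set nb : V → Finset V := fun v => univ.filter fun z => G.Adj v z with hnb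
  have hsub : Bᶜ.image nb ⊆ (T.image fun p => nb p.1) ∪
      (cliquesIn H univ).image fun K => K.map (Function.Embedding.subtype _) := by
    intro N hN
    obtain ⟨v, hv, rfl⟩ := mem_image.1 hN
    rw [mem_compl] at hv
    rw [mem_union]
    by_cases hvT : ∃ p ∈ T, p.1 = v
    · obtain ⟨p, hp, rfl⟩ := hvT
      exact Or.inl (mem_image.2 ⟨p, hp, rfl⟩)
    refine Or.inr (mem_image.2 ⟨univ.filter fun z => G.Adj v z, ?_, ?_⟩)
    · simp only [cliquesIn, mem_filter, mem_powerset, mem_univ, true_and]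
      refine ⟨subset_univ _, ?_⟩
      intro x hx y hy hxy
      by_contra hcon
      have hn : ∀ w, (w, (x : V), (y : V)) ∉ T ∧ (w, (y : V), (x : V)) ∉ T := fun w =>
        ⟨fun h => hcon ⟨w, Or.inl h⟩, fun h => hcon ⟨w, Or.inr h⟩⟩
      have hxy' : (x : V) ≠ y := fun e => hxy (Subtype.ext e)
      have hg : good (insert (v, (x : V), (y : V)) T) := by
        refine ⟨?_, ?_, ?_, ?_⟩
        · intro p hp
          rcases mem_insert.1 hp with rfl | hp
          · exact ⟨hv, hxy', hx, hy⟩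
          · exact t1 p hp
        · intro p hp q hq e
          rcases mem_insert.1 hp with rfl | hp' <;> rcases mem_insert.1 hq with rfl | hq'
          · rfl
          · exact absurd ⟨q, hq', e.symm⟩ hvT
          · exact absurd ⟨p, hp', e⟩ hvT
          · exact t2 p hp' q hq' e
        · rintro ⟨p, p1, p2⟩ hp ⟨q, q1, q2⟩ hq e e'
          dsimp only at e e'
          subst e e'
          rcases mem_insert.1 hp with h1 | hp' <;> rcases mem_insert.1 hq with h2 | hq'
          · rw [h1, h2]
          · simp only [Prod.mk.injEq] at h1
            obtain ⟨rfl, rfl, rfl⟩ := h1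
            exact absurd hq' (hn _).1
          · simp only [Prod.mk.injEq] at h2
            obtain ⟨rfl, rfl, rfl⟩ := h2
            exact absurd hp' (hn _).1
          · exact t3 _ hp' _ hq' rfl rfl
        · rintro ⟨p, p1, p2⟩ hp ⟨q, q1, q2⟩ hq e e'
          dsimp only at e e'
          subst e e'
          rcases mem_insert.1 hp with h1 | hp' <;> rcases mem_insert.1 hq with h2 | hq'
          · rw [h1, h2]
          · simp only [Prod.mk.injEq] at h1
            obtain ⟨rfl, rfl, rfl⟩ := h1
            exact absurd hq' (hn _).2
          · simp only [Prod.mk.injEq] at h2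
            obtain ⟨rfl, rfl, rfl⟩ := h2
            exact absurd hp' (hn _).2
          · exact t4 _ hp' _ hq' rfl rfl
      exact (hn v).1 (hmax hg (subset_insert _ _) (mem_insert_self _ _))
    · ext z
      simp only [mem_map, mem_filter, mem_univ, true_and, Function.Embedding.subtype_apply,
        Subtype.exists, exists_and_left, exists_prop, hnb]
      constructor
      · rintro ⟨a, h1, -, rfl⟩
        exact h1
      · intro h
        exact ⟨z, h, by_contra fun h' => hB _ _ hv h' h, rfl⟩
  have h1 := card_le_card hsub
  have h2 := card_union_le (T.image fun p => nb p.1)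
    ((cliquesIn H univ).image fun K => K.map (Function.Embedding.subtype _))
  have h3 := card_image_le (s := T) (f := fun p => nb p.1)
  have h4 := card_image_le (s := cliquesIn H univ)
    (f := fun K => K.map (Function.Embedding.subtype _))
  have h5 := (hG.minor hH).card_cliquesIn_le univ
  rw [card_univ, Fintype.card_coe] at h5
  omega

/-- The graphs on `V` without `K₅` minor. -/
def k5FreeGraphs (V : Type) [Fintype V] : Finset (SimpleGraph V) := univ.filter K5Free

lemma card_k5FreeGraphs_congr {V W : Type} [Fintype V] [Fintype W]
    (h : Fintype.card V = Fintype.card W) : #(k5FreeGraphs V) ≤ #(k5FreeGraphs W) := by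
  let e := Fintype.equivOfCardEq h
  refine card_le_card_of_injOn (fun G => G.comap e.symm) ?_ ?_
  · intro G hG
    simp only [k5FreeGraphs, coe_filter, mem_univ, true_and, Set.mem_ofPred_eq] at hG ⊢
    exact hG.comap e.symm.injective
  · intro G _ H _ h
    ext a b
    have := congrArg (fun K : SimpleGraph W => K.Adj (e a) (e b)) h
    simpa using this

/-- `f` encodes a matching of `G`: each moved vertex is matched to its image. -/
structure FitsMatching {V : Type} (f : V → V) (G : SimpleGraph V) : Prop where
  idem : ∀ v, f (f v) = f v
  inj : ∀ u v, f u ≠ u → f v ≠ v → f u = f v → u = v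
  adj : ∀ v, f v ≠ v → G.Adj v (f v)

/-- The vertices moved by `f`. -/
def moved {V : Type} [Fintype V] (f : V → V) : Finset V := univ.filter fun v => f v ≠ v

lemma mem_moved {V : Type} [Fintype V] {f : V → V} {v : V} : v ∈ moved f ↔ f v ≠ v := by
  simp [moved]

/-- The vertices fixed by `f`. -/
def fixed {V : Type} [Fintype V] (f : V → V) : Finset V := univ.filter fun v => f v = v

lemma mem_fixed {V : Type} [Fintype V] {f : V → V} {v : V} : v ∈ fixed f ↔ f v = v := by
  simp [fixed]

lemma FitsMatching.restrict {V : Type} [Fintype V] {f : V → V} {G : SimpleGraph V}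
    (h : FitsMatching f G) {a : ℕ} (ha : a ≤ #(moved f)) :
    ∃ g, FitsMatching g G ∧ #(moved g) = a := by
  obtain ⟨D, hD, rfl⟩ := exists_subset_card_eq ha
  have hD' : ∀ v ∈ D, f v ≠ v := fun v hv => mem_moved.1 (hD hv)
  have hnD : ∀ v, f v ∉ D := fun v hv => hD' _ hv (h.idem v)
  refine ⟨fun v => if v ∈ D then f v else v, ⟨?_, ?_, ?_⟩, ?_⟩
  · intro v
    by_cases hv : v ∈ D <;> simp [hv, hnD]
  · intro u v hu hv e
    have hu' : u ∈ D := by_contra fun hu' => hu (if_neg hu')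
    have hv' : v ∈ D := by_contra fun hv' => hv (if_neg hv')
    simp only [hu', hv', if_true] at e hu hv
    exact h.inj u v hu hv e
  · intro v hv
    have hv' : v ∈ D := by_contra fun hv' => hv (if_neg hv')
    simp only [hv', if_true] at hv ⊢
    exact h.adj v hv
  · congr 1
    ext v
    rw [mem_moved]
    by_cases hv : v ∈ D
    · simp [hv, hD' v hv]
    · simp [hv]

/-- The maps moving exactly `a` vertices. -/
def mapsMoving (V : Type) [Fintype V] (a : ℕ) : Finset (V → V) :=
  univ.filter fun f => #(moved f) = a

lemma mem_mapsMoving {V : Type} [Fintype V] {a : ℕ} {f : V → V} :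
    f ∈ mapsMoving V a ↔ #(moved f) = a := by simp [mapsMoving]

lemma card_mapsMoving_le {V : Type} [Fintype V] (a : ℕ) :
    #(mapsMoving V a) ≤ 2 ^ Fintype.card V * Fintype.card V ^ a := by
  refine (card_le_mul_card_image (f := moved) _ (Fintype.card V ^ a) ?_).trans ?_
  · intro D hD
    obtain ⟨f₀, hf₀, rfl⟩ := mem_image.1 hD
    have h0 := (mem_filter.1 hf₀).2
    have : Fintype.card (moved f₀ → V) = Fintype.card V ^ a := by
      rw [Fintype.card_fun, Fintype.card_coe, h0]
    rw [← this, ← card_univ]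
    refine card_le_card_of_injOn (fun f v => f v) (fun _ _ => mem_coe.2 (mem_univ _)) ?_
    intro f hf g hg hfg
    simp only [mapsMoving, coe_filter, mem_filter, mem_univ, true_and, Set.mem_ofPred_eq] at hf hg
    ext v
    by_cases hv : v ∈ moved f₀
    · exact congrFun hfg ⟨v, hv⟩
    · have h1 : v ∉ moved f := hf.2 ▸ hv
      have h2 : v ∉ moved g := hg.2 ▸ hv
      simp only [mem_moved, not_not] at h1 h2
      rw [h1, h2]
  · rw [mul_comm]
    refine Nat.mul_le_mul_right _ ?_
    refine (card_le_univ _).trans ?_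
    simp

lemma card_fits_le {V : Type} [Fintype V] (f : V → V) :
    #((k5FreeGraphs V).filter fun G => FitsMatching f G) ≤
      #(k5FreeGraphs (Fin (Fintype.card V - #(moved f)))) * 2 ^ (64 * Fintype.card V) := by
  by_cases hidem : ∀ v, f (f v) = f v
  swap
  · rw [filter_false_of_mem fun G _ h => hidem h.idem]
    simp
  let W := {v // f v = v}
  let r : V → W := fun v => ⟨f v, hidem v⟩
  have hW : Fintype.card W = Fintype.card V - #(moved f) := by
    rw [Fintype.card_subtype, ← card_univ,
      ← card_filter_add_card_filter_not (s := univ) (fun v => f v = v), moved]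
    simp
  have hconn : ∀ G, FitsMatching f G → ∀ w : W, ConnOn G {v | r v = w} := by
    rintro G hG ⟨w, hw⟩
    refine ConnOn.of_root (r := w) (Subtype.ext hw) ?_
    intro v hv
    have hv' : f v = w := congrArg Subtype.val hv
    by_cases e : v = w
    · rw [e]; exact .refl
    · have := hG.adj v (by rw [hv']; exact Ne.symm e)
      rw [hv'] at this
      exact .single ⟨this.symm, Subtype.ext hw, hv⟩
  have hmaps : ((k5FreeGraphs V).filter fun G => FitsMatching f G).image
      (fun G => quotGraph G r) ⊆ k5FreeGraphs W := by
    intro H hH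
    obtain ⟨G, hG, rfl⟩ := mem_image.1 hH
    simp only [k5FreeGraphs, mem_filter, mem_univ, true_and] at hG ⊢
    exact hG.1.minor (quotGraph_isMinor (hconn G hG.2))
  have himg : #(((k5FreeGraphs V).filter fun G => FitsMatching f G).image
      (fun G => quotGraph G r)) ≤ #(k5FreeGraphs (Fin (Fintype.card V - #(moved f)))) :=
    (card_le_card hmaps).trans (card_k5FreeGraphs_congr (by rw [hW, Fintype.card_fin]))
  refine (card_le_mul_card_image (f := fun G => quotGraph G r) _
    (2 ^ (64 * Fintype.card V)) ?_).trans ?_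
  swap
  · rw [mul_comm]
    exact Nat.mul_le_mul_right _ himg
  intro H hH
  have hHK := (mem_filter.1 (hmaps hH)).2
  let lift : W → Bool → V := fun w b => if h : b = true ∧ ∃ v, f v = w ∧ v ≠ w
    then h.2.choose else w
  have hlift : ∀ G, FitsMatching f G → ∀ v, ∃ b, lift (r v) b = v := by
    intro G hG v
    by_cases hv : f v = v
    · refine ⟨false, ?_⟩
      simp [lift, r, hv]
    · refine ⟨true, ?_⟩
      have hex : ∃ v', f v' = (r v : V) ∧ v' ≠ (r v : V) := ⟨v, rfl, Ne.symm hv⟩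
      have : lift (r v) true = hex.choose := by
        simp only [lift]
        rw [dif_pos ⟨trivial, hex⟩]
      rw [this]
      have hs := hex.choose_spec
      refine hG.inj _ _ ?_ hv hs.1
      rw [hs.1]
      exact hs.2.symm
  have hcard : #(arcs H ×ˢ (univ : Finset (Bool × Bool))) ≤ 64 * Fintype.card V := by
    rw [card_product]
    have h1 := hHK.card_arcs_le
    have h2 : Fintype.card W ≤ Fintype.card V := Fintype.card_subtype_le _
    have h3 : #(univ : Finset (Bool × Bool)) = 4 := by decide
    rw [h3]
    omega
  refine le_trans ?_ (Nat.pow_le_pow_right (by norm_num) hcard)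
  rw [← card_powerset]
  refine card_le_card_of_injOn (fun G => (arcs H ×ˢ (univ : Finset (Bool × Bool))).filter
    fun p => G.Adj (lift p.1.1 p.2.1) (lift p.1.2 p.2.2)) ?_ ?_
  · intro G _
    rw [mem_coe, mem_powerset]
    exact filter_subset _ _
  · intro G hG G' hG' e
    simp only [coe_filter, mem_filter, Set.mem_ofPred_eq] at hG hG'
    have main : ∀ G G' : SimpleGraph V, FitsMatching f G → FitsMatching f G' → quotGraph G r = H →
        ((arcs H ×ˢ (univ : Finset (Bool × Bool))).filter
          fun p => G.Adj (lift p.1.1 p.2.1) (lift p.1.2 p.2.2)) =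
        ((arcs H ×ˢ (univ : Finset (Bool × Bool))).filter
          fun p => G'.Adj (lift p.1.1 p.2.1) (lift p.1.2 p.2.2)) →
        ∀ x y, G.Adj x y → G'.Adj x y := by
      intro G G' hG hG' hGH e x y hxy
      by_cases hr : r x = r y
      · have hr' : f x = f y := congrArg Subtype.val hr
        by_cases hx : f x = x
        · have hy : f y ≠ y := fun hy => hxy.ne (hx.symm.trans (hr'.trans hy))
          have := hG'.adj y hy
          rw [← hr', hx] at this
          exact this.symm
        · by_cases hy : f y = y
          · have := hG'.adj x hx
            rwa [hr', hy] at this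
          · exact absurd (hG.inj x y hx hy hr') hxy.ne
      · obtain ⟨b, hb⟩ := hlift G hG x
        obtain ⟨b', hb'⟩ := hlift G hG y
        have : ((r x, r y), (b, b')) ∈ ((arcs H ×ˢ (univ : Finset (Bool × Bool))).filter
            fun p => G.Adj (lift p.1.1 p.2.1) (lift p.1.2 p.2.2)) := by
          rw [mem_filter]
          refine ⟨mem_product.2 ⟨?_, mem_univ _⟩, ?_⟩
          · rw [mem_arcs, ← hGH]
            exact ⟨hr, x, y, rfl, rfl, hxy⟩
          · simp only [hb, hb']
            exact hxy
        rw [e, mem_filter] at this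
        have := this.2
        simpa only [hb, hb'] using this
    ext x y
    exact ⟨main G G' hG.1.2 hG'.1.2 hG.2 e x y, main G' G hG'.1.2 hG.1.2 hG'.2 e.symm x y⟩

/-- The graphs without `K₅` minor containing one of the matchings in `M`. -/
def graphsFitting {V : Type} [Fintype V] (M : Finset (V → V)) : Finset (SimpleGraph V) :=
  (k5FreeGraphs V).filter fun G => ∃ f ∈ M, FitsMatching f G

lemma mem_graphsFitting {V : Type} [Fintype V] {M : Finset (V → V)} {G : SimpleGraph V} :
    G ∈ graphsFitting M ↔ K5Free G ∧ ∃ f ∈ M, FitsMatching f G := by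
  simp [graphsFitting, k5FreeGraphs]

/-- Few graphs without `K₅` minor contain one of few matchings of a given size. -/
lemma card_exists_fits_le {V : Type} [Fintype V] (M : Finset (V → V)) (a : ℕ)
    (hM : ∀ f ∈ M, #(moved f) = a) :
    #(graphsFitting M) ≤
      #M * (#(k5FreeGraphs (Fin (Fintype.card V - a))) * 2 ^ (64 * Fintype.card V)) := by
  have : graphsFitting M ⊆
      M.biUnion fun f => (k5FreeGraphs V).filter fun G => FitsMatching f G := by
    intro G hG
    obtain ⟨hG, f, hf, h⟩ := mem_filter.1 hG
    exact mem_biUnion.2 ⟨f, hf, mem_filter.2 ⟨hG, h⟩⟩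
  refine (card_le_card this).trans (card_biUnion_le_card_mul _ _ _ fun f hf => ?_)
  have := card_fits_le f
  rwa [hM f hf] at this

/-- A graph without `K₅` minor and without large matching is determined by few vertices. -/
lemma K5Free.exists_retraction {V : Type} [Fintype V] {G : SimpleGraph V} (hG : K5Free G) {a : ℕ}
    (ha : ∀ f, FitsMatching f G → #(moved f) < a) :
    ∃ g : V → V, (∀ v, g (g v) = g v) ∧
      #(fixed g) ≤ (2 ^ 18 + 2) * a + 1 ∧
      ∀ x y, G.Adj x y ↔ G.Adj (g x) (g y) := by
  rcases isEmpty_or_nonempty V with hV | ⟨⟨v₀⟩⟩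
  · exact ⟨id, fun v => rfl, by simp [fixed], fun v => isEmptyElim v⟩
  have hne : (univ.filter fun f => FitsMatching f G).Nonempty :=
    ⟨id, mem_filter.2 ⟨mem_univ _, ⟨fun _ => rfl, fun _ _ h => (h rfl).elim,
      fun _ h => (h rfl).elim⟩⟩⟩
  obtain ⟨f, hf, hmax⟩ := exists_max_image _ (fun f => #(moved f)) hne
  replace hf := (mem_filter.1 hf).2
  set B := moved f ∪ (moved f).image f with hBdef
  have hBcard : #B ≤ 2 * a := by
    have h1 := card_union_le (moved f) ((moved f).image f)
    have h2 := card_image_le (s := moved f) (f := f)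
    have h3 := ha f hf
    rw [← hBdef] at h1
    omega
  have hB : ∀ u v, u ∉ B → v ∉ B → ¬ G.Adj u v := by
    intro u v hu hv huv
    simp only [hBdef, mem_union, mem_image, mem_moved, not_or, not_not, not_exists, not_and] at hu hv
    have hfit : FitsMatching (fun z => if z = u then v else f z) G := by
      have huv' := huv.ne
      refine ⟨?_, ?_, ?_⟩
      · intro z
        by_cases hz : z = u
        · simp [hz, huv'.symm, hv.1]
        · have : f z ≠ u := by
            intro e
            by_cases hz' : f z = z
            · exact hz (hz'.symm.trans e)
            · exact hu.2 z hz' e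
          simp [hz, this, hf.idem]
      · intro z w hz hw e
        by_cases hzu : z = u <;> by_cases hwu : w = u
        · exact hzu.trans hwu.symm
        · simp only [hzu, hwu, if_true, if_false] at e hw
          exact absurd e.symm (hv.2 w hw)
        · simp only [hzu, hwu, if_true, if_false] at e hz
          exact absurd e (hv.2 z hz)
        · simp only [hzu, hwu, if_false] at e hz hw
          exact hf.inj z w hz hw e
      · intro z hz
        by_cases hzu : z = u
        · simpa [hzu] using huv
        · simp only [hzu, if_false] at hz ⊢
          exact hf.adj z hz
    have h1 := hmax _ (mem_filter.2 ⟨mem_univ _, hfit⟩)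
    have h2 : moved (fun z => if z = u then v else f z) = insert u (moved f) := by
      ext z
      simp only [mem_moved, mem_insert]
      by_cases hzu : z = u
      · simp [hzu, huv.ne.symm]
      · simp [hzu]
    have h3 : u ∉ moved f := by simp [mem_moved, hu.1]
    simp only [h2, card_insert_of_notMem h3] at h1
    omega
  set nb : V → Finset V := fun v => univ.filter fun z => G.Adj v z with hnb
  have hN : #(Bᶜ.image nb) ≤ 2 ^ 17 * #B + 1 := hG.card_neighborhoods_le B hB
  have hrep : ∀ N : Finset V, ∃ r : V, N ∈ Bᶜ.image nb → r ∉ B ∧ nb r = N := by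
    intro N
    by_cases h : N ∈ Bᶜ.image nb
    · obtain ⟨r, hr, h'⟩ := mem_image.1 h
      exact ⟨r, fun _ => ⟨mem_compl.1 hr, h'⟩⟩
    · exact ⟨v₀, fun h' => (h h').elim⟩
  choose rep hrep using hrep
  set g : V → V := fun v => if v ∈ B then v else rep (nb v) with hg
  have gB : ∀ v, v ∈ B → g v = v := fun v hv => by simp [hg, hv]
  have gn : ∀ v, v ∉ B → g v = rep (nb v) ∧ g v ∉ B ∧ nb (g v) = nb v := by
    intro v hv
    have := hrep (nb v) (mem_image_of_mem _ (mem_compl.2 hv))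
    have e : g v = rep (nb v) := by simp [hg, hv]
    rw [e]
    exact ⟨rfl, this⟩
  have gnb : ∀ v, nb (g v) = nb v := by
    intro v
    by_cases hv : v ∈ B
    · rw [gB v hv]
    · exact (gn v hv).2.2
  have adj_iff : ∀ v z, G.Adj v z ↔ G.Adj (g v) z := by
    intro v z
    have := congrArg (fun N => z ∈ N) (gnb v)
    simpa [hnb] using this.symm
  refine ⟨g, ?_, ?_, ?_⟩
  · intro v
    by_cases hv : v ∈ B
    · rw [gB v hv, gB v hv]
    · obtain ⟨h1, h2, h3⟩ := gn v hv
      rw [(gn _ h2).1, h3, h1]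
  · have : fixed g ⊆ B ∪ (Bᶜ.image nb).image rep := by
      intro v hv
      rw [mem_union]
      by_cases hvB : v ∈ B
      · exact Or.inl hvB
      · refine Or.inr (mem_image.2 ⟨nb v, mem_image_of_mem _ (mem_compl.2 hvB), ?_⟩)
        rw [← (gn v hvB).1]
        exact mem_fixed.1 hv
    have h1 := card_le_card this
    have h2 := card_union_le B ((Bᶜ.image nb).image rep)
    have h3 := card_image_le (s := Bᶜ.image nb) (f := rep)
    have h4 : (2 ^ 17 + 1) * #B ≤ (2 ^ 17 + 1) * (2 * a) := Nat.mul_le_mul_left _ hBcard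
    omega
  · intro x y
    rw [adj_iff x y, G.adj_comm, adj_iff y, G.adj_comm]

/-- The graphs without `K₅` minor determined by an idempotent map with few fixed points. -/
def retractGraphs (V : Type) [Fintype V] (m : ℕ) : Finset (SimpleGraph V) :=
  (k5FreeGraphs V).filter fun G => ∃ g : V → V, (∀ v, g (g v) = g v) ∧ #(fixed g) ≤ m ∧
    ∀ x y, G.Adj x y ↔ G.Adj (g x) (g y)

lemma mem_retractGraphs {V : Type} [Fintype V] {m : ℕ} {G : SimpleGraph V} :
    G ∈ retractGraphs V m ↔ K5Free G ∧ ∃ g : V → V, (∀ v, g (g v) = g v) ∧ #(fixed g) ≤ m ∧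
      ∀ x y, G.Adj x y ↔ G.Adj (g x) (g y) := by
  simp [retractGraphs, k5FreeGraphs]

lemma card_retract_le {V : Type} [Fintype V] {K m : ℕ} (hK1 : 1 ≤ K)
    (hK : ∀ k ≤ m, #(k5FreeGraphs (Fin k)) ≤ K ^ k * k ^ k) :
    #(retractGraphs V m) ≤ 2 ^ Fintype.card V * (K ^ m * m ^ Fintype.card V) := by
  set A := retractGraphs V m with hA
  have hex : ∀ G : SimpleGraph V, ∃ g : V → V, G ∈ A → (∀ v, g (g v) = g v) ∧
      #(fixed g) ≤ m ∧ ∀ x y, G.Adj x y ↔ G.Adj (g x) (g y) := by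
    intro G
    by_cases h : G ∈ A
    · obtain ⟨g, hg⟩ := (mem_filter.1 h).2
      exact ⟨g, fun _ => hg⟩
    · exact ⟨id, fun h' => (h h').elim⟩
  choose g hg using hex
  refine (card_le_mul_card_image (f := fun G => fixed (g G)) A
    (K ^ m * m ^ Fintype.card V) ?_).trans ?_
  swap
  · rw [mul_comm]
    refine Nat.mul_le_mul_right _ ((card_le_univ _).trans ?_)
    simp
  intro U hU
  obtain ⟨G₀, hG₀, rfl⟩ := mem_image.1 hU
  have hUm := (hg G₀ hG₀).2.1
  set U := fixed (g G₀) with hUdef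
  let S : Finset (((Uᶜ : Finset V) → U) × SimpleGraph U) := univ ×ˢ k5FreeGraphs U
  have hS : #S ≤ K ^ m * m ^ Fintype.card V := by
    rw [card_product, card_univ, Fintype.card_fun, Fintype.card_coe, Fintype.card_coe]
    have h1 : #(k5FreeGraphs U) ≤ #(k5FreeGraphs (Fin #U)) :=
      card_k5FreeGraphs_congr (by simp)
    have h2 : #(Uᶜ) + #U = Fintype.card V := by
      rw [card_compl]
      have := card_le_univ U
      omega
    calc #U ^ #(Uᶜ) * #(k5FreeGraphs U) ≤ #U ^ #(Uᶜ) * (K ^ #U * #U ^ #U) :=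
          Nat.mul_le_mul_left _ (h1.trans (hK _ hUm))
      _ = K ^ #U * #U ^ Fintype.card V := by rw [← h2, pow_add]; ring
      _ ≤ K ^ m * m ^ Fintype.card V := by gcongr
  refine le_trans ?_ hS
  have hgU : ∀ G ∈ A, fixed (g G) = U → ∀ v, g G v ∈ U := by
    intro G hG h v
    rw [← h, mem_fixed]
    exact (hg G hG).1 v
  have hUne : ∀ v : V, g G₀ v ∈ U := hgU G₀ hG₀ rfl
  refine card_le_card_of_injOn (fun G => (fun v => if h : g G v ∈ U then ⟨g G v, h⟩
    else ⟨g G₀ v, hUne v⟩, G.comap ((↑) : U → V))) ?_ ?_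
  · intro G hG
    simp only [coe_filter, Set.mem_ofPred_eq] at hG
    simp only [S, mem_coe, mem_product, mem_univ, true_and, k5FreeGraphs, mem_filter]
    have := (mem_filter.1 hG.1).1
    simp only [k5FreeGraphs, mem_filter, mem_univ, true_and] at this
    exact this.comap Subtype.val_injective
  · intro G hG G' hG' e
    simp only [coe_filter, Set.mem_ofPred_eq] at hG hG'
    simp only [Prod.mk.injEq] at e
    have hgg : ∀ v, g G v = g G' v := by
      intro v
      by_cases hv : v ∈ U
      · have h1 : v ∈ fixed (g G) := hG.2 ▸ hv
        have h2 : v ∈ fixed (g G') := hG'.2 ▸ hv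
        rw [mem_fixed.1 h1, mem_fixed.1 h2]
      · have := congrFun e.1 ⟨v, mem_compl.2 hv⟩
        simpa only [hgU G hG.1 hG.2 v, hgU G' hG'.1 hG'.2 v, dite_true, Subtype.mk.injEq] using this
    ext x y
    rw [(hg G hG.1).2.2 x y, (hg G' hG'.1).2.2 x y, ← hgg, ← hgg]
    have := congrArg (fun H : SimpleGraph U => H.Adj ⟨_, hgU G hG.1 hG.2 x⟩ ⟨_, hgU G hG.1 hG.2 y⟩) e.2
    simpa using this

/-- There are at most `Kⁿ nⁿ` graphs on `n` labeled vertices without `K₅` minor. -/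
theorem exists_card_k5FreeGraphs_le : ∃ K : ℕ, 1 ≤ K ∧ ∀ n : ℕ,
    #(k5FreeGraphs (Fin n)) ≤ K ^ n * n ^ n := by
  obtain ⟨q, hq⟩ : ∃ q : ℕ, q = 2 ^ 20 := ⟨_, rfl⟩
  have hq1 : 1 ≤ q := by rw [hq]; norm_num
  obtain ⟨K, hKdef⟩ : ∃ K : ℕ, K = 2 ^ (66 * (2 * q)) := ⟨_, rfl⟩
  have hK1 : 1 ≤ K := hKdef ▸ Nat.one_le_two_pow
  refine ⟨K, hK1, fun n => ?_⟩
  induction n using Nat.strong_induction_on with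
  | _ n ih =>
  rcases lt_or_ge n q with hn | hn
  · rcases Nat.eq_zero_or_pos n with rfl | hn0
    · refine (card_le_univ _).trans ?_
      simp only [pow_zero, mul_one]
      refine Fintype.card_le_one_iff.2 fun G H => ?_
      ext a
      exact a.elim0
    · have h1 : #(k5FreeGraphs (Fin n)) ≤ 2 ^ (n * n) := by
        have : 2 ^ (n * n) = #((univ : Finset (Fin n × Fin n)).powerset) := by
          simp
        rw [this]
        refine card_le_card_of_injOn arcs (fun _ _ => mem_coe.2 (mem_powerset.2 (subset_univ _))) ?_
        intro G _ H _ h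
        ext x y
        have := congrArg (fun s => (x, y) ∈ s) h
        simpa [mem_arcs] using this
      refine h1.trans ?_
      calc 2 ^ (n * n) ≤ 2 ^ (66 * (2 * q) * n) := by
            refine Nat.pow_le_pow_right (by norm_num) (Nat.mul_le_mul_right _ ?_)
            omega
        _ = K ^ n := by rw [hKdef, pow_mul]
        _ ≤ K ^ n * n ^ n := Nat.le_mul_of_pos_right _ (by positivity)
  · set a := n / q with ha
    have hn0 : 0 < n := lt_of_lt_of_le hq1 hn
    have ha1 : 1 ≤ a := by
      rw [ha]
      exact (Nat.one_le_div_iff hq1).2 hn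
    have han : a ≤ n := Nat.div_le_self _ _
    have ham : a * q ≤ n := Nat.div_mul_le_self _ _
    have haq : n ≤ 2 * q * a := by
      have := Nat.lt_div_mul_add (a := n) hq1
      rw [← ha] at this
      have h2 : q ≤ a * q := Nat.le_mul_of_pos_left _ ha1
      have h3 : 2 * q * a = 2 * (a * q) := by ring
      omega
    obtain ⟨m, hm⟩ : ∃ m, m = (2 ^ 18 + 2) * a + 1 := ⟨_, rfl⟩
    have hm2 : 2 * m ≤ n := by
      rw [hm]
      rw [hq] at ham hn
      omega
    have hcover : k5FreeGraphs (Fin n) ⊆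
        graphsFitting (mapsMoving (Fin n) a) ∪ retractGraphs (Fin n) m := by
      intro G hG
      replace hG := (mem_filter.1 hG).2
      rw [mem_union, mem_graphsFitting, mem_retractGraphs]
      by_cases h : ∃ f, FitsMatching f G ∧ a ≤ #(moved f)
      · obtain ⟨f, hf, hfa⟩ := h
        obtain ⟨f', hf', e⟩ := hf.restrict hfa
        exact Or.inl ⟨hG, f', mem_mapsMoving.2 e, hf'⟩
      · push Not at h
        exact Or.inr ⟨hG, hm ▸ hG.exists_retraction h⟩
    have hI := card_exists_fits_le (mapsMoving (Fin n) a) a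
      fun f hf => mem_mapsMoving.1 hf
    have hII := card_retract_le (V := Fin n) (K := K) (m := m) hK1 fun k hk => ih k (by omega)
    have hMc := card_mapsMoving_le (V := Fin n) a
    rw [Fintype.card_fin] at hI hII hMc
    have hIa : #(graphsFitting (mapsMoving (Fin n) a)) * 2 ≤ K ^ n * n ^ n := by
      have h1 := ih (n - a) (by omega)
      calc _ ≤ (2 ^ n * n ^ a) * ((K ^ (n - a) * n ^ (n - a)) * 2 ^ (64 * n)) * 2 := by
            refine Nat.mul_le_mul_right _ (hI.trans ?_)
            refine Nat.mul_le_mul hMc (Nat.mul_le_mul_right _ (h1.trans ?_))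
            gcongr
            omega
        _ = (2 ^ n * 2 ^ (64 * n) * 2) * K ^ (n - a) * (n ^ a * n ^ (n - a)) := by ring
        _ ≤ K ^ a * K ^ (n - a) * (n ^ a * n ^ (n - a)) := by
            gcongr
            rw [hKdef, ← pow_mul 2 _ a, ← pow_add, ← pow_succ]
            refine Nat.pow_le_pow_right (by norm_num) ?_
            have : 66 * (2 * q) * a = 66 * (2 * q * a) := by ring
            omega
        _ = K ^ n * n ^ n := by
            rw [← pow_add, ← pow_add, Nat.add_sub_cancel' han]
    have hIIa : #(retractGraphs (Fin n) m) * 2 ≤ K ^ n * n ^ n := by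
      calc _ ≤ 2 ^ n * (K ^ m * m ^ n) * 2 := Nat.mul_le_mul_right _ hII
        _ ≤ 2 ^ n * (K ^ m * n ^ n) * 2 := by gcongr; omega
        _ = (2 ^ n * 2) * K ^ m * n ^ n := by ring
        _ ≤ K ^ (n - m) * K ^ m * n ^ n := by
            gcongr
            rw [hKdef, ← pow_mul 2 _ (n - m), ← pow_succ]
            refine Nat.pow_le_pow_right (by norm_num) ?_
            have : 66 * (2 * q) * (n - m) = 132 * (q * (n - m)) := by ring
            have h3 : n - m ≤ q * (n - m) := Nat.le_mul_of_pos_left _ hq1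
            omega
        _ = K ^ n * n ^ n := by
            rw [← pow_add, Nat.sub_add_cancel (by omega)]
    have := (card_le_card hcover).trans (card_union_le _ _)
    omega

/-- `F` is a connected component of `G - S`. -/
structure IsComp {V : Type} (G : SimpleGraph V) (S F : Finset V) : Prop where
  conn : ConnOn G (F : Set V)
  disj : Disjoint F S
  closed : ∀ v ∈ F, ∀ u, G.Adj v u → u ∉ S → u ∈ F

lemma IsComp.subset {V : Type} {G : SimpleGraph V} {S F C : Finset V} (hF : IsComp G S F)
    (hC : ConnOn G (C : Set V)) (hd : Disjoint C S) {x : V} (hxC : x ∈ C) (hxF : x ∈ F) :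
    C ⊆ F := by
  intro y hy
  have := hC.2 x hxC y hy
  clear hy
  induction this with
  | refl => exact hxF
  | tail _ h ih =>
    exact hF.closed _ ih _ h.1 fun hyS => disjoint_left.1 hd (mem_coe.1 h.2.2) hyS

/-- Either a small connected set meets all the `A i`, or few vertices separate them. -/
lemma exists_connected_or_separator {V : Type} (G : SimpleGraph V) (F : Finset V)
    (A : Fin 5 → Set V) (I : Finset (Fin 5)) {r : ℕ} (hr : 0 < r) (hF : 5 * #F ≤ r * r) :
    (∃ U : Finset V, ConnOn G (U : Set V) ∧ U ⊆ F ∧ #U ≤ r ∧ ∀ i ∈ I, ∃ v ∈ U, v ∈ A i) ∨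
    ∃ Z ⊆ F, #Z ≤ r ∧ ∀ C : Finset V, ConnOn G (C : Set V) → C ⊆ F → Disjoint C Z →
      ∃ i ∈ I, ∀ v ∈ C, v ∉ A i := by
  by_cases hB : ∃ U : Finset V, ConnOn G (U : Set V) ∧ U ⊆ F ∧ #U ≤ r ∧ ∀ i ∈ I, ∃ v ∈ U, v ∈ A i
  · exact Or.inl hB
  refine Or.inr ?_
  let L : ℕ → ℕ → Finset V := fun m t => F.filter fun v => ∃ U : Finset V, ConnOn G (U : Set V) ∧
    U ⊆ F ∧ v ∈ U ∧ #U ≤ t ∧ ∀ i ∈ I, (i : ℕ) < m → ∃ v ∈ U, v ∈ A i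
  have memL : ∀ m t v, v ∈ L m t ↔ v ∈ F ∧ ∃ U : Finset V, ConnOn G (U : Set V) ∧
    U ⊆ F ∧ v ∈ U ∧ #U ≤ t ∧ ∀ i ∈ I, (i : ℕ) < m → ∃ v ∈ U, v ∈ A i := fun m t v => mem_filter
  have Lmono : ∀ m t, L m t ⊆ L m (t + 1) := by
    intro m t v hv
    rw [memL] at hv ⊢
    obtain ⟨h0, U, h1, h2, h3, h4, h5⟩ := hv
    exact ⟨h0, U, h1, h2, h3, by omega, h5⟩
  let Z : ℕ → Finset V := fun s => (range 5).biUnion fun m => L m (s + 1) \ L m s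
  have hsum : ∀ k, ∑ s ∈ range k, #(Z s) ≤ ∑ m ∈ range 5, #(L m k) := by
    intro k
    induction k with
    | zero => simp
    | succ k ih =>
      rw [sum_range_succ]
      have h1 : #(Z k) ≤ ∑ m ∈ range 5, #(L m (k + 1) \ L m k) := card_biUnion_le
      have h2 : ∑ m ∈ range 5, #(L m (k + 1) \ L m k) + ∑ m ∈ range 5, #(L m k) =
          ∑ m ∈ range 5, #(L m (k + 1)) := by
        rw [← sum_add_distrib]
        exact sum_congr rfl fun m _ => card_sdiff_add_card_eq_card (Lmono m k)
      omega
  obtain ⟨s, hs, hZ⟩ : ∃ s ∈ range r, #(Z s) ≤ r := by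
    refine exists_le_of_sum_le (nonempty_range_iff.2 hr.ne') ((hsum r).trans ?_)
    have : ∑ m ∈ range 5, #(L m r) ≤ ∑ m ∈ range 5, #F :=
      sum_le_sum fun m _ => card_filter_le _ _
    simp only [sum_const, card_range, smul_eq_mul] at this ⊢
    omega
  rw [mem_range] at hs
  refine ⟨Z s, ?_, hZ, ?_⟩
  · exact biUnion_subset.2 fun m _ => sdiff_subset.trans (filter_subset _ _)
  intro C hC hCF hCZ
  by_contra! hmeet
  have hstay : ∀ m < 5, ∀ v ∈ C, v ∈ L m (s + 1) → v ∈ L m s := by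
    intro m hm v hv hvL
    by_contra hcon
    exact disjoint_left.1 hCZ hv (mem_biUnion.2 ⟨m, mem_range.2 hm, mem_sdiff.2 ⟨hvL, hcon⟩⟩)
  have hnext : ∀ m, (hm : m < 5) → (∀ v ∈ C, v ∈ L m s) → ∃ v ∈ C, v ∈ L (m + 1) s := by
    intro m hm hall
    obtain ⟨v, hv, hvA⟩ : ∃ v ∈ C, (⟨m, hm⟩ : Fin 5) ∈ I → v ∈ A ⟨m, hm⟩ := by
      by_cases hmI : (⟨m, hm⟩ : Fin 5) ∈ I
      · obtain ⟨v, hv, h⟩ := hmeet _ hmI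
        exact ⟨v, hv, fun _ => h⟩
      · obtain ⟨v, hv⟩ := hC.1
        exact ⟨v, hv, fun h => (hmI h).elim⟩
    refine ⟨v, hv, ?_⟩
    have := hall v hv
    rw [memL] at this ⊢
    obtain ⟨h0, U, h1, h2, h3, h4, h5⟩ := this
    refine ⟨h0, U, h1, h2, h3, h4, fun i hi him => ?_⟩
    rcases Nat.lt_succ_iff_lt_or_eq.1 him with h | h
    · exact h5 i hi h
    · have : i = ⟨m, hm⟩ := Fin.ext h
      subst this
      exact ⟨v, h3, hvA hi⟩
  have hall : ∀ m, m < 5 → ∀ v ∈ C, v ∈ L m s := by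
    intro m
    induction m with
    | zero =>
      intro _ v hv
      refine hstay 0 (by norm_num) v hv ((memL _ _ _).2 ⟨hCF hv, {v}, ?_, ?_, ?_, ?_, ?_⟩)
      · rw [coe_singleton]; exact ConnOn.singleton _ _
      · exact singleton_subset_iff.2 (hCF hv)
      · exact mem_singleton_self v
      · simp
      · intro i _ h; omega
    | succ m ih =>
      intro hm
      obtain ⟨v, hv, hvL⟩ := hnext m (by omega) (ih (by omega))
      intro u hu
      have := hC.2 v hv u hu
      clear hu
      induction this with
      | refl => exact hvL
      | @tail b c _ h ihb =>
        refine hstay _ hm _ h.2.2 ?_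
        rw [memL] at ihb ⊢
        obtain ⟨h0, U, h1, h2, h3, h4, h5⟩ := ihb
        have hcF : c ∈ F := hCF h.2.2
        refine ⟨hcF, insert c U, ?_, insert_subset hcF h2, mem_insert_self _ _,
          (card_insert_le _ _).trans (by omega), ?_⟩
        · rw [coe_insert, Set.insert_eq]
          exact (ConnOn.singleton _ _).union h1 rfl (mem_coe.2 h3) h.1.symm
        · intro i hi him
          obtain ⟨x, hx, hxA⟩ := h5 i hi him
          exact ⟨x, mem_insert_of_mem hx, hxA⟩
  obtain ⟨v, -, hvL⟩ := hnext 4 (by norm_num) (hall 4 (by norm_num))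
  rw [memL] at hvL
  obtain ⟨h0, U, h1, h2, h3, h4, h5⟩ := hvL
  exact hB ⟨U, h1, h2, by omega, fun i hi => h5 i hi i.2⟩

/-- A configuration in the search for a `K₅` minor: a partial model together with a heavy
component of its attachment. -/
structure SepState {V : Type} (G : SimpleGraph V) (w : V → ℕ) (W r : ℕ) (I : Finset (Fin 5))
    (T : Fin 5 → Set V) (X : Fin 5 → Finset V) (F : Finset V) : Prop where
  conn : ∀ i ∈ I, ConnOn G (T i)
  disj : ∀ i ∈ I, ∀ j ∈ I, i ≠ j → Disjoint (T i) (T j)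
  adj : ∀ i ∈ I, ∀ j ∈ I, i ≠ j → ∃ a ∈ T i, ∃ b ∈ T j, G.Adj a b
  sub : ∀ i ∈ I, (X i : Set V) ⊆ T i
  card : ∀ i ∈ I, #(X i) ≤ r
  comp : IsComp G (I.biUnion X) F
  big : W < 2 * ∑ v ∈ F, w v
  out : ∀ i ∈ I, ∀ v ∈ F, v ∉ T i

lemma SepState.false {V : Type} [Fintype V] {G : SimpleGraph V} (hG : K5Free G) {w : V → ℕ}
    {W r : ℕ} (hW : ∑ v, w v ≤ W) (hr0 : 0 < r) (hr : 5 * Fintype.card V ≤ r * r)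
    (hbig : ∀ S : Finset V, #S ≤ 5 * r → ∃ F, IsComp G S F ∧ W < 2 * ∑ v ∈ F, w v)
    (k : ℕ) : ∀ (I : Finset (Fin 5)) (T : Fin 5 → Set V) (X : Fin 5 → Finset V) (F : Finset V),
      SepState G w W r I T X F → 6 * #F + #I ≠ k := by
  induction k using Nat.strong_induction_on with
  | _ k ih =>
  intro I T X F h hk
  have hbigSub : ∀ S S' F F' : Finset V, S ⊆ S' → IsComp G S F → IsComp G S' F' →
      W < 2 * ∑ v ∈ F, w v → W < 2 * ∑ v ∈ F', w v → F' ⊆ F := by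
    intro S S' F F' hS hF hF' hb hb'
    have : ¬ Disjoint F F' := by
      intro hd
      have h1 := sum_union (f := w) hd
      have h2 : ∑ v ∈ F ∪ F', w v ≤ ∑ v, w v := sum_le_sum_of_subset (subset_univ _)
      omega
    obtain ⟨x, hx, hx'⟩ := not_disjoint_iff.1 this
    exact hF.subset hF'.conn (hF'.disj.mono_right hS) hx' hx
  have hI4 : #I ≤ 4 := by
    have h5 : #I ≤ 5 := (card_le_univ I).trans (by simp)
    by_contra hcon
    have : I = univ := eq_univ_of_card I (by simp; omega)
    subst this
    exact hG ⟨T, fun i => h.conn i (mem_univ _), fun i j => h.disj i (mem_univ _) j (mem_univ _),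
      fun i j hij => h.adj i (mem_univ _) j (mem_univ _) hij⟩
  have hXcard : #(I.biUnion X) ≤ 4 * r := by
    refine (card_biUnion_le_card_mul _ _ r h.card).trans ?_
    gcongr
  by_cases hA : ∃ i ∈ I, ∀ a ∈ T i, ∀ v ∈ F, ¬ G.Adj a v
  · obtain ⟨i, hi, hA⟩ := hA
    have hsub : I.erase i ⊆ I := erase_subset _ _
    refine ih (6 * #F + #(I.erase i)) ?_ (I.erase i) T X F ⟨?_, ?_, ?_, ?_, ?_, ?_, h.big, ?_⟩ rfl
    · have := card_erase_lt_of_mem hi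
      omega
    · exact fun j hj => h.conn j (hsub hj)
    · exact fun j hj l hl => h.disj j (hsub hj) l (hsub hl)
    · exact fun j hj l hl => h.adj j (hsub hj) l (hsub hl)
    · exact fun j hj => h.sub j (hsub hj)
    · exact fun j hj => h.card j (hsub hj)
    · refine ⟨h.comp.conn, h.comp.disj.mono_right (biUnion_subset_biUnion_of_subset_left _ hsub), ?_⟩
      intro v hv u hvu hu
      refine h.comp.closed v hv u hvu fun hu' => ?_
      obtain ⟨j, hj, huj⟩ := mem_biUnion.1 hu'
      by_cases hji : j = i
      · subst hji
        exact hA u (h.sub j hj huj) v hv hvu.symm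
      · exact hu (mem_biUnion.2 ⟨j, mem_erase.2 ⟨hji, hj⟩, huj⟩)
    · exact fun j hj => h.out j (hsub hj)
  push Not at hA
  have h5F : 5 * #F ≤ r * r := (Nat.mul_le_mul_left _ (card_le_univ F)).trans hr
  rcases exists_connected_or_separator G F (fun i => {v | v ∈ F ∧ ∃ a ∈ T i, G.Adj a v}) I hr0 h5F
    with ⟨U, hU, hUF, hUr, hUA⟩ | ⟨Z, hZF, hZr, hZ⟩
  · obtain ⟨i₀, hi₀⟩ : ∃ i₀, i₀ ∉ I := by
      by_contra! hcon
      have : I = univ := eq_univ_of_forall hcon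
      rw [this] at hI4
      simp at hI4
    have hne : ∀ i ∈ I, i ≠ i₀ := fun i hi e => hi₀ (e ▸ hi)
    have hX' : (insert i₀ I).biUnion (Function.update X i₀ U) = U ∪ I.biUnion X := by
      rw [biUnion_insert, Function.update_self]
      congr 1
      exact biUnion_congr rfl fun i hi => by rw [Function.update_of_ne (hne i hi)]
    obtain ⟨F', hF', hb'⟩ := hbig (U ∪ I.biUnion X) (by
      have := card_union_le U (I.biUnion X)
      omega)
    have hF'F : F' ⊆ F := hbigSub _ _ _ _ subset_union_right h.comp hF' h.big hb'
    have hUF' : Disjoint F' U := hF'.disj.mono_right subset_union_left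
    have hlt : #F' < #F := by
      obtain ⟨u, hu⟩ := hU.1
      refine card_lt_card ⟨hF'F, fun hcon => ?_⟩
      exact disjoint_left.1 hUF' (hcon (hUF hu)) hu
    have hmem : ∀ i ∈ insert i₀ I, i = i₀ ∨ i ∈ I := fun i => mem_insert.1
    have hI6 : #(insert i₀ I) ≤ 5 := (card_insert_le _ _).trans (by omega)
    refine ih (6 * #F' + #(insert i₀ I)) (by omega) (insert i₀ I) (Function.update T i₀ U)
      (Function.update X i₀ U) F' ⟨?_, ?_, ?_, ?_, ?_, ?_, hb', ?_⟩ rfl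
    · intro i hi
      rcases mem_insert.1 hi with rfl | hi
      · simpa using hU
      · rw [Function.update_of_ne (hne i hi)]; exact h.conn i hi
    · have hd : ∀ i ∈ I, Disjoint (T i) U := fun i hi => Set.disjoint_left.2 fun x hx hxU =>
        h.out i hi x (hUF hxU) hx
      intro i hi j hj hij
      replace hi := hmem i hi
      replace hj := hmem j hj
      rcases hi with rfl | hi <;> rcases hj with rfl | hj
      · exact absurd rfl hij
      · rw [Function.update_self, Function.update_of_ne (hne j hj)]; exact (hd j hj).symm
      · rw [Function.update_self, Function.update_of_ne (hne i hi)]; exact hd i hi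
      · rw [Function.update_of_ne (hne i hi), Function.update_of_ne (hne j hj)]
        exact h.disj i hi j hj hij
    · intro i hi j hj hij
      replace hi := hmem i hi
      replace hj := hmem j hj
      rcases hi with rfl | hi <;> rcases hj with rfl | hj
      · exact absurd rfl hij
      · rw [Function.update_self, Function.update_of_ne (hne j hj)]
        obtain ⟨v, hv, -, a, ha, hav⟩ := hUA j hj
        exact ⟨v, hv, a, ha, hav.symm⟩
      · rw [Function.update_self, Function.update_of_ne (hne i hi)]
        obtain ⟨v, hv, -, a, ha, hav⟩ := hUA i hi
        exact ⟨a, ha, v, hv, hav⟩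
      · rw [Function.update_of_ne (hne i hi), Function.update_of_ne (hne j hj)]
        exact h.adj i hi j hj hij
    · intro i hi
      rcases mem_insert.1 hi with rfl | hi
      · simp
      · rw [Function.update_of_ne (hne i hi), Function.update_of_ne (hne i hi)]; exact h.sub i hi
    · intro i hi
      rcases mem_insert.1 hi with rfl | hi
      · simpa using hUr
      · rw [Function.update_of_ne (hne i hi)]; exact h.card i hi
    · rw [hX']; exact hF'
    · intro i hi v hv
      rcases mem_insert.1 hi with rfl | hi
      · rw [Function.update_self]
        exact fun hvU => disjoint_left.1 hUF' hv hvU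
      · rw [Function.update_of_ne (hne i hi)]; exact h.out i hi v (hF'F hv)
  · obtain ⟨F', hF', hb'⟩ := hbig (Z ∪ I.biUnion X) (by
      have := card_union_le Z (I.biUnion X)
      omega)
    have hF'F : F' ⊆ F := hbigSub _ _ _ _ subset_union_right h.comp hF' h.big hb'
    obtain ⟨i, hi, hiA⟩ := hZ F' hF'.conn hF'F (hF'.disj.mono_right subset_union_left)
    set A : Set V := {v | v ∈ F ∧ ∃ a ∈ T i, G.Adj a v} with hAdef
    have hXF : ∀ v ∈ F, v ∉ I.biUnion X := fun v hv => disjoint_left.1 h.comp.disj hv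
    let R : Finset V := F.filter fun v => ∃ a ∈ A, Reach G {x | x ∈ F ∧ x ∉ F'} a v
    have memR : ∀ v, v ∈ R ↔ v ∈ F ∧ ∃ a ∈ A, Reach G {x | x ∈ F ∧ x ∉ F'} a v :=
      fun v => mem_filter
    have hAR : ∀ a ∈ A, a ∈ R := fun a ha => (memR a).2 ⟨ha.1, a, ha, .refl⟩
    have hRF : R ⊆ F := filter_subset _ _
    have hRF' : ∀ v ∈ R, v ∉ F' := by
      intro v hv
      obtain ⟨-, a, ha, hav⟩ := (memR v).1 hv
      exact (hav.mem (s := {x | x ∈ F ∧ x ∉ F'}) ⟨ha.1, fun h' => hiA a h' ha⟩).2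
    have hRcl : ∀ v ∈ R, ∀ u ∈ F, u ∉ F' → G.Adj v u → u ∈ R := by
      intro v hv u hu hu' hvu
      obtain ⟨hvF, a, ha, hav⟩ := (memR v).1 hv
      exact (memR u).2 ⟨hu, a, ha, hav.tail ⟨hvu, ⟨hvF, hRF' v hv⟩, hu, hu'⟩⟩
    obtain ⟨x₀, hx₀⟩ := hF'.conn.1
    let F2 : Finset V := F.filter fun v => Reach G {x | x ∈ F ∧ x ∉ Z ∩ R} x₀ v
    have memF2 : ∀ v, v ∈ F2 ↔ v ∈ F ∧ Reach G {x | x ∈ F ∧ x ∉ Z ∩ R} x₀ v := fun v => mem_filter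
    have hx₀F : x₀ ∈ F := hF'F hx₀
    have hx₀R : x₀ ∉ R := fun h' => hRF' _ h' hx₀
    have hF2R : ∀ v, Reach G {x | x ∈ F ∧ x ∉ Z ∩ R} x₀ v → v ∉ R := by
      intro v hv
      induction hv with
      | refl => exact hx₀R
      | @tail b c _ hbc ihb =>
        intro hc
        by_cases hb : b ∈ F'
        · refine hbc.2.2.2 (mem_inter.2 ⟨?_, hc⟩)
          by_contra hcZ
          refine hRF' c hc (hF'.closed b hb c hbc.1 ?_)
          rw [mem_union, not_or]
          exact ⟨hcZ, hXF c hbc.2.2.1⟩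
        · exact ihb (hRcl c hc b hbc.2.1.1 hb hbc.1.symm)
    have hF'F2 : F' ⊆ F2 := by
      intro v hv
      have hsub : (F' : Set V) ⊆ {x | x ∈ F ∧ x ∉ Z ∩ R} := fun x hx =>
        ⟨hF'F hx, fun hxZ => hRF' x (mem_inter.1 hxZ).2 hx⟩
      exact (memF2 v).2 ⟨hF'F hv, (hF'.conn.2 x₀ hx₀ v hv).mono hsub⟩
    have hF2big : W < 2 * ∑ v ∈ F2, w v := by
      have : ∑ v ∈ F', w v ≤ ∑ v ∈ F2, w v := sum_le_sum_of_subset hF'F2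
      omega
    have hF2F : F2 ⊆ F := filter_subset _ _
    have hlt : #F2 < #F := by
      obtain ⟨a, ha, v, hv, hav⟩ := hA i hi
      refine card_lt_card ⟨hF2F, fun hcon => ?_⟩
      exact hF2R v ((memF2 v).1 (hcon hv)).2 (hAR v ⟨hv, a, ha, hav⟩)
    have hupd : ∀ j, j ≠ i → Function.update X i (Z ∩ R) j = X j := fun j hj =>
      Function.update_of_ne hj _ _
    have hupdT : ∀ j, j ≠ i → Function.update T i (T i ∪ R) j = T j := fun j hj =>
      Function.update_of_ne hj _ _
    refine ih (6 * #F2 + #I) (by omega) I (Function.update T i (T i ∪ R))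
      (Function.update X i (Z ∩ R)) F2 ⟨?_, ?_, ?_, ?_, ?_, ?_, hF2big, ?_⟩ rfl
    · intro j hj
      by_cases hji : j = i
      · subst hji
        rw [Function.update_self]
        obtain ⟨t, ht⟩ := (h.conn j hj).1
        refine ConnOn.of_root (r := t) (Or.inl ht) ?_
        rintro x (hx | hx)
        · exact ((h.conn j hj).2 t ht x hx).mono Set.subset_union_left
        · obtain ⟨-, a, ha, hax⟩ := (memR x).1 hx
          obtain ⟨b, hb, hba⟩ := ha.2
          refine (((h.conn j hj).2 t ht b hb).mono Set.subset_union_left).trans ?_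
          refine .head ⟨hba, Or.inl hb, Or.inr (hAR a ha)⟩ ?_
          clear hx
          have aux : ∀ x, Reach G {x | x ∈ F ∧ x ∉ F'} a x → x ∈ R ∧ Reach G (T j ∪ R) a x := by
            intro x hx
            induction hx with
            | refl => exact ⟨hAR a ha, .refl⟩
            | @tail b c _ hbc ihb =>
              have hc := hRcl b ihb.1 c hbc.2.2.1 hbc.2.2.2 hbc.1
              exact ⟨hc, ihb.2.tail ⟨hbc.1, Or.inr ihb.1, Or.inr hc⟩⟩
          exact (aux x hax).2
      · rw [hupdT j hji]; exact h.conn j hj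
    · have hd : ∀ j ∈ I, j ≠ i → Disjoint (T i ∪ R) (T j) := by
        intro j hj hji
        refine Set.disjoint_union_left.2 ⟨h.disj i hi j hj (Ne.symm hji), ?_⟩
        exact Set.disjoint_left.2 fun x hx hxT => h.out j hj x (hRF hx) hxT
      intro j hj l hl hjl
      by_cases hji : j = i
      · subst hji
        rw [Function.update_self, hupdT l (Ne.symm hjl)]
        exact hd l hl (Ne.symm hjl)
      · by_cases hli : l = i
        · subst hli
          rw [Function.update_self, hupdT j hjl]
          exact (hd j hj hjl).symm
        · rw [hupdT j hji, hupdT l hli]; exact h.disj j hj l hl hjl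
    · intro j hj l hl hjl
      obtain ⟨a, ha, b, hb, hab⟩ := h.adj j hj l hl hjl
      have hsub : ∀ j, T j ⊆ Function.update T i (T i ∪ R) j := by
        intro j
        by_cases hji : j = i
        · subst hji; rw [Function.update_self]; exact Set.subset_union_left
        · rw [hupdT j hji]
      exact ⟨a, hsub j ha, b, hsub l hb, hab⟩
    · intro j hj
      by_cases hji : j = i
      · subst hji
        rw [Function.update_self, Function.update_self]
        exact fun x hx => Or.inr (mem_inter.1 hx).2
      · rw [hupd j hji, hupdT j hji]; exact h.sub j hj
    · intro j hj
      by_cases hji : j = i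
      · subst hji
        rw [Function.update_self]
        exact (card_le_card inter_subset_left).trans hZr
      · rw [hupd j hji]; exact h.card j hj
    · refine ⟨?_, ?_, ?_⟩
      · refine ConnOn.of_root (r := x₀) ((memF2 _).2 ⟨hx₀F, .refl⟩) ?_
        intro x hx
        have hx2 := ((memF2 x).1 hx).2
        clear hx
        induction hx2 with
        | refl => exact .refl
        | @tail b c hb hbc ihb =>
          exact ihb.tail ⟨hbc.1, (memF2 _).2 ⟨hbc.2.1.1, hb⟩, (memF2 _).2 ⟨hbc.2.2.1, hb.tail hbc⟩⟩
      · refine disjoint_left.2 fun v hv hvX => ?_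
        obtain ⟨j, hj, hvj⟩ := mem_biUnion.1 hvX
        by_cases hji : j = i
        · subst hji
          rw [Function.update_self] at hvj
          exact hF2R v ((memF2 v).1 hv).2 (mem_inter.1 hvj).2
        · rw [hupd j hji] at hvj
          exact hXF v (hF2F hv) (mem_biUnion.2 ⟨j, hj, hvj⟩)
      · intro v hv u hvu hu
        have hvR := hF2R v ((memF2 v).1 hv).2
        have huF : u ∈ F := by
          refine h.comp.closed v (hF2F hv) u hvu fun huX => ?_
          obtain ⟨j, hj, huj⟩ := mem_biUnion.1 huX
          by_cases hji : j = i
          · subst hji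
            exact hvR (hAR v ⟨hF2F hv, u, h.sub j hj huj, hvu.symm⟩)
          · exact hu (mem_biUnion.2 ⟨j, hj, by rw [hupd j hji]; exact huj⟩)
        have huZ : u ∉ Z ∩ R := fun h' => hu (mem_biUnion.2 ⟨i, hi, by
          rw [Function.update_self]; exact h'⟩)
        refine (memF2 u).2 ⟨huF, ((memF2 v).1 hv).2.tail ⟨hvu, ⟨hF2F hv, ?_⟩, huF, huZ⟩⟩
        exact fun h' => hvR (mem_inter.1 h').2
    · intro j hj v hv
      by_cases hji : j = i
      · subst hji
        rw [Function.update_self]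
        rintro (hvT | hvR)
        · exact h.out j hj v (hF2F hv) hvT
        · exact hF2R v ((memF2 v).1 hv).2 hvR
      · rw [hupdT j hji]; exact h.out j hj v (hF2F hv)

/-- The Alon–Seymour–Thomas separator theorem for graphs without `K₅` minor. -/
theorem K5Free.exists_separator {V : Type} [Fintype V] {G : SimpleGraph V} (hG : K5Free G)
    (w : V → ℕ) {r : ℕ} (hr0 : 0 < r) (hr : 5 * Fintype.card V ≤ r * r) :
    ∃ S : Finset V, #S ≤ 5 * r ∧ ∀ F, IsComp G S F → 2 * ∑ v ∈ F, w v ≤ ∑ v, w v := by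
  by_contra! hbig
  obtain ⟨F, hF, hb⟩ := hbig ∅ (by simp)
  exact SepState.false hG le_rfl hr0 hr hbig _ ∅ (fun _ => ∅) (fun _ => ∅) F
    ⟨by simp, by simp, by simp, by simp, by simp, by simpa using hF, hb, by simp⟩ rfl

/-- The component of `v` in `G - S`. -/
def compOf {V : Type} [Fintype V] (G : SimpleGraph V) (S : Finset V) (v : V) : Finset V :=
  univ.filter fun u => Reach G {x | x ∉ S} v u

lemma mem_compOf {V : Type} [Fintype V] {G : SimpleGraph V} {S : Finset V} {u v : V} :
    u ∈ compOf G S v ↔ Reach G {x | x ∉ S} v u := by simp [compOf]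

lemma isComp_compOf {V : Type} [Fintype V] {G : SimpleGraph V} {S : Finset V} {v : V}
    (hv : v ∉ S) : IsComp G S (compOf G S v) := by
  refine ⟨ConnOn.of_root (r := v) (mem_compOf.2 .refl) ?_, ?_, ?_⟩
  · intro x hx
    have hx2 := mem_compOf.1 hx
    clear hx
    induction hx2 with
    | refl => exact .refl
    | @tail b c hb hbc ih => exact ih.tail ⟨hbc.1, mem_compOf.2 hb, mem_compOf.2 (hb.tail hbc)⟩
  · refine disjoint_left.2 fun u hu => ?_
    exact (mem_compOf.1 hu).mem (s := {x | x ∉ S}) hv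
  · intro u hu x hux hx
    refine mem_compOf.2 ((mem_compOf.1 hu).tail ⟨hux, ?_, hx⟩)
    exact (mem_compOf.1 hu).mem (s := {x | x ∉ S}) hv

theorem K5Free.exists_split {V : Type} [Fintype V] {G : SimpleGraph V} (hG : K5Free G)
    (w : V → ℕ) (hw : ∀ v, w v ≤ 1) {r : ℕ} (hr0 : 0 < r) (hr : 5 * Fintype.card V ≤ r * r) :
    ∃ S A : Finset V, #S ≤ 5 * r ∧ (∀ u v, G.Adj u v → u ∉ S → v ∉ S → (u ∈ A ↔ v ∈ A)) ∧
      3 * ∑ v ∈ A, w v ≤ 2 * ∑ v, w v + 3 ∧ 3 * ∑ v ∈ Aᶜ, w v ≤ 2 * ∑ v, w v + 3 := by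
  obtain ⟨S, hS, hcomp⟩ := hG.exists_separator w hr0 hr
  obtain ⟨W, hW⟩ : ∃ W, W = ∑ v, w v := ⟨_, rfl⟩
  rw [← hW] at hcomp ⊢
  have hcompl : ∀ A : Finset V, ∑ v ∈ A, w v + ∑ v ∈ Aᶜ, w v = W := fun A => by
    rw [hW]; exact sum_add_sum_compl A w
  let Closed : Finset V → Prop := fun A => ∀ u v, G.Adj u v → u ∉ S → v ∉ S → u ∈ A → v ∈ A
  have hiff : ∀ A, Closed A → ∀ u v, G.Adj u v → u ∉ S → v ∉ S → (u ∈ A ↔ v ∈ A) :=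
    fun A hA u v h hu hv => ⟨hA u v h hu hv, hA v u h.symm hv hu⟩
  have hCempty : Closed ∅ := fun u v _ _ _ h => absurd h (notMem_empty _)
  suffices ∃ A, Closed A ∧ 3 * ∑ v ∈ A, w v ≤ 2 * W + 3 ∧ 3 * ∑ v ∈ Aᶜ, w v ≤ 2 * W + 3 by
    obtain ⟨A, hA, h1, h2⟩ := this
    exact ⟨S, A, hS, hiff A hA, h1, h2⟩
  by_cases hW3 : W ≤ 3
  · exact ⟨∅, hCempty, by simp, by have := hcompl ∅; simp at this ⊢; omega⟩
  by_cases hbig : ∃ F, IsComp G S F ∧ W ≤ 3 * ∑ v ∈ F, w v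
  · obtain ⟨F, hF, hFW⟩ := hbig
    refine ⟨F, fun u v h hu hv huF => hF.closed u huF v h hv, ?_, ?_⟩
    · have := hcomp F hF
      omega
    · have := hcompl F
      omega
  push Not at hbig
  let 𝒜 : Finset (Finset V) := univ.filter fun A => Closed A ∧ 3 * ∑ v ∈ A, w v ≤ 2 * W
  have hmem : ∀ A, A ∈ 𝒜 ↔ Closed A ∧ 3 * ∑ v ∈ A, w v ≤ 2 * W := fun A => by simp [𝒜]
  obtain ⟨A, hA, hmax⟩ := exists_max_image 𝒜 (fun A => #A) ⟨∅, (hmem _).2 ⟨hCempty, by simp⟩⟩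
  rw [hmem] at hA
  refine ⟨A, hA.1, by omega, ?_⟩
  have hc := hcompl A
  by_contra hcon
  obtain ⟨v, hv⟩ : ∃ v, v ∉ A := by
    by_contra! hall
    rw [eq_univ_of_forall hall] at hcon
    simp at hcon
  obtain ⟨F, hvF, hFc, hFw⟩ : ∃ F : Finset V, v ∈ F ∧ Closed F ∧ 3 * ∑ v ∈ F, w v < W := by
    by_cases hvS : v ∈ S
    · refine ⟨{v}, mem_singleton_self v, fun u x _ hu _ hu' => ?_, ?_⟩
      · rw [mem_singleton] at hu'
        exact absurd (hu' ▸ hvS) hu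
      · have := hw v
        rw [sum_singleton]
        omega
    · have hF := isComp_compOf (G := G) hvS
      exact ⟨_, mem_compOf.2 .refl, fun u x h hu hx huF => hF.closed u huF x h hx, hbig _ hF⟩
  have hunion : A ∪ F ∈ 𝒜 := by
    refine (hmem _).2 ⟨fun u x h hu hx hux => ?_, ?_⟩
    · rw [mem_union] at hux ⊢
      exact hux.imp (hA.1 u x h hu hx) (hFc u x h hu hx)
    · have : ∑ v ∈ A ∪ F, w v ≤ ∑ v ∈ A, w v + ∑ v ∈ F, w v := by
        rw [← sum_union_inter]; omega
      omega
  have h1 := hmax _ hunion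
  have h2 : #A < #(A ∪ F) :=
    card_lt_card ⟨subset_union_left, fun h => hv (h (mem_union_right _ hvF))⟩
  omega

theorem K5Free.exists_coloring {V : Type} [Fintype V] {G : SimpleGraph V} (hG : K5Free G)
    (w : V → ℕ) (hw : ∀ v, w v ≤ 1) {r : ℕ} (hr0 : 0 < r) (hr : 5 * Fintype.card V ≤ r * r)
    (J : ℕ) : ∃ (S : Finset V) (κ : V → ℕ), #S ≤ 2 ^ J * (5 * r) ∧ (∀ v, κ v < 2 ^ J) ∧
      (∀ u v, G.Adj u v → u ∉ S → v ∉ S → κ u = κ v) ∧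
      ∀ q, 3 ^ J * ∑ v, (if κ v = q then w v else 0) ≤ 2 ^ J * ∑ v, w v + 3 ^ (J + 1) := by
  suffices ∃ (S : Finset V) (κ : V → ℕ), #S ≤ (2 ^ J - 1) * (5 * r) ∧ (∀ v, κ v < 2 ^ J) ∧
      (∀ u v, G.Adj u v → u ∉ S → v ∉ S → κ u = κ v) ∧
      ∀ q, 3 ^ J * ∑ v, (if κ v = q then w v else 0) ≤ 2 ^ J * ∑ v, w v + 3 ^ (J + 1) by
    obtain ⟨S, κ, h, h'⟩ := this
    exact ⟨S, κ, h.trans (Nat.mul_le_mul_right _ (Nat.sub_le _ _)), h'⟩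
  induction J with
  | zero =>
    refine ⟨∅, fun _ => 0, by simp, by simp, by simp, fun q => ?_⟩
    have : ∑ v : V, (if 0 = q then w v else 0) ≤ ∑ v, w v :=
      sum_le_sum fun v _ => by split_ifs <;> simp
    simpa using this.trans (Nat.le_add_right _ _)
  | succ J ih =>
    obtain ⟨S, κ, hS, hκ, hadj, hsum⟩ := ih
    have hsplit := fun q => hG.exists_split (fun v => if κ v = q then w v else 0)
      (fun v => by split_ifs; exacts [hw v, by simp]) hr0 hr
    choose S' A hS' hA h1 h2 using hsplit
    refine ⟨S ∪ (range (2 ^ J)).biUnion S',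
      fun v => 2 * κ v + if v ∈ A (κ v) then 1 else 0, ?_, ?_, ?_, ?_⟩
    · have e1 := card_union_le S ((range (2 ^ J)).biUnion S')
      have e2 := card_biUnion_le_card_mul (range (2 ^ J)) S' (5 * r) fun q _ => hS' q
      rw [card_range] at e2
      have e3 : (2 ^ (J + 1) - 1) = (2 ^ J - 1) + 2 ^ J := by
        have := Nat.one_le_two_pow (n := J)
        rw [pow_succ]; omega
      rw [e3, Nat.add_mul]
      omega
    · intro v
      have := hκ v
      rw [pow_succ]
      dsimp only
      split_ifs <;> omega
    · intro u v huv hu hv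
      rw [mem_union, not_or] at hu hv
      have e := hadj u v huv hu.1 hv.1
      have hnot : ∀ x, κ x = κ u → x ∉ (range (2 ^ J)).biUnion S' → x ∉ S' (κ u) := fun x hx h h' =>
        h (mem_biUnion.2 ⟨κ u, mem_range.2 (hκ u), h'⟩)
      have := hA (κ u) u v huv (hnot u rfl hu.2) (hnot v e.symm hv.2)
      dsimp only
      rw [← e]
      simp only [this]
    · intro q
      have key : ∃ q', 3 * ∑ v, (if 2 * κ v + (if v ∈ A (κ v) then 1 else 0) = q then w v else 0) ≤
          2 * (∑ v, if κ v = q' then w v else 0) + 3 := by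
        refine ⟨q / 2, ?_⟩
        by_cases hq : q % 2 = 1
        · refine le_trans ?_ (h1 (q / 2))
          refine Nat.mul_le_mul_left _ ?_
          rw [← sum_filter_add_sum_filter_not univ (fun v => v ∈ A (q / 2))]
          rw [sum_eq_zero (s := univ.filter fun v => v ∉ A (q / 2)), add_zero]
          · rw [filter_univ_mem]
            refine sum_le_sum fun v hv => ?_
            split_ifs <;> omega
          · intro v hv
            rw [mem_filter] at hv
            rw [if_neg]
            intro h
            have hκq : κ v = q / 2 := by split_ifs at h <;> omega
            rw [hκq, if_neg hv.2] at h
            omega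
        · refine le_trans ?_ (h2 (q / 2))
          refine Nat.mul_le_mul_left _ ?_
          rw [← sum_filter_add_sum_filter_not univ (fun v => v ∈ A (q / 2))]
          rw [sum_eq_zero (s := univ.filter fun v => v ∈ A (q / 2)), zero_add]
          · rw [← compl_filter, filter_univ_mem]
            refine sum_le_sum fun v hv => ?_
            split_ifs <;> omega
          · intro v hv
            rw [mem_filter] at hv
            rw [if_neg]
            intro h
            have hκq : κ v = q / 2 := by split_ifs at h <;> omega
            rw [hκq, if_pos hv.2] at h
            omega
      obtain ⟨q', hq'⟩ := key
      have := hsum q'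
      calc 3 ^ (J + 1) * ∑ v, (if 2 * κ v + (if v ∈ A (κ v) then 1 else 0) = q then w v else 0)
          = 3 ^ J * (3 * ∑ v, (if 2 * κ v + (if v ∈ A (κ v) then 1 else 0) = q then w v else 0)) := by
            ring
        _ ≤ 3 ^ J * (2 * (∑ v, if κ v = q' then w v else 0) + 3) := Nat.mul_le_mul_left _ hq'
        _ = 2 * (3 ^ J * ∑ v, if κ v = q' then w v else 0) + 3 * 3 ^ J := by ring
        _ ≤ 2 * (2 ^ J * ∑ v, w v + 3 ^ (J + 1)) + 3 * 3 ^ J := by gcongr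
        _ = 2 ^ (J + 1) * ∑ v, w v + 3 ^ (J + 1 + 1) := by ring

/-- Twice the signed area of the triangle `p q r`. -/
def area (p q r : ℝ × ℝ) : ℝ :=
  (q.1 - p.1) * (r.2 - p.2) - (r.1 - p.1) * (q.2 - p.2)

/-- The orientation of a triple of points, modulo two. -/
def orient (p q r : ℝ × ℝ) : ZMod 2 := if 0 < area p q r then 1 else 0

lemma area_rot (p q r : ℝ × ℝ) : area q r p = area p q r := by unfold area; ring

lemma area_swap (p q r : ℝ × ℝ) : area q p r = - area p q r := by unfold area; ring

lemma orient_rot (p q r : ℝ × ℝ) : orient q r p = orient p q r := by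
  unfold orient; rw [area_rot]

lemma orient_swap {p q r : ℝ × ℝ} (h : area p q r ≠ 0) : orient q p r = orient p q r + 1 := by
  unfold orient
  rw [area_swap]
  rcases lt_or_gt_of_ne h with h | h
  · rw [if_pos (by linarith), if_neg (by linarith)]; rfl
  · rw [if_neg (by linarith), if_pos h]; rfl

/-- The sign pattern forbidden by the three-term Grassmann-Plücker relation. -/
def PlueckerSigns (x₁ x₂ x₃ x₄ x₅ x₆ : ZMod 2) : Prop :=
  ¬ (x₁ + x₂ = 0 ∧ x₃ + x₄ = 1 ∧ x₅ + x₆ = 0) ∧ ¬ (x₁ + x₂ = 1 ∧ x₃ + x₄ = 0 ∧ x₅ + x₆ = 1)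

instance (x₁ x₂ x₃ x₄ x₅ x₆ : ZMod 2) : Decidable (PlueckerSigns x₁ x₂ x₃ x₄ x₅ x₆) := by
  unfold PlueckerSigns; infer_instance

lemma orient_add_eq_zero {p q r p' q' r' : ℝ × ℝ} (h : area p q r ≠ 0) (h' : area p' q' r' ≠ 0) :
    (orient p q r + orient p' q' r' = 0 ↔ 0 < area p q r * area p' q' r') ∧
    (orient p q r + orient p' q' r' = 1 ↔ area p q r * area p' q' r' < 0) := by
  unfold orient
  rcases lt_or_gt_of_ne h with h | h <;> rcases lt_or_gt_of_ne h' with h' | h'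
  · rw [if_neg (by linarith), if_neg (by linarith)]
    have := mul_pos_of_neg_of_neg h h'
    exact ⟨⟨fun _ => this, fun _ => rfl⟩, ⟨fun h => absurd h (by decide), fun h => by linarith⟩⟩
  · rw [if_neg (by linarith), if_pos h']
    have := mul_neg_of_neg_of_pos h h'
    exact ⟨⟨fun h => absurd h (by decide), fun h => by linarith⟩, ⟨fun _ => this, fun _ => rfl⟩⟩
  · rw [if_pos h, if_neg (by linarith)]
    have := mul_neg_of_pos_of_neg h h'
    exact ⟨⟨fun h => absurd h (by decide), fun h => by linarith⟩, ⟨fun _ => this, fun _ => rfl⟩⟩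
  · rw [if_pos h, if_pos h']
    have := mul_pos h h'
    exact ⟨⟨fun _ => this, fun _ => rfl⟩, ⟨fun h => absurd h (by decide), fun h => by linarith⟩⟩

lemma plueckerSigns (a b c d e : ℝ × ℝ) (h₁ : area a b c ≠ 0) (h₂ : area a d e ≠ 0)
    (h₃ : area a b d ≠ 0) (h₄ : area a c e ≠ 0) (h₅ : area a b e ≠ 0) (h₆ : area a c d ≠ 0) :
    PlueckerSigns (orient a b c) (orient a d e) (orient a b d) (orient a c e) (orient a b e)
      (orient a c d) := by
  have key : area a b c * area a d e - area a b d * area a c e + area a b e * area a c d = 0 := by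
    unfold area; ring
  unfold PlueckerSigns
  rw [(orient_add_eq_zero h₁ h₂).1, (orient_add_eq_zero h₁ h₂).2, (orient_add_eq_zero h₃ h₄).1,
    (orient_add_eq_zero h₃ h₄).2, (orient_add_eq_zero h₅ h₆).1, (orient_add_eq_zero h₅ h₆).2]
  constructor <;> rintro ⟨h1, h2, h3⟩ <;> linarith

/-- The parity of the number of crossings of the segments `a b` and `c d`. -/
def crossing (a b c d : ℝ × ℝ) : ZMod 2 :=
  (orient a b c + orient a b d) * (orient c d a + orient c d b)

/-- Whether `d` lies in the triangle `a b c`. -/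
def inTriangle (a b c d : ℝ × ℝ) : ZMod 2 :=
  if orient a b d = orient b c d ∧ orient b c d = orient c a d then 1 else 0

lemma crossing_comm (a b c d : ℝ × ℝ) : crossing a b c d = crossing c d a b := mul_comm _ _

lemma segment_inter_of_crossing {a b c d : ℝ × ℝ} (hab : area a b c ≠ 0) (habd : area a b d ≠ 0)
    (hcda : area c d a ≠ 0) (hcdb : area c d b ≠ 0) (h : crossing a b c d ≠ 0) :
    ¬ Disjoint (segment ℝ a b) (segment ℝ c d) := by
  have h1 : orient a b c + orient a b d ≠ 0 := left_ne_zero_of_mul h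
  have h2 : orient c d a + orient c d b ≠ 0 := right_ne_zero_of_mul h
  rw [Ne, (orient_add_eq_zero hab habd).1, not_lt] at h1
  rw [Ne, (orient_add_eq_zero hcda hcdb).1, not_lt] at h2
  have aux : ∀ x y : ℝ, x ≠ 0 → y ≠ 0 → x * y ≤ 0 → x - y ≠ 0 ∧ 0 ≤ x / (x - y) ∧
      0 ≤ 1 - x / (x - y) := by
    intro x y hx hy hxy
    have hne : x - y ≠ 0 := by
      intro h0
      have : x = y := by linarith
      subst this
      have := mul_self_pos.2 hx
      linarith
    refine ⟨hne, ?_, ?_⟩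
    · rw [div_nonneg_iff]
      rcases lt_or_gt_of_ne hx with h | h
      · right; constructor <;> nlinarith
      · left; constructor <;> nlinarith
    · have : 1 - x / (x - y) = - y / (x - y) := by field_simp; ring
      rw [this, div_nonneg_iff]
      rcases lt_or_gt_of_ne hx with h | h
      · right; constructor <;> nlinarith
      · left; constructor <;> nlinarith
  obtain ⟨e1, e2, e3⟩ := aux _ _ hcda hcdb h2
  obtain ⟨f1, f2, f3⟩ := aux _ _ hab habd h1
  rw [Set.not_disjoint_iff]
  refine ⟨_, ⟨_, _, e3, e2, by ring, rfl⟩, ⟨_, _, f3, f2, by ring, ?_⟩⟩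
  have rel : area a b c - area a b d = -(area c d a - area c d b) := by unfold area; ring
  rw [rel]
  have hD : area c d a - area c d b ≠ 0 := e1
  ext
  · simp only [Prod.fst_add, Prod.smul_fst, smul_eq_mul]
    field_simp
    unfold area
    ring
  · simp only [Prod.snd_add, Prod.smul_snd, smul_eq_mul]
    field_simp
    unfold area
    ring

set_option maxRecDepth 100000 in
lemma triangle_parity_aux : ∀ abc abd abe acd ace ade bcd bce bde cde : ZMod 2,
    PlueckerSigns abc ade abd ace abe acd → PlueckerSigns abc bde abd bce abe bcd →
    PlueckerSigns abc cde acd bce ace bcd → PlueckerSigns abd cde acd bde ade bcd →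
    PlueckerSigns abe cde ace bde ade bce →
    (abd + abe) * (ade + bde) + (bcd + bce) * (bde + cde) + (acd + 1 + (ace + 1)) * (cde + ade) =
      (if abd = bcd ∧ bcd = acd + 1 then 1 else 0) +
      (if abe = bce ∧ bce = ace + 1 then 1 else 0) := by
  decide +kernel

set_option maxRecDepth 100000 in
lemma crossing_parity_aux : ∀ abc abd abe acd ace ade bcd bce bde cde : ZMod 2,
    PlueckerSigns abc ade abd ace abe acd → PlueckerSigns abc bde abd bce abe bcd →
    PlueckerSigns abc cde acd bce ace bcd → PlueckerSigns abd cde acd bde ade bcd →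
    PlueckerSigns abe cde ace bde ade bce →
    ((abc + abd) * (acd + bcd) + (abc + 1 + acd) * (abd + (bcd + 1)) +
      (abd + 1 + (acd + 1)) * (abc + bcd)) +
    ((abc + abe) * (ace + bce) + (abc + 1 + ace) * (abe + (bce + 1)) +
      (abe + 1 + (ace + 1)) * (abc + bce)) +
    ((abd + abe) * (ade + bde) + (abd + 1 + ade) * (abe + (bde + 1)) +
      (abe + 1 + (ade + 1)) * (abd + bde)) +
    ((acd + ace) * (ade + cde) + (acd + 1 + ade) * (ace + (cde + 1)) +
      (ace + 1 + (ade + 1)) * (acd + cde)) +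
    ((bcd + bce) * (bde + cde) + (bcd + 1 + bde) * (bce + (cde + 1)) +
      (bce + 1 + (bde + 1)) * (bcd + cde)) = 1 := by
  decide +kernel

/-- No three of the points `p i` are collinear. -/
def GeneralPosition {ι : Type} (p : ι → ℝ × ℝ) : Prop :=
  ∀ i j k, i ≠ j → i ≠ k → j ≠ k → area (p i) (p j) (p k) ≠ 0

section General

variable {ι : Type} {p : ι → ℝ × ℝ}

lemma GeneralPosition.plueckerSigns_all (hp : GeneralPosition p) {a b c d e : ι}
    (hab : a ≠ b) (hac : a ≠ c) (had : a ≠ d) (hae : a ≠ e) (hbc : b ≠ c) (hbd : b ≠ d)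
    (hbe : b ≠ e) (hcd : c ≠ d) (hce : c ≠ e) (hde : d ≠ e) :
    PlueckerSigns (orient (p a) (p b) (p c)) (orient (p a) (p d) (p e)) (orient (p a) (p b) (p d))
      (orient (p a) (p c) (p e)) (orient (p a) (p b) (p e)) (orient (p a) (p c) (p d)) :=
  plueckerSigns _ _ _ _ _ (hp _ _ _ hab hac hbc) (hp _ _ _ had hae hde) (hp _ _ _ hab had hbd)
    (hp _ _ _ hac hae hce) (hp _ _ _ hab hae hbe) (hp _ _ _ hac had hcd)

lemma PlueckerSigns.of_flip : ∀ {x₁ x₂ x₃ x₄ x₅ x₆ : ZMod 2},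
    (PlueckerSigns (x₁ + 1) x₂ (x₃ + 1) x₄ (x₅ + 1) x₆ ∨
    PlueckerSigns x₁ x₂ (x₃ + 1) (x₄ + 1) (x₅ + 1) (x₆ + 1) ∨
    PlueckerSigns x₁ (x₂ + 1) x₃ (x₄ + 1) (x₅ + 1) x₆) → PlueckerSigns x₁ x₂ x₃ x₄ x₅ x₆ := by
  decide +kernel

lemma GeneralPosition.swap (hp : GeneralPosition p) {a b c : ι} (hab : a ≠ b) (hac : a ≠ c)
    (hbc : b ≠ c) : orient (p b) (p a) (p c) = orient (p a) (p b) (p c) + 1 :=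
  orient_swap (hp _ _ _ hab hac hbc)

lemma GeneralPosition.five (hp : GeneralPosition p) {a b c d e : ι}
    (hab : a ≠ b) (hac : a ≠ c) (had : a ≠ d) (hae : a ≠ e) (hbc : b ≠ c) (hbd : b ≠ d)
    (hbe : b ≠ e) (hcd : c ≠ d) (hce : c ≠ e) (hde : d ≠ e) :
    PlueckerSigns (orient (p a) (p b) (p c)) (orient (p a) (p d) (p e)) (orient (p a) (p b) (p d))
      (orient (p a) (p c) (p e)) (orient (p a) (p b) (p e)) (orient (p a) (p c) (p d)) ∧
    PlueckerSigns (orient (p a) (p b) (p c)) (orient (p b) (p d) (p e)) (orient (p a) (p b) (p d))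
      (orient (p b) (p c) (p e)) (orient (p a) (p b) (p e)) (orient (p b) (p c) (p d)) ∧
    PlueckerSigns (orient (p a) (p b) (p c)) (orient (p c) (p d) (p e)) (orient (p a) (p c) (p d))
      (orient (p b) (p c) (p e)) (orient (p a) (p c) (p e)) (orient (p b) (p c) (p d)) ∧
    PlueckerSigns (orient (p a) (p b) (p d)) (orient (p c) (p d) (p e)) (orient (p a) (p c) (p d))
      (orient (p b) (p d) (p e)) (orient (p a) (p d) (p e)) (orient (p b) (p c) (p d)) ∧
    PlueckerSigns (orient (p a) (p b) (p e)) (orient (p c) (p d) (p e)) (orient (p a) (p c) (p e))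
      (orient (p b) (p d) (p e)) (orient (p a) (p d) (p e)) (orient (p b) (p c) (p e)) := by
  refine ⟨hp.plueckerSigns_all hab hac had hae hbc hbd hbe hcd hce hde, ?_, ?_, ?_, ?_⟩
  · refine .of_flip (Or.inl ?_)
    rw [← hp.swap hab hac hbc, ← hp.swap hab had hbd, ← hp.swap hab hae hbe]
    exact hp.plueckerSigns_all hab.symm hbc hbd hbe hac had hae hcd hce hde
  · refine .of_flip (Or.inr (Or.inl ?_))
    rw [← hp.swap hac had hcd, ← hp.swap hbc hbe hce, ← hp.swap hac hae hce,
      ← hp.swap hbc hbd hcd, orient_rot (p c) (p a) (p b)]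
    exact hp.plueckerSigns_all hac.symm hbc.symm hcd hce hab had hae hbd hbe hde
  · refine .of_flip (Or.inr (Or.inr ?_))
    rw [← hp.swap hcd hce hde, ← hp.swap hbd hbe hde, ← hp.swap had hae hde,
      orient_rot (p d) (p a) (p b), orient_rot (p d) (p a) (p c), orient_rot (p d) (p b) (p c)]
    exact hp.plueckerSigns_all had.symm hbd.symm hcd.symm hde hab hac hae hbc hbe hce
  · rw [orient_rot (p e) (p a) (p b), orient_rot (p e) (p c) (p d),
      orient_rot (p e) (p a) (p c), orient_rot (p e) (p b) (p d),
      orient_rot (p e) (p a) (p d), orient_rot (p e) (p b) (p c)]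
    exact hp.plueckerSigns_all hae.symm hbe.symm hce.symm hde.symm hab hac had hbc hbd hcd

lemma GeneralPosition.crossing_triangle (hp : GeneralPosition p) {a b c d e : ι}
    (hab : a ≠ b) (hac : a ≠ c) (had : a ≠ d) (hae : a ≠ e) (hbc : b ≠ c) (hbd : b ≠ d)
    (hbe : b ≠ e) (hcd : c ≠ d) (hce : c ≠ e) (hde : d ≠ e) :
    crossing (p a) (p b) (p d) (p e) + crossing (p b) (p c) (p d) (p e) +
      crossing (p c) (p a) (p d) (p e) =
    inTriangle (p a) (p b) (p c) (p d) + inTriangle (p a) (p b) (p c) (p e) := by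
  obtain ⟨h1, h2, h3, h4, h5⟩ := hp.five hab hac had hae hbc hbd hbe hcd hce hde
  unfold crossing inTriangle
  rw [hp.swap hac had hcd, hp.swap hac hae hce, orient_rot (p a) (p d) (p e),
    orient_rot (p b) (p d) (p e), orient_rot (p c) (p d) (p e)]
  exact triangle_parity_aux _ _ _ _ _ _ _ _ _ _ h1 h2 h3 h4 h5

lemma GeneralPosition.crossing_quad (hp : GeneralPosition p) {a b c d : ι}
    (hab : a ≠ b) (hac : a ≠ c) (had : a ≠ d) (hbc : b ≠ c) (hbd : b ≠ d) (hcd : c ≠ d) :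
    crossing (p a) (p b) (p c) (p d) + crossing (p a) (p c) (p b) (p d) +
      crossing (p a) (p d) (p b) (p c) =
    (orient (p a) (p b) (p c) + orient (p a) (p b) (p d)) *
      (orient (p a) (p c) (p d) + orient (p b) (p c) (p d)) +
    (orient (p a) (p b) (p c) + 1 + orient (p a) (p c) (p d)) *
      (orient (p a) (p b) (p d) + (orient (p b) (p c) (p d) + 1)) +
    (orient (p a) (p b) (p d) + 1 + (orient (p a) (p c) (p d) + 1)) *
      (orient (p a) (p b) (p c) + orient (p b) (p c) (p d)) := by
  unfold crossing
  rw [orient_rot (p a) (p c) (p d), orient_rot (p b) (p c) (p d), orient_rot (p b) (p a) (p c),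
    hp.swap hab hac hbc, orient_rot (p a) (p b) (p d), orient_rot (p c) (p b) (p d),
    hp.swap hbc hbd hcd, orient_rot (p b) (p a) (p d), hp.swap hab had hbd,
    orient_rot (p c) (p a) (p d), hp.swap hac had hcd, orient_rot (p a) (p b) (p c)]

lemma GeneralPosition.crossing_sum (hp : GeneralPosition p) {a b c d e : ι}
    (hab : a ≠ b) (hac : a ≠ c) (had : a ≠ d) (hae : a ≠ e) (hbc : b ≠ c) (hbd : b ≠ d)
    (hbe : b ≠ e) (hcd : c ≠ d) (hce : c ≠ e) (hde : d ≠ e) :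
    (crossing (p a) (p b) (p c) (p d) + crossing (p a) (p c) (p b) (p d) +
      crossing (p a) (p d) (p b) (p c)) +
    (crossing (p a) (p b) (p c) (p e) + crossing (p a) (p c) (p b) (p e) +
      crossing (p a) (p e) (p b) (p c)) +
    (crossing (p a) (p b) (p d) (p e) + crossing (p a) (p d) (p b) (p e) +
      crossing (p a) (p e) (p b) (p d)) +
    (crossing (p a) (p c) (p d) (p e) + crossing (p a) (p d) (p c) (p e) +
      crossing (p a) (p e) (p c) (p d)) +
    (crossing (p b) (p c) (p d) (p e) + crossing (p b) (p d) (p c) (p e) +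
      crossing (p b) (p e) (p c) (p d)) = 1 := by
  obtain ⟨h1, h2, h3, h4, h5⟩ := hp.five hab hac had hae hbc hbd hbe hcd hce hde
  rw [hp.crossing_quad hab hac had hbc hbd hcd, hp.crossing_quad hab hac hae hbc hbe hce,
    hp.crossing_quad hab had hae hbd hbe hde, hp.crossing_quad hac had hae hcd hce hde,
    hp.crossing_quad hbc hbd hbe hcd hce hde]
  exact crossing_parity_aux _ _ _ _ _ _ _ _ _ _ h1 h2 h3 h4 h5

lemma GeneralPosition.crossing_swap (hp : GeneralPosition p) {a b d e : ι}
    (hab : a ≠ b) (had : a ≠ d) (hae : a ≠ e) (hbd : b ≠ d) (hbe : b ≠ e) :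
    crossing (p b) (p a) (p d) (p e) = crossing (p a) (p b) (p d) (p e) := by
  unfold crossing
  rw [hp.swap hab had hbd, hp.swap hab hae hbe]
  have h2 : (2 : ZMod 2) = 0 := rfl
  linear_combination (orient (p d) (p e) (p b) + orient (p d) (p e) (p a)) * h2

/-- The parity of the number of triangles of the fan spanned by the chain `c` that contain `x`. -/
def fanParity (p : ι → ℝ × ℝ) (c : ℕ → ι) (m : ℕ) (x : ι) : ZMod 2 :=
  ∑ k ∈ range m, inTriangle (p (c 0)) (p (c (k + 1))) (p (c (k + 2))) (p x)

lemma GeneralPosition.sum_crossing_chain (hp : GeneralPosition p) {c : ℕ → ι} {d e : ι}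
    (hde : d ≠ e) (m : ℕ) (hc : Set.InjOn c (Set.Iic (m + 1))) (hd : ∀ k ≤ m + 1, c k ≠ d)
    (he : ∀ k ≤ m + 1, c k ≠ e) :
    ∑ k ∈ range (m + 1), crossing (p (c k)) (p (c (k + 1))) (p d) (p e) =
      crossing (p (c 0)) (p (c (m + 1))) (p d) (p e) + fanParity p c m d + fanParity p c m e := by
  induction m with
  | zero => simp [fanParity]
  | succ m ih =>
    have h2 : (2 : ZMod 2) = 0 := rfl
    have hne : ∀ i j, i ≤ m + 1 + 1 → j ≤ m + 1 + 1 → i ≠ j → c i ≠ c j :=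
      fun i j hi hj hij h => hij (hc hi hj h)
    rw [sum_range_succ, ih (hc.mono (Set.Iic_subset_Iic.2 (by omega))) (fun k hk => hd k (by omega))
      (fun k hk => he k (by omega))]
    have tri := hp.crossing_triangle (hne 0 (m + 1) (by omega) (by omega) (by omega))
      (hne 0 (m + 2) (by omega) (by omega) (by omega)) (hd 0 (by omega)) (he 0 (by omega))
      (hne (m + 1) (m + 2) (by omega) (by omega) (by omega)) (hd (m + 1) (by omega))
      (he (m + 1) (by omega)) (hd (m + 2) (by omega)) (he (m + 2) (by omega)) hde
    rw [hp.crossing_swap (hne 0 (m + 2) (by omega) (by omega) (by omega)) (hd 0 (by omega))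
      (he 0 (by omega)) (hd (m + 2) (by omega)) (he (m + 2) (by omega))] at tri
    unfold fanParity
    rw [sum_range_succ, sum_range_succ _ m]
    linear_combination tri - crossing (p (c 0)) (p (c (m + 2))) (p d) (p e) * h2

lemma GeneralPosition.sum_crossing_chains (hp : GeneralPosition p) {c d : ℕ → ι} (m : ℕ)
    (hc : Set.InjOn c (Set.Iic (m + 1))) (hd : Set.InjOn d (Set.Iic (m + 1)))
    (hcd : ∀ k ≤ m + 1, ∀ l ≤ m + 1, c k ≠ d l) :
    ∑ l ∈ range (m + 1), ∑ k ∈ range (m + 1),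
        crossing (p (c k)) (p (c (k + 1))) (p (d l)) (p (d (l + 1))) =
      crossing (p (c 0)) (p (c (m + 1))) (p (d 0)) (p (d (m + 1))) +
        fanParity p c m (d 0) + fanParity p c m (d (m + 1)) +
        fanParity p d m (c 0) + fanParity p d m (c (m + 1)) := by
  have h2 : (2 : ZMod 2) = 0 := rfl
  have h1 : ∀ l ∈ range (m + 1), ∑ k ∈ range (m + 1),
      crossing (p (c k)) (p (c (k + 1))) (p (d l)) (p (d (l + 1))) =
      crossing (p (d l)) (p (d (l + 1))) (p (c 0)) (p (c (m + 1))) +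
        (fanParity p c m (d l) + fanParity p c m (d (l + 1))) := by
    intro l hl
    rw [mem_range] at hl
    rw [hp.sum_crossing_chain _ m hc (fun k hk => hcd k hk l (by omega))
      (fun k hk => hcd k hk (l + 1) (by omega)), crossing_comm (p (d l)), add_assoc]
    intro h
    have := hd (Set.mem_Iic.2 (by omega)) (Set.mem_Iic.2 (by omega)) h
    omega
  have htel : ∀ f : ℕ → ZMod 2, ∀ n, ∑ l ∈ range n, (f l + f (l + 1)) = f 0 + f n := by
    intro f n
    induction n with
    | zero => rw [sum_range_zero]; linear_combination - f 0 * h2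
    | succ n ih => rw [sum_range_succ, ih]; linear_combination f n * h2
  rw [sum_congr rfl h1, sum_add_distrib, htel (fun l => fanParity p c m (d l)),
    hp.sum_crossing_chain _ m hd (fun k hk h => hcd 0 (by omega) k hk h.symm)
      (fun k hk h => hcd (m + 1) (by omega) k hk h.symm), crossing_comm (p (d 0))]
  · ring
  · intro h
    have := hc (Set.mem_Iic.2 (by omega)) (Set.mem_Iic.2 (by omega)) h
    omega

lemma eventually_quadratic_ne {A B C : ℝ} (hC : C ≠ 0) :
    ∀ᶠ t in nhdsWithin (0 : ℝ) {0}ᶜ, A + t * (B + t * C) ≠ 0 := by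
  have hne : ∀ᶠ t in nhdsWithin (0 : ℝ) {0}ᶜ, t ≠ 0 := self_mem_nhdsWithin
  have hcont : ∀ f : ℝ → ℝ, Continuous f → f 0 ≠ 0 →
      ∀ᶠ t in nhdsWithin (0 : ℝ) {0}ᶜ, f t ≠ 0 := fun f hf h0 =>
    (hf.continuousAt.eventually_ne h0).filter_mono nhdsWithin_le_nhds
  by_cases hA : A = 0
  · subst hA
    by_cases hB : B = 0
    · subst hB
      filter_upwards [hne] with t ht
      simp [ht, hC]
    · filter_upwards [hne, hcont (fun t => B + t * C) (by fun_prop) (by simpa using hB)] with t ht h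
      rw [zero_add]
      exact mul_ne_zero ht h
  · exact hcont _ (by fun_prop) (by simpa using hA)

lemma exists_generalPosition [Finite ι] (p : ι → ℝ × ℝ) :
    ∃ q : ι → ℝ × ℝ, GeneralPosition q ∧ ∀ a b c d,
      Disjoint (segment ℝ (p a) (p b)) (segment ℝ (p c) (p d)) →
      Disjoint (segment ℝ (q a) (q b)) (segment ℝ (q c) (q d)) := by
  obtain ⟨s, hs⟩ : ∃ s : ι → ℝ, Function.Injective s := by
    obtain ⟨n, ⟨e⟩⟩ := Finite.exists_equiv_fin ι
    exact ⟨fun i => ((e i : ℕ) : ℝ), fun i j h =>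
      e.injective (Fin.ext (Nat.cast_injective (R := ℝ) h))⟩
  let q : ℝ → ι → ℝ × ℝ := fun t i => ((p i).1 + t * s i, (p i).2 + t * (s i) ^ 2)
  have hq0 : q 0 = p := by ext i <;> simp [q]
  have h1 : ∀ᶠ t in nhdsWithin (0 : ℝ) {0}ᶜ, GeneralPosition (q t) := by
    unfold GeneralPosition
    simp only [Filter.eventually_all]
    intro i j k hij hik hjk
    have hC : (s j - s i) * (s k - s i) * (s k - s j) ≠ 0 := by
      refine mul_ne_zero (mul_ne_zero ?_ ?_) ?_ <;> rw [sub_ne_zero] <;> intro h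
      · exact hij (hs h).symm
      · exact hik (hs h).symm
      · exact hjk (hs h).symm
    refine (eventually_quadratic_ne (A := area (p i) (p j) (p k))
      (B := ((p j).1 - (p i).1) * (s k ^ 2 - s i ^ 2) + (s j - s i) * ((p k).2 - (p i).2) -
        ((p k).1 - (p i).1) * (s j ^ 2 - s i ^ 2) - (s k - s i) * ((p j).2 - (p i).2)) hC).mono ?_
    intro t ht h
    refine ht (Eq.trans ?_ h)
    simp only [area, q]
    ring
  have h2 : ∀ᶠ t in nhdsWithin (0 : ℝ) {0}ᶜ, ∀ a b c d,
      Disjoint (segment ℝ (p a) (p b)) (segment ℝ (p c) (p d)) →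
      Disjoint (segment ℝ (q t a) (q t b)) (segment ℝ (q t c) (q t d)) := by
    simp only [Filter.eventually_all]
    intro a b c d hdis
    let P : ℝ → ι → ι → ℝ → ℝ × ℝ := fun t i j x =>
      ((1 - x) * (q t i).1 + x * (q t j).1, (1 - x) * (q t i).2 + x * (q t j).2)
    have hP : ∀ t i j, segment ℝ (q t i) (q t j) = P t i j '' Set.Icc 0 1 := by
      intro t i j
      rw [segment_eq_image]
      refine Set.image_congr fun x _ => ?_
      ext <;> simp [P]
    have hPc : ∀ i j, Continuous fun z : ℝ × ℝ => P z.1 i j z.2 := by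
      intro i j
      simp only [P, q]
      fun_prop
    have hK : IsCompact (Set.Icc (0 : ℝ) 1 ×ˢ Set.Icc (0 : ℝ) 1) := isCompact_Icc.prod isCompact_Icc
    have := hK.eventually_forall_of_forall_eventually (x₀ := (0 : ℝ))
      (P := fun t z => P t a b z.1 ≠ P t c d z.2) ?_
    · refine (this.filter_mono nhdsWithin_le_nhds).mono fun t ht => ?_
      rw [hP, hP]
      refine Set.disjoint_left.2 ?_
      rintro _ ⟨x, hx, rfl⟩ ⟨y, hy, hxy⟩
      exact ht (x, y) ⟨hx, hy⟩ hxy.symm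
    · rintro ⟨x, y⟩ ⟨hx, hy⟩
      have c1 : Continuous fun z : ℝ × ℝ × ℝ => P z.1 a b z.2.1 :=
        (hPc a b).comp (by fun_prop : Continuous fun z : ℝ × ℝ × ℝ => (z.1, z.2.1))
      have c2 : Continuous fun z : ℝ × ℝ × ℝ => P z.1 c d z.2.2 :=
        (hPc c d).comp (by fun_prop : Continuous fun z : ℝ × ℝ × ℝ => (z.1, z.2.2))
      refine (isOpen_ne_fun c1 c2).mem_nhds ?_
      show P 0 a b x ≠ P 0 c d y
      intro h
      rw [← hq0, hP, hP] at hdis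
      exact Set.disjoint_left.1 hdis ⟨x, hx, rfl⟩ ⟨y, hy, h.symm⟩
  obtain ⟨t, ht⟩ := (h1.and h2).exists
  exact ⟨q t, ht⟩

end General
/-- `a` and `b` are joined by a polyline inside `Q`. -/
def PJoin (Q : Set (ℝ × ℝ)) (a b : ℝ × ℝ) : Prop :=
  ∃ n > 0, ∃ c : ℕ → ℝ × ℝ, c 0 = a ∧ c n = b ∧ ∀ k < n, segment ℝ (c k) (c (k + 1)) ⊆ Q

lemma PJoin.exists_eventually {Q : Set (ℝ × ℝ)} {a b : ℝ × ℝ} (h : PJoin Q a b) :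
    ∃ N, ∀ n ≥ N, ∃ c : ℕ → ℝ × ℝ, c 0 = a ∧ c n = b ∧ ∀ k < n, segment ℝ (c k) (c (k + 1)) ⊆ Q := by
  obtain ⟨N, hN, c, h0, h1, hc⟩ := h
  refine ⟨N, fun n hn => ⟨fun k => c (min k N), by simpa using h0, by simpa [hn] using h1, ?_⟩⟩
  intro k _
  dsimp only
  by_cases hk : k < N
  · rw [min_eq_left (by omega), min_eq_left (by omega)]
    exact hc k hk
  · rw [min_eq_right (by omega), min_eq_right (by omega), segment_same]
    refine Set.singleton_subset_iff.2 (hc (N - 1) (by omega) ?_)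
    rw [Nat.sub_add_cancel hN]
    exact right_mem_segment ℝ _ _

/-- The complete graph on five vertices has no plane drawing by polylines. -/
theorem no_plane_complete_five (t : Fin 5 → ℝ × ℝ) (Q : Fin 5 → Fin 5 → Set (ℝ × ℝ))
    (hQ : ∀ i j, i < j → PJoin (Q i j) (t i) (t j))
    (hd : ∀ i j k l, i < j → k < l → i ≠ k → i ≠ l → j ≠ k → j ≠ l → Disjoint (Q i j) (Q k l)) :
    False := by
  obtain ⟨m, hm⟩ : ∃ m, ∀ i j, i < j → ∃ c : ℕ → ℝ × ℝ, c 0 = t i ∧ c (m + 1) = t j ∧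
      ∀ k < m + 1, segment ℝ (c k) (c (k + 1)) ⊆ Q i j := by
    have : ∀ i j : Fin 5, ∃ N, ∀ n ≥ N, i < j → ∃ c : ℕ → ℝ × ℝ, c 0 = t i ∧ c n = t j ∧
        ∀ k < n, segment ℝ (c k) (c (k + 1)) ⊆ Q i j := by
      intro i j
      by_cases hij : i < j
      · obtain ⟨N, hN⟩ := (hQ i j hij).exists_eventually
        exact ⟨N, fun n hn _ => hN n hn⟩
      · exact ⟨0, fun n _ h => absurd h hij⟩
    choose N hN using this
    refine ⟨∑ i, ∑ j, N i j, fun i j => hN i j _ ?_⟩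
    have h1 : N i j ≤ ∑ j, N i j := single_le_sum (fun _ _ => Nat.zero_le _) (mem_univ j)
    have h2 : ∑ j, N i j ≤ ∑ i, ∑ j, N i j :=
      single_le_sum (f := fun i => ∑ j, N i j) (fun _ _ => Nat.zero_le _) (mem_univ i)
    omega
  have : ∀ i j : Fin 5, ∃ c : ℕ → ℝ × ℝ, i < j → c 0 = t i ∧ c (m + 1) = t j ∧
      ∀ k < m + 1, segment ℝ (c k) (c (k + 1)) ⊆ Q i j := by
    intro i j
    by_cases hij : i < j
    · obtain ⟨c, hc⟩ := hm i j hij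
      exact ⟨c, fun _ => hc⟩
    · exact ⟨fun _ => 0, fun h => absurd h hij⟩
  choose c hc using this
  let ι := Fin 5 ⊕ Fin 5 × Fin 5 × Fin (m + 1)
  let pos : ι → ℝ × ℝ := Sum.elim t fun x => c x.1 x.2.1 x.2.2
  obtain ⟨q, hq, hqd⟩ := exists_generalPosition pos
  let C : Fin 5 → Fin 5 → ℕ → ι := fun i j k =>
    if k = 0 then Sum.inl i else if h : k < m + 1 then Sum.inr (i, j, ⟨k, h⟩) else Sum.inl j
  have hC0 : ∀ i j, C i j 0 = Sum.inl i := fun i j => if_pos rfl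
  have hCm : ∀ i j, C i j (m + 1) = Sum.inl j := fun i j => by simp [C]
  have hCin : ∀ i j k, (h : k < m + 1) → k ≠ 0 → C i j k = Sum.inr (i, j, ⟨k, h⟩) :=
    fun i j k h h0 => (if_neg h0).trans (dif_pos h)
  have hcase : ∀ k ≤ m + 1, k = 0 ∨ k = m + 1 ∨ ∃ h : k < m + 1, k ≠ 0 := by
    intro k hk
    by_cases h0 : k = 0
    · exact Or.inl h0
    · by_cases h1 : k = m + 1
      · exact Or.inr (Or.inl h1)
      · exact Or.inr (Or.inr ⟨by omega, h0⟩)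
  have hpos : ∀ i j, i < j → ∀ k ≤ m + 1, pos (C i j k) = c i j k := by
    intro i j hij k hk
    obtain ⟨e1, e2, -⟩ := hc i j hij
    rcases hcase k hk with rfl | rfl | ⟨h, h0⟩
    · rw [hC0, e1]; rfl
    · rw [hCm, e2]; rfl
    · rw [hCin i j k h h0]; rfl
  have hinj : ∀ i j, i < j → Set.InjOn (C i j) (Set.Iic (m + 1)) := by
    intro i j hij k hk l hl h
    rcases hcase k hk with rfl | rfl | ⟨hk, hk0⟩ <;> rcases hcase l hl with rfl | rfl | ⟨hl, hl0⟩
    · rfl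
    · rw [hC0, hCm] at h
      exact absurd (Sum.inl_injective h) hij.ne
    · rw [hC0, hCin i j l hl hl0] at h
      cases h
    · rw [hC0, hCm] at h
      exact absurd (Sum.inl_injective h) hij.ne'
    · rfl
    · rw [hCm, hCin i j l hl hl0] at h
      cases h
    · rw [hC0, hCin i j k hk hk0] at h
      cases h
    · rw [hCm, hCin i j k hk hk0] at h
      cases h
    · rw [hCin i j l hl hl0, hCin i j k hk hk0] at h
      simpa using Sum.inr_injective h
  have hdis : ∀ i j k l, i ≠ k → i ≠ l → j ≠ k → j ≠ l →
      ∀ x ≤ m + 1, ∀ y ≤ m + 1, C i j x ≠ C k l y := by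
    intro i j k l hik hil hjk hjl x hx y hy h
    rcases hcase x hx with rfl | rfl | ⟨hx, hx0⟩ <;> rcases hcase y hy with rfl | rfl | ⟨hy, hy0⟩
    · rw [hC0, hC0] at h
      exact hik (Sum.inl_injective h)
    · rw [hC0, hCm] at h
      exact hil (Sum.inl_injective h)
    · rw [hC0, hCin k l y hy hy0] at h
      cases h
    · rw [hC0, hCm] at h
      exact hjk (Sum.inl_injective h)
    · rw [hCm, hCm] at h
      exact hjl (Sum.inl_injective h)
    · rw [hCm, hCin k l y hy hy0] at h
      cases h
    · rw [hC0, hCin i j x hx hx0] at h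
      cases h
    · rw [hCm, hCin i j x hx hx0] at h
      cases h
    · rw [hCin i j x hx hx0, hCin k l y hy hy0] at h
      exact hik (congrArg Prod.fst (Sum.inr_injective h))
  have hne : ∀ i j, i ≠ j → (Sum.inl i : ι) ≠ Sum.inl j := fun i j h h' => h (Sum.inl_injective h')
  have key : ∀ i j k l, i < j → k < l → i ≠ k → i ≠ l → j ≠ k → j ≠ l →
      crossing (q (Sum.inl i)) (q (Sum.inl j)) (q (Sum.inl k)) (q (Sum.inl l)) +
        fanParity q (C i j) m (Sum.inl k) + fanParity q (C i j) m (Sum.inl l) +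
        fanParity q (C k l) m (Sum.inl i) + fanParity q (C k l) m (Sum.inl j) = 0 := by
    intro i j k l hij hkl hik hil hjk hjl
    have hCC := hdis i j k l hik hil hjk hjl
    have := hq.sum_crossing_chains m (hinj i j hij) (hinj k l hkl) hCC
    rw [hC0, hC0, hCm, hCm] at this
    rw [← this]
    refine sum_eq_zero fun y hy => sum_eq_zero fun x hx => ?_
    rw [mem_range] at hx hy
    by_contra hcr
    have n1 := fun a b (ha : a ≤ m + 1) (hb : b ≤ m + 1) (hab : a ≠ b) h =>
      hab (hinj i j hij (Set.mem_Iic.2 ha) (Set.mem_Iic.2 hb) h)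
    have n2 := fun a b (ha : a ≤ m + 1) (hb : b ≤ m + 1) (hab : a ≠ b) h =>
      hab (hinj k l hkl (Set.mem_Iic.2 ha) (Set.mem_Iic.2 hb) h)
    have e1 := n1 x (x + 1) (by omega) (by omega) (by omega)
    have e2 := n2 y (y + 1) (by omega) (by omega) (by omega)
    have a1 := hCC x (by omega) y (by omega)
    have a2 := hCC x (by omega) (y + 1) (by omega)
    have a3 := hCC (x + 1) (by omega) y (by omega)
    have a4 := hCC (x + 1) (by omega) (y + 1) (by omega)
    refine segment_inter_of_crossing (hq _ _ _ e1 a1 a3) (hq _ _ _ e1 a2 a4)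
      (hq _ _ _ e2 a1.symm a2.symm) (hq _ _ _ e2 a3.symm a4.symm) hcr (hqd _ _ _ _ ?_)
    rw [hpos i j hij x (by omega), hpos i j hij (x + 1) (by omega), hpos k l hkl y (by omega),
      hpos k l hkl (y + 1) (by omega)]
    exact (hd i j k l hij hkl hik hil hjk hjl).mono ((hc i j hij).2.2 x hx) ((hc k l hkl).2.2 y hy)
  have h2 : (2 : ZMod 2) = 0 := rfl
  have hsum := hq.crossing_sum (a := Sum.inl 0) (b := Sum.inl 1) (c := Sum.inl 2) (d := Sum.inl 3)
    (e := Sum.inl 4) (hne _ _ (by decide)) (hne _ _ (by decide)) (hne _ _ (by decide))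
    (hne _ _ (by decide)) (hne _ _ (by decide)) (hne _ _ (by decide)) (hne _ _ (by decide))
    (hne _ _ (by decide)) (hne _ _ (by decide)) (hne _ _ (by decide))
  obtain ⟨W, hW⟩ : ∃ W : Fin 5 → Fin 5 → Fin 5 → ZMod 2, ∀ i j k,
      fanParity q (C i j) m (Sum.inl k) = W i j k := ⟨_, fun _ _ _ => rfl⟩
  simp only [hW] at key
  have : (1 : ZMod 2) = 0 := by
    linear_combination -hsum
      + key 0 1 2 3 (by decide) (by decide) (by decide) (by decide) (by decide) (by decide)
      + key 0 2 1 3 (by decide) (by decide) (by decide) (by decide) (by decide) (by decide)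
      + key 0 3 1 2 (by decide) (by decide) (by decide) (by decide) (by decide) (by decide)
      + key 0 1 2 4 (by decide) (by decide) (by decide) (by decide) (by decide) (by decide)
      + key 0 2 1 4 (by decide) (by decide) (by decide) (by decide) (by decide) (by decide)
      + key 0 4 1 2 (by decide) (by decide) (by decide) (by decide) (by decide) (by decide)
      + key 0 1 3 4 (by decide) (by decide) (by decide) (by decide) (by decide) (by decide)
      + key 0 3 1 4 (by decide) (by decide) (by decide) (by decide) (by decide) (by decide)
      + key 0 4 1 3 (by decide) (by decide) (by decide) (by decide) (by decide) (by decide)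
      + key 0 2 3 4 (by decide) (by decide) (by decide) (by decide) (by decide) (by decide)
      + key 0 3 2 4 (by decide) (by decide) (by decide) (by decide) (by decide) (by decide)
      + key 0 4 2 3 (by decide) (by decide) (by decide) (by decide) (by decide) (by decide)
      + key 1 2 3 4 (by decide) (by decide) (by decide) (by decide) (by decide) (by decide)
      + key 1 3 2 4 (by decide) (by decide) (by decide) (by decide) (by decide) (by decide)
      + key 1 4 2 3 (by decide) (by decide) (by decide) (by decide) (by decide) (by decide)
      - (W 0 1 2 + W 0 1 3 + W 0 1 4 + W 0 2 1 + W 0 2 3 + W 0 2 4 + W 0 3 1 + W 0 3 2 + W 0 3 4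
        + W 0 4 1 + W 0 4 2 + W 0 4 3 + W 1 2 0 + W 1 2 3 + W 1 2 4 + W 1 3 0 + W 1 3 2 + W 1 3 4
        + W 1 4 0 + W 1 4 2 + W 1 4 3 + W 2 3 0 + W 2 3 1 + W 2 3 4 + W 2 4 0 + W 2 4 1 + W 2 4 3
        + W 3 4 0 + W 3 4 1 + W 3 4 2) * h2
  exact absurd this (by decide)

lemma PJoin.mono {Q Q' : Set (ℝ × ℝ)} {a b : ℝ × ℝ} (h : PJoin Q a b) (hQ : Q ⊆ Q') :
    PJoin Q' a b := by
  obtain ⟨n, hn, c, h0, h1, hc⟩ := h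
  exact ⟨n, hn, c, h0, h1, fun k hk => (hc k hk).trans hQ⟩

lemma PJoin.of_segment {Q : Set (ℝ × ℝ)} {a b : ℝ × ℝ} (h : segment ℝ a b ⊆ Q) : PJoin Q a b := by
  refine ⟨1, one_pos, fun k => if k = 0 then a else b, if_pos rfl, if_neg one_ne_zero, ?_⟩
  intro k hk
  obtain rfl : k = 0 := by omega
  simpa using h

lemma PJoin.trans {Q : Set (ℝ × ℝ)} {a b c : ℝ × ℝ} (h : PJoin Q a b) (h' : PJoin Q b c) :
    PJoin Q a c := by
  obtain ⟨n, hn, p, hp0, hp1, hp⟩ := h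
  obtain ⟨m, hm, q, hq0, hq1, hq⟩ := h'
  refine ⟨n + m, by omega, fun k => if k < n then p k else q (k - n), ?_, ?_, ?_⟩
  · simpa [hn] using hp0
  · simpa using hq1
  · intro k hk
    dsimp only
    by_cases hkn : k + 1 < n
    · rw [if_pos (by omega), if_pos hkn]
      exact hp k (by omega)
    · by_cases hkn' : k < n
      · have e : k + 1 = n := by omega
        rw [if_pos hkn', if_neg hkn, e, Nat.sub_self, hq0, ← hp1]
        have := hp k hkn'
        rwa [e] at this
      · rw [if_neg hkn', if_neg hkn]
        have := hq (k - n) (by omega)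
        rwa [← Nat.sub_add_comm (by omega)] at this

lemma polylineOf_cons_cons (a b : ℝ × ℝ) (l : List (ℝ × ℝ)) :
    polylineOf (a :: b :: l) = segment ℝ a b ∪ polylineOf (b :: l) := by
  simp [polylineOf, Set.iUnion_or, Set.iUnion_union_distrib]

lemma pJoin_polylineOf (a b : ℝ × ℝ) (l : List (ℝ × ℝ)) :
    PJoin (polylineOf (a :: (l ++ [b]))) a b := by
  induction l generalizing a with
  | nil =>
    refine .of_segment ?_
    simp [polylineOf]
  | cons x l ih =>
    rw [List.cons_append, polylineOf_cons_cons]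
    exact (PJoin.of_segment Set.subset_union_left).trans ((ih x).mono Set.subset_union_right)

theorem IsPolylineDrawing.k5Free {n : ℕ} {G : SimpleGraph (Fin n)} {π : Fin n → ℝ × ℝ}
    {bends : Fin n → Fin n → List (ℝ × ℝ)} (h : IsPolylineDrawing G π bends) : K5Free G := by
  rintro ⟨B, hB, hBd, hBadj⟩
  choose t ht using fun i => (hB i).1
  let Q : Fin 5 → Fin 5 → Set (ℝ × ℝ) := fun i j =>
    {z | ∃ u v, G.Adj u v ∧ u ∈ B i ∪ B j ∧ v ∈ B i ∪ B j ∧ z ∈ edgeCurve π bends u v}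
  have hedge : ∀ i j u v, G.Adj u v → u ∈ B i ∪ B j → v ∈ B i ∪ B j → PJoin (Q i j) (π u) (π v) :=
    fun i j u v huv hu hv => (pJoin_polylineOf _ _ _).mono fun z hz => ⟨u, v, huv, hu, hv, hz⟩
  refine no_plane_complete_five (fun i => π (t i)) Q ?_ ?_
  · intro i j hij
    obtain ⟨a, ha, b, hb, hab⟩ := hBadj i j hij.ne
    have h1 : ∀ y, Reach G (B j) b y → PJoin (Q i j) (π a) (π y) := by
      intro y hy
      induction hy with
      | refl => exact hedge i j a b hab (Or.inl ha) (Or.inr hb)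
      | tail _ h ih => exact ih.trans (hedge i j _ _ h.1 (Or.inr h.2.1) (Or.inr h.2.2))
    have h2 : ∀ x, Reach G (B i) a x → PJoin (Q i j) (π x) (π (t j)) := by
      intro x hx
      induction hx with
      | refl => exact h1 _ ((hB j).2 b hb _ (ht j))
      | tail _ h ih =>
        exact (hedge i j _ _ h.1.symm (Or.inl h.2.2) (Or.inl h.2.1)).trans ih
    exact h2 _ ((hB i).2 a ha _ (ht i))
  · intro i j k l _ _ hik hil hjk hjl
    refine Set.disjoint_left.2 ?_
    rintro z ⟨u, v, huv, hu, hv, hz⟩ ⟨x, y, hxy, hx, hy, hz'⟩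
    have hne : ∀ a b, a ∈ B i ∪ B j → b ∈ B k ∪ B l → a ≠ b := by
      rintro a b ha hb rfl
      rcases ha with ha | ha <;> rcases hb with hb | hb
      · exact Set.disjoint_left.1 (hBd _ _ hik) ha hb
      · exact Set.disjoint_left.1 (hBd _ _ hil) ha hb
      · exact Set.disjoint_left.1 (hBd _ _ hjk) ha hb
      · exact Set.disjoint_left.1 (hBd _ _ hjl) ha hb
    have hs : s(u, v) ≠ s(x, y) := by
      intro h
      rcases Sym2.eq_iff.1 h with ⟨h, -⟩ | ⟨h, -⟩
      · exact hne _ _ hu hx h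
      · exact hne _ _ hu hy h
    have := h.inter u v x y huv hxy hs
    have hmem : z ∈ edgeCurve π bends u v ∩ edgeCurve π bends x y := ⟨hz, hz'⟩
    rw [this] at hmem
    obtain ⟨w, ⟨hw, hw'⟩, -⟩ := hmem
    simp only [Set.mem_insert_iff, Set.mem_singleton_iff] at hw hw'
    rcases hw with rfl | rfl <;> rcases hw' with rfl | rfl
    · exact hne _ _ hu hx rfl
    · exact hne _ _ hu hy rfl
    · exact hne _ _ hv hx rfl
    · exact hne _ _ hv hy rfl

/-- The height at abscissa `x` of the line through the end points of `e`. -/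
def height (e : (ℝ × ℝ) × (ℝ × ℝ)) (x : ℝ) : ℝ :=
  e.1.2 + (x - e.1.1) * ((e.2.2 - e.1.2) / (e.2.1 - e.1.1))

/-- The vertical line at abscissa `x` crosses the interior of `e`. -/
def Alive (e : (ℝ × ℝ) × (ℝ × ℝ)) (x : ℝ) : Prop := e.1.1 < x ∧ x < e.2.1

lemma height_left (e : (ℝ × ℝ) × (ℝ × ℝ)) : height e e.1.1 = e.1.2 := by simp [height]

lemma height_right {e : (ℝ × ℝ) × (ℝ × ℝ)} (h : e.1.1 < e.2.1) : height e e.2.1 = e.2.2 := by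
  unfold height
  have : e.2.1 - e.1.1 ≠ 0 := by linarith
  field_simp
  ring

lemma height_combo (e : (ℝ × ℝ) × (ℝ × ℝ)) {a b : ℝ} (hab : a + b = 1) (x y : ℝ) :
    height e (a * x + b * y) = a * height e x + b * height e y := by
  unfold height
  obtain rfl : b = 1 - a := by linarith
  ring

lemma continuous_height (e : (ℝ × ℝ) × (ℝ × ℝ)) : Continuous (height e) := by
  unfold height
  fun_prop

/-- A noncrossing set `E` of segments, given by their left and right end points, with end points
in `P`. -/
structure PSLG (P : Finset (ℝ × ℝ)) (E : Finset ((ℝ × ℝ) × (ℝ × ℝ))) : Prop where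
  lt : ∀ e ∈ E, e.1.1 < e.2.1
  left : ∀ e ∈ E, e.1 ∈ P
  right : ∀ e ∈ E, e.2 ∈ P
  inj : ∀ p ∈ P, ∀ q ∈ P, p.1 = q.1 → p = q
  nc : ∀ e ∈ E, ∀ f ∈ E, ∀ x, Alive e x → Alive f x → height e x = height f x → e = f
  np : ∀ e ∈ E, ∀ p ∈ P, Alive e p.1 → height e p.1 ≠ p.2

lemma PSLG.mono {P P' : Finset (ℝ × ℝ)} {E E' : Finset ((ℝ × ℝ) × (ℝ × ℝ))} (h : PSLG P E)
    (hP : P' ⊆ P) (hE : E' ⊆ E) (hl : ∀ e ∈ E', e.1 ∈ P') (hr : ∀ e ∈ E', e.2 ∈ P') : PSLG P' E' where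
  lt e he := h.lt e (hE he)
  left := hl
  right := hr
  inj p hp q hq := h.inj p (hP hp) q (hP hq)
  nc e he f hf := h.nc e (hE he) f (hE hf)
  np e he p hp := h.np e (hE he) p (hP hp)

section Trapezoids

variable {P : Finset (ℝ × ℝ)} {E : Finset ((ℝ × ℝ) × (ℝ × ℝ))}

/-- The vertical order of two segments does not change along the abscissa. -/
lemma PSLG.height_le (h : PSLG P E) {e f : (ℝ × ℝ) × (ℝ × ℝ)} (he : e ∈ E) (hf : f ∈ E) {x y : ℝ}
    (hey : Alive e y) (hfy : Alive f y) (hlt : height e y < height f y)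
    (hex : e.1.1 ≤ x ∧ x ≤ e.2.1) (hfx : f.1.1 ≤ x ∧ x ≤ f.2.1) : height e x ≤ height f x := by
  by_contra! hcon
  obtain ⟨d, hd⟩ : ∃ d, d = (height e x - height f x) + (height f y - height e y) := ⟨_, rfl⟩
  have hd0 : 0 < d := by linarith
  obtain ⟨a, ha⟩ : ∃ a, a = (height f y - height e y) / d := ⟨_, rfl⟩
  obtain ⟨b, hb⟩ : ∃ b, b = (height e x - height f x) / d := ⟨_, rfl⟩
  have ha0 : 0 < a := by rw [ha]; exact div_pos (by linarith) hd0
  have hb0 : 0 < b := by rw [hb]; exact div_pos (by linarith) hd0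
  have hab : a + b = 1 := by
    rw [ha, hb, ← add_div, div_eq_one_iff_eq hd0.ne', hd]; ring
  have hal : ∀ g : (ℝ × ℝ) × (ℝ × ℝ), Alive g y → g.1.1 ≤ x ∧ x ≤ g.2.1 →
      Alive g (a * x + b * y) := by
    rintro g ⟨h1, h2⟩ ⟨h3, h4⟩
    have e1 : g.1.1 = a * g.1.1 + b * g.1.1 := by rw [← add_mul, hab, one_mul]
    have e2 : g.2.1 = a * g.2.1 + b * g.2.1 := by rw [← add_mul, hab, one_mul]
    have := mul_lt_mul_of_pos_left h1 hb0
    have := mul_lt_mul_of_pos_left h2 hb0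
    have := mul_le_mul_of_nonneg_left h3 ha0.le
    have := mul_le_mul_of_nonneg_left h4 ha0.le
    constructor <;> linarith
  have heq : height e (a * x + b * y) = height f (a * x + b * y) := by
    rw [height_combo e hab, height_combo f hab, ha, hb]
    field_simp
    ring
  have := h.nc e he f hf _ (hal e hey hex) (hal f hfy hfx) heq
  subst this
  exact lt_irrefl _ hlt

lemma PSLG.height_lt (h : PSLG P E) {e f : (ℝ × ℝ) × (ℝ × ℝ)} (he : e ∈ E) (hf : f ∈ E) {x y : ℝ}
    (hey : Alive e y) (hfy : Alive f y) (hlt : height e y < height f y)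
    (hex : Alive e x) (hfx : Alive f x) : height e x < height f x := by
  refine lt_of_le_of_ne (h.height_le he hf hey hfy hlt ⟨hex.1.le, hex.2.le⟩ ⟨hfx.1.le, hfx.2.le⟩) ?_
  intro heq
  have := h.nc e he f hf x hex hfx heq
  subst this
  exact lt_irrefl _ hlt

/-- The point `z` lies between the segments `b` and `t`, possibly on `t`. -/
def InGap (t b : Option ((ℝ × ℝ) × (ℝ × ℝ))) (z : ℝ × ℝ) : Prop :=
  (∀ e ∈ t, Alive e z.1 ∧ z.2 ≤ height e z.1) ∧ ∀ e ∈ b, Alive e z.1 ∧ height e z.1 < z.2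

/-- The point `z` lies in the closed region between the segments `b` and `t`. -/
def InClosedGap (t b : Option ((ℝ × ℝ) × (ℝ × ℝ))) (z : ℝ × ℝ) : Prop :=
  (∀ e ∈ t, (e.1.1 ≤ z.1 ∧ z.1 ≤ e.2.1) ∧ z.2 ≤ height e z.1) ∧
    ∀ e ∈ b, (e.1.1 ≤ z.1 ∧ z.1 ≤ e.2.1) ∧ height e z.1 ≤ z.2

lemma InGap.closed {t b : Option ((ℝ × ℝ) × (ℝ × ℝ))} {z : ℝ × ℝ} (h : InGap t b z) :
    InClosedGap t b z :=
  ⟨fun e he => ⟨⟨(h.1 e he).1.1.le, (h.1 e he).1.2.le⟩, (h.1 e he).2⟩,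
    fun e he => ⟨⟨(h.2 e he).1.1.le, (h.2 e he).1.2.le⟩, (h.2 e he).2.le⟩⟩

lemma InGap.segment {t b : Option ((ℝ × ℝ) × (ℝ × ℝ))} {z w u : ℝ × ℝ} (hz : InGap t b z)
    (hw : InGap t b w) (hu : u ∈ segment ℝ z w) : InGap t b u := by
  obtain ⟨α, β, hα, hβ, hαβ, rfl⟩ := hu
  have conv : ∀ x y x' y' : ℝ, x < y → x' < y' → α * x + β * x' < α * y + β * y' := by
    intro x y x' y' h h'
    rcases hα.lt_or_eq with hα | hα
    · exact add_lt_add_of_lt_of_le (mul_lt_mul_of_pos_left h hα) (mul_le_mul_of_nonneg_left h'.le hβ)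
    · obtain rfl : β = 1 := by linarith
      rw [← hα]; simpa using h'
  have same : ∀ x, x = α * x + β * x := fun x => by rw [← add_mul, hαβ, one_mul]
  have alive : ∀ e, Alive e z.1 → Alive e w.1 → Alive e (α * z.1 + β * w.1) := by
    intro e h h'
    have h1 := conv _ _ _ _ h.1 h'.1
    have h2 := conv _ _ _ _ h.2 h'.2
    rw [← same] at h1 h2
    exact ⟨h1, h2⟩
  refine ⟨fun e he => ⟨alive e (hz.1 e he).1 (hw.1 e he).1, ?_⟩,
    fun e he => ⟨alive e (hz.2 e he).1 (hw.2 e he).1, ?_⟩⟩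
  · show α * z.2 + β * w.2 ≤ height e (α * z.1 + β * w.1)
    rw [height_combo e hαβ]
    exact add_le_add (mul_le_mul_of_nonneg_left (hz.1 e he).2 hα)
      (mul_le_mul_of_nonneg_left (hw.1 e he).2 hβ)
  · show height e (α * z.1 + β * w.1) < α * z.2 + β * w.2
    rw [height_combo e hαβ]
    exact conv _ _ _ _ (hz.2 e he).2 (hw.2 e he).2

/-- The label of a cell of the trapezoidal decomposition: the segments above and below, the next
point to the right, and whether the cell is the vertical segment through that point. -/
@[ext] structure Trapezoid where
  top : Option ((ℝ × ℝ) × (ℝ × ℝ))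
  bot : Option ((ℝ × ℝ) × (ℝ × ℝ))
  next : Option (ℝ × ℝ)
  wall : Prop

/-- The trapezoid `k` contains `z`. -/
structure IsCell (P : Finset (ℝ × ℝ)) (E : Finset ((ℝ × ℝ) × (ℝ × ℝ))) (z : ℝ × ℝ)
    (k : Trapezoid) : Prop where
  top_mem : ∀ e ∈ k.top, e ∈ E
  bot_mem : ∀ e ∈ k.bot, e ∈ E
  gap : InGap k.top k.bot z
  top_le : ∀ f ∈ E, Alive f z.1 → z.2 ≤ height f z.1 → ∃ e ∈ k.top, height e z.1 ≤ height f z.1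
  le_bot : ∀ f ∈ E, Alive f z.1 → height f z.1 < z.2 → ∃ e ∈ k.bot, height f z.1 ≤ height e z.1
  next_mem : ∀ p ∈ k.next, p ∈ P ∧ z.1 ≤ p.1 ∧ InClosedGap k.top k.bot p
  next_le : ∀ p ∈ P, z.1 ≤ p.1 → InClosedGap k.top k.bot p → ∃ p' ∈ k.next, p'.1 ≤ p.1
  wall_iff : k.wall ↔ ∃ p ∈ k.next, p.1 = z.1

lemma exists_isCell (P : Finset (ℝ × ℝ)) (E : Finset ((ℝ × ℝ) × (ℝ × ℝ))) (z : ℝ × ℝ) :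
    ∃ k, IsCell P E z k := by
  have aux : ∀ {α : Type} (s : Finset α) (f : α → ℝ), ∃ o : Option α, (∀ a ∈ o, a ∈ s) ∧
      ∀ b ∈ s, ∃ a ∈ o, f a ≤ f b := by
    intro α s f
    rcases s.eq_empty_or_nonempty with rfl | hs
    · exact ⟨none, by simp, by simp⟩
    · obtain ⟨a, ha, hmin⟩ := exists_min_image s f hs
      exact ⟨some a, by simpa using ha, fun b hb => ⟨a, rfl, hmin b hb⟩⟩
  obtain ⟨t, ht, ht'⟩ := aux (E.filter fun f => Alive f z.1 ∧ z.2 ≤ height f z.1)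
    (fun f => height f z.1)
  obtain ⟨b, hb, hb'⟩ := aux (E.filter fun f => Alive f z.1 ∧ height f z.1 < z.2)
    (fun f => - height f z.1)
  obtain ⟨q, hq, hq'⟩ := aux (P.filter fun p => z.1 ≤ p.1 ∧ InClosedGap t b p) Prod.fst
  simp only [mem_filter, neg_le_neg_iff] at ht ht' hb hb' hq hq'
  exact ⟨⟨t, b, q, ∃ p ∈ q, p.1 = z.1⟩, fun e he => (ht e he).1, fun e he => (hb e he).1,
    ⟨fun e he => (ht e he).2, fun e he => (hb e he).2⟩, fun f hf h1 h2 => ht' f ⟨hf, h1, h2⟩,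
    fun f hf h1 h2 => hb' f ⟨hf, h1, h2⟩, fun p hp => hq p hp, fun p hp h1 h2 => hq' p ⟨hp, h1, h2⟩,
    Iff.rfl⟩

lemma IsCell.unique (h : PSLG P E) {z : ℝ × ℝ} {k k' : Trapezoid} (hk : IsCell P E z k)
    (hk' : IsCell P E z k') : k = k' := by
  have ht : ∀ {k k'}, IsCell P E z k → IsCell P E z k' → ∀ e ∈ k.top, e ∈ k'.top := by
    intro k k' hk hk' e he
    obtain ⟨f, hf, hfe⟩ := hk'.top_le e (hk.top_mem e he) (hk.gap.1 e he).1 (hk.gap.1 e he).2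
    obtain ⟨g, hg, hgf⟩ := hk.top_le f (hk'.top_mem f hf) (hk'.gap.1 f hf).1 (hk'.gap.1 f hf).2
    obtain rfl := Option.mem_unique he hg
    rwa [h.nc e (hk.top_mem e he) f (hk'.top_mem f hf) z.1 (hk.gap.1 e he).1 (hk'.gap.1 f hf).1
      (le_antisymm hgf hfe)]
  have hb : ∀ {k k'}, IsCell P E z k → IsCell P E z k' → ∀ e ∈ k.bot, e ∈ k'.bot := by
    intro k k' hk hk' e he
    obtain ⟨f, hf, hfe⟩ := hk'.le_bot e (hk.bot_mem e he) (hk.gap.2 e he).1 (hk.gap.2 e he).2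
    obtain ⟨g, hg, hgf⟩ := hk.le_bot f (hk'.bot_mem f hf) (hk'.gap.2 f hf).1 (hk'.gap.2 f hf).2
    obtain rfl := Option.mem_unique he hg
    rwa [h.nc e (hk.bot_mem e he) f (hk'.bot_mem f hf) z.1 (hk.gap.2 e he).1 (hk'.gap.2 f hf).1
      (le_antisymm hfe hgf)]
  have htop : k.top = k'.top := Option.ext fun e => ⟨ht hk hk' e, ht hk' hk e⟩
  have hbot : k.bot = k'.bot := Option.ext fun e => ⟨hb hk hk' e, hb hk' hk e⟩
  have hn : ∀ {k k'}, IsCell P E z k → IsCell P E z k' → k.top = k'.top → k.bot = k'.bot →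
      ∀ p ∈ k.next, p ∈ k'.next := by
    intro k k' hk hk' htop hbot p hp
    obtain ⟨h1, h2, h3⟩ := hk.next_mem p hp
    obtain ⟨q, hq, hqp⟩ := hk'.next_le p h1 h2 (htop ▸ hbot ▸ h3)
    obtain ⟨h1', h2', h3'⟩ := hk'.next_mem q hq
    obtain ⟨r, hr, hrq⟩ := hk.next_le q h1' h2' (htop.symm ▸ hbot.symm ▸ h3')
    obtain rfl := Option.mem_unique hp hr
    rwa [h.inj p h1 q h1' (le_antisymm hrq hqp)]
  have hnext : k.next = k'.next :=
    Option.ext fun p => ⟨hn hk hk' htop hbot p, hn hk' hk htop.symm hbot.symm p⟩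
  refine Trapezoid.ext htop hbot hnext (propext ?_)
  rw [hk.wall_iff, hk'.wall_iff, hnext]

/-- The cell containing `z`. -/
def cell (P : Finset (ℝ × ℝ)) (E : Finset ((ℝ × ℝ) × (ℝ × ℝ))) (z : ℝ × ℝ) : Trapezoid :=
  (exists_isCell P E z).choose

lemma isCell_cell (P : Finset (ℝ × ℝ)) (E : Finset ((ℝ × ℝ) × (ℝ × ℝ))) (z : ℝ × ℝ) :
    IsCell P E z (cell P E z) := (exists_isCell P E z).choose_spec

lemma IsCell.eq_cell (h : PSLG P E) {z : ℝ × ℝ} {k : Trapezoid} (hk : IsCell P E z k) :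
    cell P E z = k := (isCell_cell P E z).unique h hk

/-- A point of the same gap is in the same cell if no point of `P` separates them. -/
lemma IsCell.transport (h : PSLG P E) {z w : ℝ × ℝ} {k : Trapezoid} (hk : IsCell P E z k)
    (hw : InGap k.top k.bot w)
    (hclear : w.1 = z.1 ∨ ∀ p ∈ P, InClosedGap k.top k.bot p → p.1 ∉ Set.uIcc z.1 w.1) :
    IsCell P E w k := by
  have hz0 : ∀ f ∈ E, Alive f z.1 → (∀ e ∈ k.top, height f z.1 < height e z.1) →
      (∀ e ∈ k.bot, height e z.1 < height f z.1) → False := by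
    intro f hf hfz h1 h2
    rcases le_or_gt z.2 (height f z.1) with hle | hlt
    · obtain ⟨e, he, h'⟩ := hk.top_le f hf hfz hle
      exact absurd (h1 e he) (not_lt.2 h')
    · obtain ⟨e, he, h'⟩ := hk.le_bot f hf hfz hlt
      exact absurd (h2 e he) (not_lt.2 h')
  have hw0 : ∀ f ∈ E, Alive f w.1 → (∀ e ∈ k.top, height f w.1 < height e w.1) →
      (∀ e ∈ k.bot, height e w.1 < height f w.1) → False := by
    rcases hclear with heq | hclear
    · rw [heq]; exact hz0
    intro f hf hfw h1 h2
    by_cases hfz : Alive f z.1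
    · exact hz0 f hf hfz
        (fun e he => h.height_lt hf (hk.top_mem e he) hfw (hw.1 e he).1 (h1 e he) hfz (hk.gap.1 e he).1)
        (fun e he => h.height_lt (hk.bot_mem e he) hf (hw.2 e he).1 hfw (h2 e he) (hk.gap.2 e he).1 hfz)
    · have hend : ∃ p ∈ P, p.1 ∈ Set.uIcc z.1 w.1 ∧ height f p.1 = p.2 ∧ f.1.1 ≤ p.1 ∧ p.1 ≤ f.2.1 := by
        unfold Alive at hfz hfw
        rw [not_and_or, not_lt, not_lt] at hfz
        have hlt := h.lt f hf
        rcases hfz with hfz | hfz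
        · exact ⟨f.1, h.left f hf, Set.mem_uIcc.2 (Or.inl ⟨hfz, hfw.1.le⟩), height_left f, le_rfl, hlt.le⟩
        · exact ⟨f.2, h.right f hf, Set.mem_uIcc.2 (Or.inr ⟨hfw.2.le, hfz⟩), height_right hlt, hlt.le,
            le_rfl⟩
      obtain ⟨p, hpP, hpu, hpf, hpf'⟩ := hend
      have hbet : ∀ e : (ℝ × ℝ) × (ℝ × ℝ), Alive e z.1 → Alive e w.1 → e.1.1 ≤ p.1 ∧ p.1 ≤ e.2.1 := by
        intro e hez hew
        rcases Set.mem_uIcc.1 hpu with hp | hp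
        · exact ⟨hez.1.le.trans hp.1, hp.2.trans hew.2.le⟩
        · exact ⟨hew.1.le.trans hp.1, hp.2.trans hez.2.le⟩
      refine hclear p hpP ⟨fun e he => ?_, fun e he => ?_⟩ hpu
      · have hb := hbet e (hk.gap.1 e he).1 (hw.1 e he).1
        refine ⟨hb, ?_⟩
        rw [← hpf]
        exact h.height_le hf (hk.top_mem e he) hfw (hw.1 e he).1 (h1 e he) hpf' hb
      · have hb := hbet e (hk.gap.2 e he).1 (hw.2 e he).1
        refine ⟨hb, ?_⟩
        rw [← hpf]
        exact h.height_le (hk.bot_mem e he) hf (hw.2 e he).1 hfw (h2 e he) hb hpf'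
  refine ⟨hk.top_mem, hk.bot_mem, hw, ?_, ?_, ?_, ?_, ?_⟩
  · intro f hf hfw hle
    by_contra! hcon
    exact hw0 f hf hfw hcon fun e he => (hw.2 e he).2.trans_le hle
  · intro f hf hfw hlt
    by_contra! hcon
    exact hw0 f hf hfw (fun e he => hlt.trans_le (hw.1 e he).2) hcon
  · intro p hp
    obtain ⟨h1, h2, h3⟩ := hk.next_mem p hp
    refine ⟨h1, ?_, h3⟩
    rcases hclear with heq | hclear
    · rwa [heq]
    · by_contra! hcon
      exact hclear p h1 h3 (Set.mem_uIcc.2 (Or.inl ⟨h2, hcon.le⟩))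
  · intro p hp hwp hgap
    refine hk.next_le p hp ?_ hgap
    rcases hclear with heq | hclear
    · rwa [← heq]
    · by_contra! hcon
      exact hclear p hp hgap (Set.mem_uIcc.2 (Or.inr ⟨hwp, hcon.le⟩))
  · rw [hk.wall_iff]
    rcases hclear with heq | hclear
    · rw [heq]
    · constructor
      · rintro ⟨p, hp, hpz⟩
        obtain ⟨h1, h2, h3⟩ := hk.next_mem p hp
        exact absurd (hpz ▸ Set.left_mem_uIcc) (hclear p h1 h3)
      · rintro ⟨p, hp, hpz⟩
        obtain ⟨h1, h2, h3⟩ := hk.next_mem p hp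
        exact absurd (hpz ▸ Set.right_mem_uIcc) (hclear p h1 h3)

/-- Moving right inside the gap, the cell does not change before the next point. -/
lemma IsCell.transport_right (h : PSLG P E) {z w : ℝ × ℝ} {k : Trapezoid} (hk : IsCell P E z k)
    (hw : InGap k.top k.bot w) (hzw : z.1 ≤ w.1) (hn : ∀ p ∈ k.next, w.1 < p.1) : IsCell P E w k := by
  refine hk.transport h hw (Or.inr fun p hp hgap hu => ?_)
  rw [Set.uIcc_of_le hzw] at hu
  obtain ⟨q, hq, hqp⟩ := hk.next_le p hp hu.1 hgap
  exact absurd (hn q hq) (not_lt.2 (hqp.trans hu.2))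

lemma IsCell.lt_next {z : ℝ × ℝ} {k : Trapezoid} (hk : IsCell P E z k) (hwall : ¬ k.wall) :
    ∀ p ∈ k.next, z.1 < p.1 := by
  intro p hp
  refine lt_of_le_of_ne (hk.next_mem p hp).2.1 fun heq => hwall ?_
  exact hk.wall_iff.2 ⟨p, hp, heq.symm⟩

/-- Cells are convex. -/
lemma IsCell.segment (h : PSLG P E) {z w u : ℝ × ℝ} {k : Trapezoid} (hz : IsCell P E z k)
    (hw : IsCell P E w k) (hu : u ∈ segment ℝ z w) : IsCell P E u k := by
  wlog hzw : z.1 ≤ w.1 generalizing z w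
  · exact this hw hz (by rwa [segment_symm]) (le_of_not_ge hzw)
  have hgap := hz.gap.segment hw.gap hu
  have hux : z.1 ≤ u.1 ∧ u.1 ≤ w.1 := by
    obtain ⟨α, β, hα, hβ, hαβ, rfl⟩ := hu
    obtain rfl : α = 1 - β := by linarith
    simp only [Prod.fst_add, Prod.smul_fst, smul_eq_mul]
    constructor <;> nlinarith
  by_cases hwall : k.wall
  · obtain ⟨p, hp, hpz⟩ := hz.wall_iff.1 hwall
    obtain ⟨q, hq, hqw⟩ := hw.wall_iff.1 hwall
    obtain rfl := Option.mem_unique hp hq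
    exact hz.transport h hgap (Or.inl (le_antisymm (by linarith) hux.1))
  · exact hz.transport_right h hgap hux.1 fun p hp => hux.2.trans_lt (hw.lt_next hwall p hp)

end Trapezoids

section CellCount

variable {P : Finset (ℝ × ℝ)} {E : Finset ((ℝ × ℝ) × (ℝ × ℝ))}

/-- The cell of a point of `P` is the wall through that point. -/
lemma PSLG.next_cell (h : PSLG P E) {p : ℝ × ℝ} (hp : p ∈ P) :
    p ∈ (cell P E p).next ∧ (cell P E p).wall := by
  have hc := isCell_cell P E p
  obtain ⟨q, hq, hqp⟩ := hc.next_le p hp le_rfl hc.gap.closed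
  obtain ⟨h1, h2, -⟩ := hc.next_mem q hq
  obtain rfl := h.inj p hp q h1 (le_antisymm h2 hqp)
  exact ⟨hq, hc.wall_iff.2 ⟨p, hq, rfl⟩⟩

lemma IsCell.wall_eq (h : PSLG P E) {z p : ℝ × ℝ} {k : Trapezoid} (hk : IsCell P E z k)
    (hw : k.wall) (hp : p ∈ k.next) : cell P E p = k := by
  obtain ⟨q, hq, hqz⟩ := hk.wall_iff.1 hw
  obtain rfl := Option.mem_unique hp hq
  obtain ⟨h1, -, h3⟩ := hk.next_mem p hp
  refine (hk.transport h ⟨fun e he => ?_, fun e he => ?_⟩ (Or.inl hqz)).eq_cell h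
  · exact ⟨hqz ▸ (hk.gap.1 e he).1, (h3.1 e he).2⟩
  · have ha : Alive e p.1 := hqz ▸ (hk.gap.2 e he).1
    exact ⟨ha, lt_of_le_of_ne (h3.2 e he).2 (h.np e (hk.bot_mem e he) p h1 ha)⟩

lemma IsCell.eq_of_common (h : PSLG P E) {z z' w : ℝ × ℝ} {k k' : Trapezoid}
    (hk : IsCell P E z k) (hk' : IsCell P E z' k') (hn : ∀ p ∈ k.next, w.1 < p.1)
    (hn' : ∀ p ∈ k'.next, w.1 < p.1) (hw : InGap k.top k.bot w) (hw' : InGap k'.top k'.bot w)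
    (hz : z.1 ≤ w.1) (hz' : z'.1 ≤ w.1) : k = k' :=
  (hk.transport_right h hw hz hn).unique h (hk'.transport_right h hw' hz' hn')

lemma IsCell.alive (h : PSLG P E) {z : ℝ × ℝ} {k : Trapezoid} (hk : IsCell P E z k) {p : ℝ × ℝ}
    (hp : p ∈ k.next) {x : ℝ} (hx : z.1 ≤ x) (hxp : x < p.1) :
    (∀ e ∈ k.top, Alive e x) ∧ (∀ e ∈ k.bot, Alive e x) ∧
      ∀ e ∈ k.top, ∀ f ∈ k.bot, height f x < height e x := by
  obtain ⟨h1, -, h3⟩ := hk.next_mem p hp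
  have ht : ∀ e ∈ k.top, Alive e x := fun e he =>
    ⟨(hk.gap.1 e he).1.1.trans_le hx, hxp.trans_le (h3.1 e he).1.2⟩
  have hb : ∀ e ∈ k.bot, Alive e x := fun e he =>
    ⟨(hk.gap.2 e he).1.1.trans_le hx, hxp.trans_le (h3.2 e he).1.2⟩
  refine ⟨ht, hb, fun e he f hf => ?_⟩
  exact h.height_lt (hk.bot_mem f hf) (hk.top_mem e he) (hk.gap.2 f hf).1 (hk.gap.1 e he).1
    ((hk.gap.2 f hf).2.trans_le (hk.gap.1 e he).2) (hb f hf) (ht e he)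

lemma IsCell.eq_of_top (h : PSLG P E) {z z' : ℝ × ℝ} {k k' : Trapezoid}
    (hk : IsCell P E z k) (hk' : IsCell P E z' k') (hw : ¬ k.wall) (hw' : ¬ k'.wall)
    {e : (ℝ × ℝ) × (ℝ × ℝ)} (he : e ∈ k.top) (he' : e ∈ k'.top) {p : ℝ × ℝ} (hp : p ∈ k.next)
    (hp' : p ∈ k'.next) : k = k' := by
  obtain ⟨x, hx⟩ : ∃ x, x = max z.1 z'.1 := ⟨_, rfl⟩
  have hxp : x < p.1 := by rw [hx]; exact max_lt (hk.lt_next hw p hp) (hk'.lt_next hw' p hp')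
  have hz : z.1 ≤ x := hx ▸ le_max_left _ _
  have hz' : z'.1 ≤ x := hx ▸ le_max_right _ _
  have key : ∀ {z k}, IsCell P E z k → e ∈ k.top → p ∈ k.next → z.1 ≤ x →
      InGap k.top k.bot (x, height e x) := by
    intro z k hk he hp hz
    obtain ⟨h1, h2, h3⟩ := hk.alive h hp hz hxp
    refine ⟨fun f hf => ⟨h1 f hf, ?_⟩, fun f hf => ⟨h2 f hf, h3 e he f hf⟩⟩
    rw [Option.mem_unique he hf]
  exact hk.eq_of_common h hk' (fun q hq => Option.mem_unique hp hq ▸ hxp)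
    (fun q hq => Option.mem_unique hp' hq ▸ hxp) (key hk he hp hz) (key hk' he' hp' hz') hz hz'

lemma IsCell.eq_of_bot (h : PSLG P E) {z z' : ℝ × ℝ} {k k' : Trapezoid}
    (hk : IsCell P E z k) (hk' : IsCell P E z' k') (hw : ¬ k.wall) (hw' : ¬ k'.wall)
    {e : (ℝ × ℝ) × (ℝ × ℝ)} (he : e ∈ k.bot) (he' : e ∈ k'.bot) {p : ℝ × ℝ} (hp : p ∈ k.next)
    (hp' : p ∈ k'.next) : k = k' := by
  obtain ⟨x, hx⟩ : ∃ x, x = max z.1 z'.1 := ⟨_, rfl⟩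
  have hxp : x < p.1 := by rw [hx]; exact max_lt (hk.lt_next hw p hp) (hk'.lt_next hw' p hp')
  have hz : z.1 ≤ x := hx ▸ le_max_left _ _
  have hz' : z'.1 ≤ x := hx ▸ le_max_right _ _
  have key : ∀ {z k}, IsCell P E z k → e ∈ k.bot → p ∈ k.next → z.1 ≤ x →
      ∃ m, height e x < m ∧ ∀ y, height e x < y → y ≤ m → InGap k.top k.bot (x, y) := by
    intro z k hk he hp hz
    obtain ⟨h1, h2, h3⟩ := hk.alive h hp hz hxp
    rcases ht : k.top with _ | f
    · refine ⟨height e x + 1, by linarith, fun y hy _ => ⟨by simp, fun f hf => ⟨h2 f hf, ?_⟩⟩⟩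
      rwa [← Option.mem_unique he hf]
    · refine ⟨height f x, h3 f ht e he, fun y hy hy' => ⟨fun g hg => ?_, fun g hg => ⟨h2 g hg, ?_⟩⟩⟩
      · obtain rfl := Option.mem_some_iff.1 hg
        exact ⟨h1 _ ht, hy'⟩
      · rwa [← Option.mem_unique he hg]
  obtain ⟨m, hm, hm'⟩ := key hk he hp hz
  obtain ⟨n, hn, hn'⟩ := key hk' he' hp' hz'
  exact hk.eq_of_common h hk' (w := (x, min m n)) (fun q hq => Option.mem_unique hp hq ▸ hxp)
    (fun q hq => Option.mem_unique hp' hq ▸ hxp) (hm' _ (lt_min hm hn) (min_le_left _ _))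
    (hn' _ (lt_min hm hn) (min_le_right _ _)) hz hz'

lemma IsCell.eq_of_gap (h : PSLG P E) {z z' : ℝ × ℝ} {k k' : Trapezoid}
    (hk : IsCell P E z k) (hk' : IsCell P E z' k') (hw : ¬ k.wall) (hw' : ¬ k'.wall)
    {p : ℝ × ℝ} (hp : p ∈ k.next) (hp' : p ∈ k'.next) (hg : InGap k.top k.bot p)
    (hg' : InGap k'.top k'.bot p) : k = k' := by
  have key : ∀ {z k}, IsCell P E z k → p ∈ k.next → ¬ k.wall → InGap k.top k.bot p →
      ∀ᶠ x in nhdsWithin p.1 (Set.Iio p.1), z.1 ≤ x ∧ InGap k.top k.bot (x, p.2) := by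
    intro z k hk hp hw hg
    have hal : ∀ e : (ℝ × ℝ) × (ℝ × ℝ), Alive e p.1 →
        ∀ᶠ x in nhdsWithin p.1 (Set.Iio p.1), Alive e x := fun e he =>
      nhdsWithin_le_nhds ((lt_mem_nhds he.1).and (gt_mem_nhds he.2))
    have ht : ∀ᶠ x in nhdsWithin p.1 (Set.Iio p.1), ∀ e ∈ k.top, Alive e x ∧ p.2 ≤ height e x := by
      rcases hk0 : k.top with _ | e
      · simp
      · have hge := hg.1 e hk0
        have hlt := lt_of_le_of_ne hge.2
          (h.np e (hk.top_mem e hk0) p (hk.next_mem p hp).1 hge.1).symm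
        have h2 : ∀ᶠ x in nhdsWithin p.1 (Set.Iio p.1), p.2 < height e x :=
          nhdsWithin_le_nhds ((continuous_height e).continuousAt.eventually (lt_mem_nhds hlt))
        filter_upwards [hal e hge.1, h2] with x h1 h2 f hf
        obtain rfl := Option.mem_some_iff.1 hf
        exact ⟨h1, h2.le⟩
    have hb : ∀ᶠ x in nhdsWithin p.1 (Set.Iio p.1), ∀ e ∈ k.bot, Alive e x ∧ height e x < p.2 := by
      rcases hk0 : k.bot with _ | e
      · simp
      · have hge := hg.2 e hk0
        have h2 : ∀ᶠ x in nhdsWithin p.1 (Set.Iio p.1), height e x < p.2 :=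
          nhdsWithin_le_nhds ((continuous_height e).continuousAt.eventually (gt_mem_nhds hge.2))
        filter_upwards [hal e hge.1, h2] with x h1 h2 f hf
        obtain rfl := Option.mem_some_iff.1 hf
        exact ⟨h1, h2⟩
    have hz : ∀ᶠ x in nhdsWithin p.1 (Set.Iio p.1), z.1 < x :=
      nhdsWithin_le_nhds (lt_mem_nhds (hk.lt_next hw p hp))
    filter_upwards [ht, hb, hz] with x h1 h2 h3
    exact ⟨h3.le, h1, h2⟩
  obtain ⟨x, ⟨hx, hx'⟩, hxp⟩ :=
    (((key hk hp hw hg).and (key hk' hp' hw' hg')).and self_mem_nhdsWithin).exists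
  exact hk.eq_of_common h hk' (w := (x, p.2)) (fun q hq => Option.mem_unique hp hq ▸ hxp)
    (fun q hq => Option.mem_unique hp' hq ▸ hxp) hx.2 hx'.2 hx.1 hx'.1

lemma IsCell.gap_next (h : PSLG P E) {z : ℝ × ℝ} {k : Trapezoid} (hk : IsCell P E z k)
    {p : ℝ × ℝ} (hp : p ∈ k.next) (ht : ∀ e ∈ k.top, e.2 ≠ p) (hb : ∀ e ∈ k.bot, e.2 ≠ p) :
    InGap k.top k.bot p := by
  obtain ⟨h1, h2, h3⟩ := hk.next_mem p hp
  have key : ∀ e ∈ E, e.2 ≠ p → Alive e z.1 → p.1 ≤ e.2.1 → Alive e p.1 := by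
    intro e he hne ha hle
    refine ⟨ha.1.trans_le h2, lt_of_le_of_ne hle fun heq => hne ?_⟩
    exact (h.inj p h1 e.2 (h.right e he) heq).symm
  refine ⟨fun e he => ⟨?_, (h3.1 e he).2⟩, fun e he => ?_⟩
  · exact key e (hk.top_mem e he) (ht e he) (hk.gap.1 e he).1 (h3.1 e he).1.2
  · have := key e (hk.bot_mem e he) (hb e he) (hk.gap.2 e he).1 (h3.2 e he).1.2
    exact ⟨this, lt_of_le_of_ne (h3.2 e he).2 (h.np e (hk.bot_mem e he) p h1 this)⟩

lemma IsCell.eq_of_next_eq_none (h : PSLG P E) {z : ℝ × ℝ} {k : Trapezoid} (hk : IsCell P E z k)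
    (hn : k.next = none) : k = ⟨none, none, none, False⟩ := by
  have hno : ∀ p ∈ P, z.1 ≤ p.1 → ¬ InClosedGap k.top k.bot p := by
    intro p hp hzp hg
    obtain ⟨q, hq, -⟩ := hk.next_le p hp hzp hg
    simp [hn] at hq
  have ht : ∀ e ∈ k.top, ∀ f ∈ k.bot, False := by
    intro e he f hf
    have heE := hk.top_mem e he
    have hfE := hk.bot_mem f hf
    have hea := (hk.gap.1 e he).1
    have hfa := (hk.gap.2 f hf).1
    have hlt := (hk.gap.2 f hf).2.trans_le (hk.gap.1 e he).2
    rcases le_total e.2.1 f.2.1 with hle | hle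
    · have hb : f.1.1 ≤ e.2.1 := (hfa.1.trans hea.2).le
      refine hno e.2 (h.right e heE) hea.2.le ⟨fun g hg => ?_, fun g hg => ?_⟩
      · obtain rfl := Option.mem_unique he hg
        exact ⟨⟨(h.lt e heE).le, le_rfl⟩, (height_right (h.lt e heE)).ge⟩
      · obtain rfl := Option.mem_unique hf hg
        refine ⟨⟨hb, hle⟩, ?_⟩
        rw [← height_right (h.lt e heE)]
        exact h.height_le hfE heE hfa hea hlt ⟨hb, hle⟩ ⟨(h.lt e heE).le, le_rfl⟩
    · have hb : e.1.1 ≤ f.2.1 := (hea.1.trans hfa.2).le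
      refine hno f.2 (h.right f hfE) hfa.2.le ⟨fun g hg => ?_, fun g hg => ?_⟩
      · obtain rfl := Option.mem_unique he hg
        refine ⟨⟨hb, hle⟩, ?_⟩
        rw [← height_right (h.lt f hfE)]
        exact h.height_le hfE heE hfa hea hlt ⟨(h.lt f hfE).le, le_rfl⟩ ⟨hb, hle⟩
      · obtain rfl := Option.mem_unique hf hg
        exact ⟨⟨(h.lt f hfE).le, le_rfl⟩, (height_right (h.lt f hfE)).le⟩
  have htop : k.top = none := by
    refine Option.eq_none_iff_forall_not_mem.2 fun e he => ?_
    have heE := hk.top_mem e he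
    refine hno e.2 (h.right e heE) (hk.gap.1 e he).1.2.le
      ⟨fun g hg => ?_, fun g hg => (ht e he g hg).elim⟩
    obtain rfl := Option.mem_unique he hg
    exact ⟨⟨(h.lt e heE).le, le_rfl⟩, (height_right (h.lt e heE)).ge⟩
  have hbot : k.bot = none := by
    refine Option.eq_none_iff_forall_not_mem.2 fun e he => ?_
    have heE := hk.bot_mem e he
    refine hno e.2 (h.right e heE) (hk.gap.2 e he).1.2.le
      ⟨fun g hg => (ht g hg e he).elim, fun g hg => ?_⟩
    obtain rfl := Option.mem_unique he hg
    exact ⟨⟨(h.lt e heE).le, le_rfl⟩, (height_right (h.lt e heE)).le⟩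
  refine Trapezoid.ext htop hbot hn (propext ?_)
  rw [hk.wall_iff, hn]
  simp

end CellCount

lemma Set.finite_and_ncard_le_of_rel {α β : Type} {K : Set α} {T : Finset β} (R : α → β → Prop)
    (hex : ∀ k ∈ K, ∃ t ∈ T, R k t)
    (huniq : ∀ k ∈ K, ∀ k' ∈ K, ∀ t, R k t → R k' t → k = k') : K.Finite ∧ K.ncard ≤ #T := by
  rcases K.eq_empty_or_nonempty with rfl | ⟨k, hk⟩
  · simp
  have : Nonempty β := ⟨(hex k hk).choose⟩
  choose! f hf using hex
  have hinj : Set.InjOn f K := fun k hk k' hk' he =>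
    huniq k hk k' hk' (f k) (hf k hk).2 (he ▸ (hf k' hk').2)
  have hmaps : Set.MapsTo f K T := fun k hk => (hf k hk).1
  refine ⟨Set.Finite.of_injOn hmaps hinj T.finite_toSet, ?_⟩
  rw [← Set.ncard_coe_finset T]
  exact Set.ncard_le_ncard_of_injOn f (fun k hk => hmaps hk) hinj T.finite_toSet

/-- The trapezoidal decomposition has linearly many cells. -/
theorem PSLG.ncard_range_cell_le {P : Finset (ℝ × ℝ)} {E : Finset ((ℝ × ℝ) × (ℝ × ℝ))}
    (h : PSLG P E) : (Set.range (cell P E)).Finite ∧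
      (Set.range (cell P E)).ncard ≤ 2 * #P + 2 * #E + 1 := by
  have key := Set.finite_and_ncard_le_of_rel (K := Set.range (cell P E))
    (T := (P.disjSum P).disjSum ((E.disjSum E).disjSum (univ : Finset Unit)))
    (fun k t => match t with
      | .inl (.inl p) => k.wall ∧ p ∈ k.next
      | .inl (.inr p) => ¬ k.wall ∧ p ∈ k.next ∧ InGap k.top k.bot p
      | .inr (.inl (.inl e)) => ¬ k.wall ∧ e ∈ k.top ∧ e.2 ∈ k.next
      | .inr (.inl (.inr e)) => ¬ k.wall ∧ e ∈ k.bot ∧ e.2 ∈ k.next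
      | .inr (.inr ()) => k.next = none) ?_ ?_
  · refine ⟨key.1, key.2.trans (le_of_eq ?_)⟩
    simp only [card_disjSum, card_univ, Fintype.card_unit]
    ring
  · rintro k ⟨z, rfl⟩
    have hk := isCell_cell P E z
    generalize cell P E z = k at hk
    rcases hn : k.next with _ | p
    · exact ⟨.inr (.inr ()), by simp, rfl⟩
    by_cases hw : k.wall
    · exact ⟨.inl (.inl p), by simpa using (hk.next_mem p hn).1, hw, rfl⟩
    by_cases ht : ∀ e ∈ k.top, e.2 ≠ p
    · by_cases hb : ∀ e ∈ k.bot, e.2 ≠ p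
      · exact ⟨.inl (.inr p), by simpa using (hk.next_mem p hn).1, hw, rfl, hk.gap_next h hn ht hb⟩
      · push Not at hb
        obtain ⟨e, he, rfl⟩ := hb
        exact ⟨.inr (.inl (.inr e)), by simpa using hk.bot_mem e he, hw, he, rfl⟩
    · push Not at ht
      obtain ⟨e, he, rfl⟩ := ht
      exact ⟨.inr (.inl (.inl e)), by simpa using hk.top_mem e he, hw, he, rfl⟩
  · rintro k ⟨z, rfl⟩ k' ⟨z', rfl⟩ t ht ht'
    have hk := isCell_cell P E z
    have hk' := isCell_cell P E z'
    generalize cell P E z = k at hk ht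
    generalize cell P E z' = k' at hk' ht'
    rcases t with (p | p) | ((e | e) | ⟨⟩)
    · rw [← hk.wall_eq h ht.1 ht.2, ← hk'.wall_eq h ht'.1 ht'.2]
    · exact hk.eq_of_gap h hk' ht.1 ht'.1 ht.2.1 ht'.2.1 ht.2.2 ht'.2.2
    · exact hk.eq_of_top h hk' ht.1 ht'.1 ht.2.1 ht'.2.1 ht.2.2 ht'.2.2
    · exact hk.eq_of_bot h hk' ht.1 ht'.1 ht.2.1 ht'.2.1 ht.2.2 ht'.2.2
    · rw [hk.eq_of_next_eq_none h ht, hk'.eq_of_next_eq_none h ht']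

section CellGraph

variable {P : Finset (ℝ × ℝ)} {E : Finset ((ℝ × ℝ) × (ℝ × ℝ))}

/-- The adjacency graph of the cells of the trapezoidal decomposition. -/
def cellGraph (P : Finset (ℝ × ℝ)) (E : Finset ((ℝ × ℝ) × (ℝ × ℝ))) :
    SimpleGraph (Set.range (cell P E)) where
  Adj a b := a ≠ b ∧ ∃ z w, cell P E z = a ∧ cell P E w = b ∧
    ∀ u ∈ segment ℝ z w, cell P E u = a ∨ cell P E u = b
  symm := ⟨fun a b ⟨hne, z, w, hz, hw, h⟩ =>
    ⟨hne.symm, w, z, hw, hz, fun u hu => (h u (by rwa [segment_symm])).symm⟩⟩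
  loopless := ⟨fun _ h => h.1 rfl⟩

lemma cell_segment (h : PSLG P E) {x y u : ℝ × ℝ} (hxy : cell P E x = cell P E y)
    (hu : u ∈ segment ℝ x y) : cell P E u = cell P E x :=
  (((isCell_cell P E x).segment h (hxy ▸ isCell_cell P E y) hu)).eq_cell h

theorem k5Free_cellGraph (h : PSLG P E) : K5Free (cellGraph P E) := by
  rintro ⟨B, hB, hBd, hBadj⟩
  have hne : ∀ i, ∃ z, ∃ k ∈ B i, cell P E z = k := by
    intro i
    obtain ⟨⟨_, z, rfl⟩, hk⟩ := (hB i).1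
    exact ⟨z, _, hk, rfl⟩
  choose t k hk htk using hne
  obtain ⟨Q, hQ⟩ : ∃ Q : Fin 5 → Fin 5 → Set (ℝ × ℝ),
      Q = fun i j => {z | ∃ k ∈ B i ∪ B j, cell P E z = k} := ⟨_, rfl⟩
  have hsame : ∀ i j (k : Set.range (cell P E)) z w, k ∈ B i ∪ B j → cell P E z = k →
      cell P E w = k → PJoin (Q i j) z w := by
    intro i j k z w hk hz hw
    refine PJoin.of_segment fun u hu => ?_
    rw [hQ]
    exact ⟨k, hk, (cell_segment h (hz.trans hw.symm) hu).trans hz⟩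
  have hedge : ∀ i j a b z w, (cellGraph P E).Adj a b → a ∈ B i ∪ B j → b ∈ B i ∪ B j →
      cell P E z = a → cell P E w = b → PJoin (Q i j) z w := by
    rintro i j a b z w ⟨-, z', w', hz', hw', hs⟩ ha hb hz hw
    refine ((hsame i j a z z' ha hz hz').trans (PJoin.of_segment fun u hu => ?_)).trans
      (hsame i j b w' w hb hw' hw)
    rw [hQ]
    rcases hs u hu with h | h
    · exact ⟨a, ha, h⟩
    · exact ⟨b, hb, h⟩
  refine no_plane_complete_five t Q ?_ ?_
  · intro i j hij
    obtain ⟨a, ha, b, hb, hab⟩ := hBadj i j hij.ne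
    have h1 : ∀ y, Reach (cellGraph P E) (B j) b y → ∀ z w, cell P E z = a → cell P E w = y →
        PJoin (Q i j) z w := by
      intro y hy
      induction hy with
      | refl => exact fun z w => hedge i j a b z w hab (Or.inl ha) (Or.inr hb)
      | @tail c d _ h ih =>
        obtain ⟨v, hv⟩ := c.2
        exact fun z w hz hw => (ih z v hz hv).trans
          (hedge i j _ _ v w h.1 (Or.inr h.2.1) (Or.inr h.2.2) hv hw)
    have h2 : ∀ x, Reach (cellGraph P E) (B i) a x → ∀ z, cell P E z = x →
        PJoin (Q i j) z (t j) := by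
      intro x hx
      induction hx with
      | refl => exact fun z hz => h1 _ ((hB j).2 b hb _ (hk j)) z (t j) hz (htk j)
      | @tail c d _ h ih =>
        obtain ⟨v, hv⟩ := c.2
        exact fun z hz => (hedge i j _ _ z v h.1.symm (Or.inl h.2.2) (Or.inl h.2.1) hz hv).trans
          (ih v hv)
    exact h2 _ ((hB i).2 a ha _ (hk i)) _ (htk i)
  · intro i j k l _ _ hik hil hjk hjl
    rw [hQ]
    refine Set.disjoint_left.2 ?_
    rintro z ⟨a, ha, hza⟩ ⟨b, hb, hzb⟩
    obtain rfl : a = b := Subtype.ext (hza.symm.trans hzb)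
    rcases ha with ha | ha <;> rcases hb with hb | hb
    · exact Set.disjoint_left.1 (hBd _ _ hik) ha hb
    · exact Set.disjoint_left.1 (hBd _ _ hil) ha hb
    · exact Set.disjoint_left.1 (hBd _ _ hjk) ha hb
    · exact Set.disjoint_left.1 (hBd _ _ hjl) ha hb

/-- A coloring of cells constant along adjacencies outside `S` is constant along segments whose
cells avoid `S`. -/
lemma eq_of_segment_avoids (h : PSLG P E) {α : Type} (κ : Trapezoid → α) (S : Set Trapezoid)
    (hκ : ∀ a b, (cellGraph P E).Adj a b → (a : Trapezoid) ∉ S → (b : Trapezoid) ∉ S →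
      κ a = κ b) (x y : ℝ × ℝ) (hS : ∀ u ∈ segment ℝ x y, cell P E u ∉ S) :
    κ (cell P E x) = κ (cell P E y) := by
  have hfin : ∀ x y, (cell P E '' segment ℝ x y).Finite := fun x y =>
    h.ncard_range_cell_le.1.subset (Set.image_subset_range _ _)
  have hlt : ∀ x y u, u ∈ segment ℝ x y → cell P E u ≠ cell P E y →
      (cell P E '' segment ℝ x u).ncard < (cell P E '' segment ℝ x y).ncard := by
    intro x y u hu hne
    have hsub : segment ℝ x u ⊆ segment ℝ x y :=
      (convex_segment x y).segment_subset (left_mem_segment ℝ x y) hu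
    refine Set.ncard_lt_ncard ⟨Set.image_mono hsub, fun hsup => ?_⟩ (hfin x y)
    obtain ⟨v, hv, hvy⟩ := hsup ⟨y, right_mem_segment ℝ x y, rfl⟩
    rw [mem_segment_iff_wbtw] at hv hu
    have := hu.trans_left_right hv
    rw [← mem_segment_iff_wbtw] at this
    exact hne ((cell_segment h hvy this).trans hvy)
  obtain ⟨n, hn⟩ : ∃ n, (cell P E '' segment ℝ x y).ncard = n := ⟨_, rfl⟩
  induction n using Nat.strong_induction_on generalizing x y with
  | _ n ih =>
  by_cases hxy : cell P E x = cell P E y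
  · rw [hxy]
  by_cases hu : ∃ u ∈ segment ℝ x y, cell P E u ≠ cell P E x ∧ cell P E u ≠ cell P E y
  · obtain ⟨u, hu, hux, huy⟩ := hu
    have h1 : segment ℝ x u ⊆ segment ℝ x y :=
      (convex_segment x y).segment_subset (left_mem_segment ℝ x y) hu
    have h2 : segment ℝ u y ⊆ segment ℝ x y :=
      (convex_segment x y).segment_subset hu (right_mem_segment ℝ x y)
    have hn1 := hlt x y u hu huy
    have hn2 := hlt y x u (by rwa [segment_symm]) hux
    rw [segment_symm ℝ y u, segment_symm ℝ y x] at hn2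
    exact (ih _ (hn ▸ hn1) x u (fun v hv => hS v (h1 hv)) rfl).trans
      (ih _ (hn ▸ hn2) u y (fun v hv => hS v (h2 hv)) rfl)
  · push Not at hu
    refine hκ ⟨_, x, rfl⟩ ⟨_, y, rfl⟩ ⟨fun he => hxy (congrArg Subtype.val he), x, y, rfl, rfl,
      fun u hus => ?_⟩ (hS x (left_mem_segment ℝ x y)) (hS y (right_mem_segment ℝ x y))
    exact or_iff_not_imp_left.2 (hu u hus)

lemma PSLG.injOn_cell (h : PSLG P E) : Set.InjOn (cell P E) P := by
  intro p hp q hq heq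
  have h1 := (h.next_cell hp).1
  rw [heq] at h1
  exact Option.mem_unique h1 (h.next_cell hq).1

/-- A segment of `E` meets only cells labelled by the segment itself or its end points. -/
lemma PSLG.cell_of_mem_edge (h : PSLG P E) {e : (ℝ × ℝ) × (ℝ × ℝ)} (he : e ∈ E) {z : ℝ × ℝ}
    (hz : z ∈ segment ℝ e.1 e.2) : e ∈ (cell P E z).top ∨ e.1 ∈ (cell P E z).next ∨
      e.2 ∈ (cell P E z).next := by
  have hlt := h.lt e he
  obtain ⟨a, b, ha, hb, hab, rfl⟩ := hz
  rcases ha.lt_or_eq with ha | rfl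
  · rcases hb.lt_or_eq with hb | rfl
    · left
      have hc := isCell_cell P E (a • e.1 + b • e.2)
      have hx : (a • e.1 + b • e.2).1 = a * e.1.1 + b * e.2.1 := rfl
      have hy : (a • e.1 + b • e.2).2 = a * e.1.2 + b * e.2.2 := rfl
      have hh : height e (a • e.1 + b • e.2).1 = (a • e.1 + b • e.2).2 := by
        rw [hx, hy, height_combo e hab, height_left, height_right hlt]
      have hal : Alive e (a • e.1 + b • e.2).1 := by
        rw [hx]
        obtain rfl : a = 1 - b := by linarith
        constructor <;> nlinarith
      obtain ⟨f, hf, hfe⟩ := hc.top_le e he hal hh.ge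
      have hg := hc.gap.1 f hf
      rwa [← h.nc e he f (hc.top_mem f hf) _ hal hg.1 (le_antisymm (hh.le.trans hg.2) hfe)] at hf
    · obtain rfl : a = 1 := by linarith
      simpa using Or.inr (Or.inl (h.next_cell (h.left e he)).1)
  · obtain rfl : b = 1 := by linarith
    simpa using Or.inr (Or.inr (h.next_cell (h.right e he)).1)

lemma IsCell.restrict {P' : Finset (ℝ × ℝ)} {E' : Finset ((ℝ × ℝ) × (ℝ × ℝ))} {z : ℝ × ℝ}
    {k : Trapezoid} (hk : IsCell P E z k) (hP : P' ⊆ P) (hE : E' ⊆ E)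
    (ht : ∀ e ∈ k.top, e ∈ E') (hb : ∀ e ∈ k.bot, e ∈ E') (hn : ∀ p ∈ k.next, p ∈ P') :
    IsCell P' E' z k where
  top_mem := ht
  bot_mem := hb
  gap := hk.gap
  top_le f hf := hk.top_le f (hE hf)
  le_bot f hf := hk.le_bot f (hE hf)
  next_mem p hp := ⟨hn p hp, (hk.next_mem p hp).2⟩
  next_le p hp := hk.next_le p (hP hp)
  wall_iff := hk.wall_iff

/-- If `P'` contains the point that bounds the cell `k` on the left, then every point whose cell is
`k` with respect to `P'` and `E'` is in the cell `k` with respect to `P` and `E`. -/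
lemma IsCell.lift (h : PSLG P E) {P' : Finset (ℝ × ℝ)} {E' : Finset ((ℝ × ℝ) × (ℝ × ℝ))}
    {z w : ℝ × ℝ} {k : Trapezoid} (hk : IsCell P E z k) (hk' : IsCell P' E' w k)
    (hL : ∀ p ∈ P, InClosedGap k.top k.bot p → p.1 < z.1 →
      ∃ q ∈ P', InClosedGap k.top k.bot q ∧ q.1 < z.1 ∧ p.1 ≤ q.1) : IsCell P E w k := by
  by_cases hw : k.wall
  · obtain ⟨q, hq, hqz⟩ := hk.wall_iff.1 hw
    obtain ⟨q', hq', hqw⟩ := hk'.wall_iff.1 hw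
    obtain rfl := Option.mem_unique hq hq'
    exact hk.transport h hk'.gap (Or.inl (hqw.symm.trans hqz))
  rcases le_or_gt z.1 w.1 with hzw | hzw
  · exact hk.transport_right h hk'.gap hzw (hk'.lt_next hw)
  refine hk.transport h hk'.gap (Or.inr fun p hp hg hu => ?_)
  rw [Set.uIcc_of_ge hzw.le] at hu
  rcases hu.2.lt_or_eq with hlt | heq
  · obtain ⟨q, hq, hqg, hqz, hpq⟩ := hL p hp hg hlt
    obtain ⟨q', hq', hle⟩ := hk'.next_le q hq (hu.1.trans hpq) hqg
    exact absurd (hk.next_mem q' hq').2.1 (not_le.2 (hle.trans_lt hqz))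
  · obtain ⟨q', hq', hle⟩ := hk.next_le p hp heq.ge hg
    exact absurd (hk.lt_next hw q' hq') (not_lt.2 (hle.trans heq.le))

/-- A balanced coloring of the plane that is constant on the cells of a small subset of the
decomposition, and on all but few segments. -/
theorem PSLG.exists_descriptor (h : PSLG P E)
    (hdeg : ∀ p, #(E.filter fun e => e.1 = p ∨ e.2 = p) ≤ 2) {X : Finset (ℝ × ℝ)} (hX : X ⊆ P)
    (J : ℕ) {r : ℕ} (hr0 : 0 < r) (hr : 5 * (2 * #P + 2 * #E + 1) ≤ r * r) {m : ℕ}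
    (hm : m = 2 ^ J * (5 * r)) :
    ∃ P' ⊆ P, ∃ E' ⊆ E, ∃ κ : ℝ × ℝ → ℕ, ∃ F ⊆ E, PSLG P' E' ∧ #P' ≤ 6 * m ∧ #E' ≤ 2 * m ∧
      (∀ z, κ z < 2 ^ J) ∧ (∀ x y, cell P' E' x = cell P' E' y → κ x = κ y) ∧ #F ≤ 3 * m ∧
      (∀ e ∈ E, e ∉ F → κ e.1 = κ e.2) ∧
      ∀ q, 3 ^ J * #(X.filter fun x => κ x = q) ≤ 2 ^ J * #X + 3 ^ (J + 1) := by
  obtain ⟨hfin, hcard⟩ := h.ncard_range_cell_le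
  have : Fintype (Set.range (cell P E)) := hfin.fintype
  obtain ⟨c, hc⟩ : ∃ c : ℝ × ℝ → Set.range (cell P E), c = fun z => ⟨cell P E z, z, rfl⟩ :=
    ⟨_, rfl⟩
  have hcinj : Set.InjOn c X := by
    intro p hp q hq he
    rw [hc] at he
    exact h.injOn_cell (hX hp) (hX hq) (congrArg Subtype.val he)
  obtain ⟨S₀, κ₀, hS₀, hκ₀, hadj, hbal⟩ := (k5Free_cellGraph h).exists_coloring
    (fun v => if v ∈ X.image c then 1 else 0) (fun v => by split_ifs <;> simp) hr0
    (by
      rw [← Nat.card_eq_fintype_card, Nat.card_coe_set_eq]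
      exact (Nat.mul_le_mul_left 5 hcard).trans hr) J
  rw [← hm] at hS₀
  obtain ⟨S, hS⟩ : ∃ S : Finset Trapezoid, S = S₀.image Subtype.val := ⟨_, rfl⟩
  have hScard : #S ≤ m := hS ▸ card_image_le.trans hS₀
  have hrep : ∀ k ∈ S, ∃ z, IsCell P E z k := by
    intro k hk
    rw [hS] at hk
    obtain ⟨⟨_, z, rfl⟩, -, rfl⟩ := mem_image.1 hk
    exact ⟨z, isCell_cell P E z⟩
  choose! rep hrep using hrep
  have hleft : ∀ k, ∃ o : Option (ℝ × ℝ),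
      (∀ q ∈ o, q ∈ P ∧ InClosedGap k.top k.bot q ∧ q.1 < (rep k).1) ∧
      ∀ p ∈ P, InClosedGap k.top k.bot p → p.1 < (rep k).1 → ∃ q ∈ o, p.1 ≤ q.1 := by
    intro k
    obtain ⟨s, hs⟩ : ∃ s, s = P.filter fun q => InClosedGap k.top k.bot q ∧ q.1 < (rep k).1 :=
      ⟨_, rfl⟩
    rcases s.eq_empty_or_nonempty with he | hne
    · refine ⟨none, by simp, fun p hp h1 h2 => ?_⟩
      have : p ∈ s := by rw [hs]; exact mem_filter.2 ⟨hp, h1, h2⟩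
      simp [he] at this
    · obtain ⟨q, hq, hmax⟩ := exists_max_image s Prod.fst hne
      refine ⟨some q, fun q' hq' => ?_, fun p hp h1 h2 => ⟨q, rfl, hmax p ?_⟩⟩
      · obtain rfl := Option.mem_some_iff.1 hq'
        rw [hs] at hq
        exact mem_filter.1 hq
      · rw [hs]; exact mem_filter.2 ⟨hp, h1, h2⟩
  choose left hleft hleft' using hleft
  obtain ⟨E', hE'⟩ : ∃ E', E' = S.biUnion fun k => k.top.toFinset ∪ k.bot.toFinset := ⟨_, rfl⟩
  obtain ⟨P', hP'⟩ : ∃ P', P' = S.biUnion (fun k => k.next.toFinset ∪ (left k).toFinset) ∪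
      (E'.image Prod.fst ∪ E'.image Prod.snd) := ⟨_, rfl⟩
  have hopt : ∀ {α : Type} (o : Option α), #o.toFinset ≤ 1 := by
    intro α o
    cases o <;> simp
  have hE'E : E' ⊆ E := by
    rw [hE']
    intro e he
    simp only [mem_biUnion, mem_union, Option.mem_toFinset] at he
    obtain ⟨k, hk, he⟩ := he
    exact he.elim ((hrep k hk).top_mem e) ((hrep k hk).bot_mem e)
  have hP'P : P' ⊆ P := by
    rw [hP']
    intro p hp
    simp only [mem_biUnion, mem_union, Option.mem_toFinset, mem_image] at hp
    rcases hp with ⟨k, hk, hp | hp⟩ | ⟨e, he, rfl⟩ | ⟨e, he, rfl⟩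
    · exact ((hrep k hk).next_mem p hp).1
    · exact (hleft k p hp).1
    · exact h.left e (hE'E he)
    · exact h.right e (hE'E he)
  have hE'c : #E' ≤ 2 * m := by
    rw [hE']
    refine card_biUnion_le.trans ((sum_le_card_nsmul _ _ 2 fun k _ => ?_).trans ?_)
    · exact (card_union_le _ _).trans (add_le_add (hopt _) (hopt _))
    · rw [smul_eq_mul]; omega
  have hP'c : #P' ≤ 6 * m := by
    have h1 : #(S.biUnion fun k => k.next.toFinset ∪ (left k).toFinset) ≤ #S • 2 := by
      refine card_biUnion_le.trans (sum_le_card_nsmul _ _ 2 fun k _ => ?_)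
      exact (card_union_le _ _).trans (add_le_add (hopt _) (hopt _))
    have h2 : #(E'.image Prod.fst ∪ E'.image Prod.snd) ≤ #E' + #E' :=
      (card_union_le _ _).trans (add_le_add card_image_le card_image_le)
    rw [hP']
    refine (card_union_le _ _).trans ?_
    rw [smul_eq_mul] at h1
    omega
  have hpslg : PSLG P' E' := by
    refine h.mono hP'P hE'E (fun e he => ?_) fun e he => ?_
    · rw [hP']; exact mem_union_right _ (mem_union_left _ (mem_image_of_mem _ he))
    · rw [hP']; exact mem_union_right _ (mem_union_right _ (mem_image_of_mem _ he))
  have htopmem : ∀ k ∈ S, ∀ e ∈ k.top, e ∈ E' := by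
    intro k hk e he
    rw [hE']
    exact mem_biUnion.2 ⟨k, hk, mem_union_left _ (Option.mem_toFinset.2 he)⟩
  have hbotmem : ∀ k ∈ S, ∀ e ∈ k.bot, e ∈ E' := by
    intro k hk e he
    rw [hE']
    exact mem_biUnion.2 ⟨k, hk, mem_union_right _ (Option.mem_toFinset.2 he)⟩
  have hnextmem : ∀ k ∈ S, ∀ p ∈ k.next, p ∈ P' := by
    intro k hk p hp
    rw [hP']
    exact mem_union_left _ (mem_biUnion.2 ⟨k, hk, mem_union_left _ (Option.mem_toFinset.2 hp)⟩)
  have hleftmem : ∀ k ∈ S, ∀ p ∈ left k, p ∈ P' := by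
    intro k hk p hp
    rw [hP']
    exact mem_union_left _ (mem_biUnion.2 ⟨k, hk, mem_union_right _ (Option.mem_toFinset.2 hp)⟩)
  have hdown : ∀ z, cell P E z ∈ S → cell P' E' z = cell P E z := fun z hz =>
    ((isCell_cell P E z).restrict hP'P hE'E (htopmem _ hz) (hbotmem _ hz)
      (hnextmem _ hz)).eq_cell hpslg
  have hup : ∀ z, cell P' E' z ∈ S → cell P E z = cell P' E' z := by
    intro z hz
    refine ((hrep _ hz).lift h (isCell_cell P' E' z) fun p hp hg hlt => ?_).eq_cell h
    obtain ⟨q, hq, hpq⟩ := hleft' _ p hp hg hlt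
    exact ⟨q, hleftmem _ hz q hq, (hleft _ q hq).2.1, (hleft _ q hq).2.2, hpq⟩
  obtain ⟨col, hcol⟩ : ∃ col : Trapezoid → ℕ,
      ∀ v : Set.range (cell P E), col v = κ₀ v :=
    ⟨fun k => if hk : k ∈ Set.range (cell P E) then κ₀ ⟨k, hk⟩ else 0, fun v => by simp⟩
  have hcolc : ∀ z, col (cell P E z) = κ₀ (c z) := fun z => by rw [hc, ← hcol]
  have hseg : ∀ x y, (∀ u ∈ segment ℝ x y, cell P E u ∉ S) →
      col (cell P E x) = col (cell P E y) := by
    refine fun x y hxy => eq_of_segment_avoids h col S (fun a b hab ha hb => ?_) x y hxy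
    rw [hcol, hcol]
    have hnot : ∀ a : Set.range (cell P E), (a : Trapezoid) ∉ (S : Set Trapezoid) → a ∉ S₀ := by
      intro a ha ha'
      refine ha ?_
      rw [hS]
      exact mem_coe.2 (mem_image_of_mem _ ha')
    exact hadj a b hab (hnot a ha) (hnot b hb)
  refine ⟨P', hP'P, E', hE'E, fun z => col (cell P E z), E.filter fun e => ∃ k ∈ S,
    e ∈ k.top ∨ e.1 ∈ k.next ∨ e.2 ∈ k.next, filter_subset _ _, hpslg, hP'c, hE'c,
    fun z => ?_, fun x y hxy => ?_, ?_, fun e he heF => ?_, fun q => ?_⟩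
  · exact (hcolc z).trans_lt (hκ₀ _)
  · by_cases hx : cell P' E' x ∈ S
    · show col (cell P E x) = col (cell P E y)
      rw [hup x hx, hup y (hxy ▸ hx), hxy]
    · refine hseg x y fun u hu huS => hx ?_
      rw [← cell_segment hpslg hxy hu, hdown u huS]
      exact huS
  · have hsub : (E.filter fun e => ∃ k ∈ S, e ∈ k.top ∨ e.1 ∈ k.next ∨ e.2 ∈ k.next) ⊆
        S.biUnion fun k => k.top.toFinset ∪
          k.next.toFinset.biUnion fun p => E.filter fun e => e.1 = p ∨ e.2 = p := by
      intro e he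
      obtain ⟨he, k, hk, hek⟩ := mem_filter.1 he
      refine mem_biUnion.2 ⟨k, hk, mem_union.2 ?_⟩
      rcases hek with hek | hek | hek
      · exact Or.inl (Option.mem_toFinset.2 hek)
      · exact Or.inr (mem_biUnion.2 ⟨e.1, Option.mem_toFinset.2 hek,
          mem_filter.2 ⟨he, Or.inl rfl⟩⟩)
      · exact Or.inr (mem_biUnion.2 ⟨e.2, Option.mem_toFinset.2 hek,
          mem_filter.2 ⟨he, Or.inr rfl⟩⟩)
    refine (card_le_card hsub).trans (card_biUnion_le.trans
      ((sum_le_card_nsmul _ _ 3 fun k _ => ?_).trans ?_))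
    · refine (card_union_le _ _).trans (add_le_add (hopt _) (b := 1) (d := 2) ?_)
      refine card_biUnion_le.trans ((sum_le_card_nsmul _ _ 2 fun p _ => hdeg p).trans ?_)
      have := hopt k.next
      rw [smul_eq_mul]; omega
    · rw [smul_eq_mul]; omega
  · refine hseg _ _ fun u hu huS => heF (mem_filter.2 ⟨he, _, huS, ?_⟩)
    exact h.cell_of_mem_edge he hu
  · have hone : ∀ Y ⊆ X, #Y = #(univ.filter fun v => v ∈ Y.image c) := by
      intro Y hY
      rw [filter_univ_mem, card_image_of_injOn (hcinj.mono hY)]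
    have h1 : ∑ v, (if v ∈ X.image c then 1 else 0) = #X := by
      rw [hone X subset_rfl, card_filter]
    have h2 : ∑ v, (if κ₀ v = q then if v ∈ X.image c then 1 else 0 else 0) =
        #(X.filter fun x => col (cell P E x) = q) := by
      rw [hone _ (filter_subset _ _), card_filter]
      refine sum_congr rfl fun v _ => ?_
      have : v ∈ (X.filter fun x => col (cell P E x) = q).image c ↔ κ₀ v = q ∧ v ∈ X.image c := by
        simp only [mem_image, mem_filter, hcolc]
        constructor
        · rintro ⟨x, ⟨hx, hxq⟩, rfl⟩
          exact ⟨hxq, x, hx, rfl⟩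
        · rintro ⟨hxq, x, hx, rfl⟩
          exact ⟨x, ⟨hx, hxq⟩, rfl⟩
      simp only [this, ite_and]
    have := hbal q
    rwa [h1, h2] at this

end CellGraph

lemma card_filter_card_le {α : Type} (Y : Finset α) (t : ℕ) :
    #(Y.powerset.filter fun s => #s ≤ t) ≤ (#Y + 1) ^ t := by
  induction t with
  | zero =>
    refine card_le_one.2 fun a ha b hb => ?_
    have h1 := (mem_filter.1 ha).2
    have h2 := (mem_filter.1 hb).2
    rw [Nat.le_zero, card_eq_zero] at h1 h2
    rw [h1, h2]
  | succ t ih =>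
    have hsub : (Y.powerset.filter fun s => #s ≤ t + 1) ⊆
        (Y.powerset.filter fun s => #s ≤ t) ∪
          Y.biUnion fun y => (Y.powerset.filter fun s => #s ≤ t).image (insert y) := by
      intro s hs
      obtain ⟨hs, hst⟩ := mem_filter.1 hs
      rw [mem_powerset] at hs
      rcases s.eq_empty_or_nonempty with rfl | ⟨y, hy⟩
      · exact mem_union_left _ (mem_filter.2 ⟨empty_mem_powerset _, by simp⟩)
      · refine mem_union_right _ (mem_biUnion.2 ⟨y, hs hy, mem_image.2 ⟨s.erase y, ?_,
          insert_erase hy⟩⟩)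
        refine mem_filter.2 ⟨mem_powerset.2 ((erase_subset _ _).trans hs), ?_⟩
        rw [card_erase_of_mem hy]
        omega
    refine (card_le_card hsub).trans ((card_union_le _ _).trans ?_)
    have h1 : #(Y.biUnion fun y => (Y.powerset.filter fun s => #s ≤ t).image (insert y)) ≤
        #Y • (#Y + 1) ^ t :=
      card_biUnion_le.trans (sum_le_card_nsmul _ _ _ fun y _ => card_image_le.trans ih)
    rw [smul_eq_mul] at h1
    calc _ ≤ (#Y + 1) ^ t + #Y * (#Y + 1) ^ t := add_le_add ih h1
      _ = (#Y + 1) ^ (t + 1) := by ring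

/-- The noncrossing sets of segments on `X` that form a disjoint union of `x`-monotone paths. -/
def pathSystems (X : Finset (ℝ × ℝ)) : Finset (Finset ((ℝ × ℝ) × (ℝ × ℝ))) :=
  (X ×ˢ X).powerset.filter fun E => PSLG X E ∧ Set.InjOn Prod.fst (E : Set ((ℝ × ℝ) × (ℝ × ℝ))) ∧
    Set.InjOn Prod.snd (E : Set ((ℝ × ℝ) × (ℝ × ℝ)))

lemma mem_pathSystems {X : Finset (ℝ × ℝ)} {E : Finset ((ℝ × ℝ) × (ℝ × ℝ))} :
    E ∈ pathSystems X ↔ PSLG X E ∧ Set.InjOn Prod.fst (E : Set ((ℝ × ℝ) × (ℝ × ℝ))) ∧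
      Set.InjOn Prod.snd (E : Set ((ℝ × ℝ) × (ℝ × ℝ))) := by
  refine ⟨fun h => (mem_filter.1 h).2, fun h => mem_filter.2 ⟨mem_powerset.2 fun e he => ?_, h⟩⟩
  exact mem_product.2 ⟨h.1.left e he, h.1.right e he⟩

lemma card_pathSystems_le_two_pow (X : Finset (ℝ × ℝ)) : #(pathSystems X) ≤ 2 ^ (#X * #X) := by
  refine (card_filter_le _ _).trans ?_
  rw [card_powerset, card_product]

/-- The subsets of `X` that are unions of cells of small decompositions. -/
def cellSplits (X : Finset (ℝ × ℝ)) (m : ℕ) : Finset (Finset (ℝ × ℝ)) :=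
  (((X.powerset.filter fun s => #s ≤ 6 * m) ×ˢ
    ((X ×ˢ X).powerset.filter fun s => #s ≤ 2 * m)).filter fun D => PSLG D.1 D.2).biUnion
      fun D => (X.image (cell D.1 D.2)).powerset.image fun Z => X.filter fun x => cell D.1 D.2 x ∈ Z

lemma PSLG.card_image_cell_le {P : Finset (ℝ × ℝ)} {E : Finset ((ℝ × ℝ) × (ℝ × ℝ))}
    (h : PSLG P E) (X : Finset (ℝ × ℝ)) : #(X.image (cell P E)) ≤ 2 * #P + 2 * #E + 1 := by
  refine le_trans ?_ h.ncard_range_cell_le.2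
  rw [← Set.ncard_coe_finset, coe_image]
  exact Set.ncard_le_ncard (Set.image_subset_range _ _) h.ncard_range_cell_le.1

lemma card_cellSplits_le (X : Finset (ℝ × ℝ)) (m : ℕ) :
    #(cellSplits X m) ≤ (#X + 1) ^ (6 * m) * (#X * #X + 1) ^ (2 * m) * 2 ^ (16 * m + 1) := by
  unfold cellSplits
  refine card_biUnion_le.trans ((sum_le_card_nsmul _ _ (2 ^ (16 * m + 1)) fun D hD => ?_).trans ?_)
  · obtain ⟨hD, hp⟩ := mem_filter.1 hD
    obtain ⟨h1, h2⟩ := mem_product.1 hD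
    have h3 := (mem_filter.1 h1).2
    have h4 := (mem_filter.1 h2).2
    refine card_image_le.trans ?_
    rw [card_powerset]
    refine Nat.pow_le_pow_right two_pos ((hp.card_image_cell_le X).trans ?_)
    omega
  · rw [smul_eq_mul]
    refine Nat.mul_le_mul_right _ ((card_filter_le _ _).trans ?_)
    rw [card_product, ← card_product X X]
    exact Nat.mul_le_mul (card_filter_card_le _ _) (card_filter_card_le _ _)

lemma PSLG.restrict {P X : Finset (ℝ × ℝ)} {E : Finset ((ℝ × ℝ) × (ℝ × ℝ))} (h : PSLG P E)
    (hX : X ⊆ P) : PSLG X (E.filter fun e => e.1 ∈ X ∧ e.2 ∈ X) :=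
  h.mono hX (filter_subset _ _) (fun _ he => (mem_filter.1 he).2.1)
    fun _ he => (mem_filter.1 he).2.2

lemma restrict_mem_pathSystems {X Y : Finset (ℝ × ℝ)} {E : Finset ((ℝ × ℝ) × (ℝ × ℝ))}
    (hE : E ∈ pathSystems X) (hY : Y ⊆ X) :
    E.filter (fun e => e.1 ∈ Y ∧ e.2 ∈ Y) ∈ pathSystems Y := by
  obtain ⟨h1, h2, h3⟩ := mem_pathSystems.1 hE
  have hsub := coe_subset.2 (filter_subset (fun e => e.1 ∈ Y ∧ e.2 ∈ Y) E)
  exact mem_pathSystems.2 ⟨h1.restrict hY, h2.mono hsub, h3.mono hsub⟩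

lemma exists_split_of_mem_pathSystems {X : Finset (ℝ × ℝ)} {E : Finset ((ℝ × ℝ) × (ℝ × ℝ))}
    (hE : E ∈ pathSystems X) {r : ℕ} (hr0 : 0 < r) (hr : 5 * (4 * #X + 1) ≤ r * r) :
    ∃ Y ∈ cellSplits X (10 * r), ∃ F ⊆ E, #F ≤ 30 * r ∧ Y ⊆ X ∧ 3 * #Y ≤ 2 * #X + 9 ∧
      3 * #(X \ Y) ≤ 2 * #X + 9 ∧ E = E.filter (fun e => e.1 ∈ Y ∧ e.2 ∈ Y) ∪
        E.filter (fun e => e.1 ∈ X \ Y ∧ e.2 ∈ X \ Y) ∪ F := by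
  obtain ⟨h, hl, hr'⟩ := mem_pathSystems.1 hE
  have hEc : #E ≤ #X := card_le_card_of_injOn Prod.fst (fun e he => h.left e he) hl
  have hdeg : ∀ p, #(E.filter fun e => e.1 = p ∨ e.2 = p) ≤ 2 := by
    intro p
    rw [filter_or]
    refine (card_union_le _ _).trans (add_le_add (b := 1) (d := 1) ?_ ?_)
    · exact card_le_one.2 fun a ha b hb => hl (mem_filter.1 ha).1 (mem_filter.1 hb).1
        ((mem_filter.1 ha).2.trans (mem_filter.1 hb).2.symm)
    · exact card_le_one.2 fun a ha b hb => hr' (mem_filter.1 ha).1 (mem_filter.1 hb).1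
        ((mem_filter.1 ha).2.trans (mem_filter.1 hb).2.symm)
  obtain ⟨P', hP', E', hE', κ, F, hF, hps, hPc, hEc', hκ2, hκ, hFc, hcut, hbal⟩ :=
    h.exists_descriptor hdeg subset_rfl 1 hr0 (by omega) (m := 10 * r) (by ring)
  have hκ2' : ∀ z, κ z ≠ 0 → κ z = 1 := fun z hz => by have := hκ2 z; omega
  have hcompl : X \ X.filter (fun x => κ x = 0) = X.filter fun x => κ x = 1 := by
    ext x
    simp only [mem_sdiff, mem_filter, not_and]
    constructor
    · exact fun ⟨hx, hx'⟩ => ⟨hx, hκ2' x (hx' hx)⟩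
    · exact fun ⟨hx, hx'⟩ => ⟨hx, fun _ => by omega⟩
  refine ⟨X.filter fun x => κ x = 0, ?_, F, hF, by omega, filter_subset _ _, ?_, ?_, ?_⟩
  · refine mem_biUnion.2 ⟨(P', E'), mem_filter.2 ⟨mem_product.2 ⟨mem_filter.2
      ⟨mem_powerset.2 hP', hPc⟩, mem_filter.2 ⟨mem_powerset.2 fun e he => mem_product.2
        ⟨h.left e (hE' he), h.right e (hE' he)⟩, hEc'⟩⟩, hps⟩, mem_image.2
      ⟨(X.filter fun x => κ x = 0).image (cell P' E'), mem_powerset.2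
        (image_subset_image (filter_subset _ _)), ?_⟩⟩
    ext x
    simp only [mem_filter, mem_image]
    constructor
    · rintro ⟨hx, y, ⟨hy, hy0⟩, hxy⟩
      exact ⟨hx, (hκ y x hxy).symm.trans hy0⟩
    · exact fun hx => ⟨hx.1, x, hx, rfl⟩
  · have := hbal 0
    omega
  · rw [hcompl]
    have := hbal 1
    omega
  · rw [hcompl]
    refine (union_subset (union_subset (filter_subset _ _) (filter_subset _ _)) hF).antisymm' ?_
    intro e he
    by_cases heF : e ∈ F
    · exact mem_union_right _ heF
    refine mem_union_left _ ?_
    have hc := hcut e he heF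
    have h1 := h.left e he
    have h2 := h.right e he
    by_cases h0 : κ e.1 = 0
    · exact mem_union_left _ (mem_filter.2 ⟨he, mem_filter.2 ⟨h1, h0⟩,
        mem_filter.2 ⟨h2, hc ▸ h0⟩⟩)
    · have := hκ2' _ h0
      exact mem_union_right _ (mem_filter.2 ⟨he, mem_filter.2 ⟨h1, this⟩,
        mem_filter.2 ⟨h2, hc ▸ this⟩⟩)

lemma card_pathSystems_le_of_split {X : Finset (ℝ × ℝ)} {r : ℕ} (hr0 : 0 < r)
    (hr : 5 * (4 * #X + 1) ≤ r * r) {B : ℝ} (hB0 : 0 ≤ B)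
    (hB : ∀ Y ⊆ X, 3 * #Y ≤ 2 * #X + 9 → 3 * #(X \ Y) ≤ 2 * #X + 9 →
      (#(pathSystems Y) : ℝ) * #(pathSystems (X \ Y)) ≤ B) :
    (#(pathSystems X) : ℝ) ≤ ((#X : ℝ) + 1) ^ (330 * r) * B := by
  have hsub : pathSystems X ⊆ ((cellSplits X (10 * r)).filter fun Y => Y ⊆ X ∧
      3 * #Y ≤ 2 * #X + 9 ∧ 3 * #(X \ Y) ≤ 2 * #X + 9).biUnion fun Y =>
        (pathSystems Y ×ˢ pathSystems (X \ Y) ×ˢ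
          ((X ×ˢ X).powerset.filter fun s => #s ≤ 30 * r)).image fun D => D.1 ∪ D.2.1 ∪ D.2.2 := by
    intro E hE
    obtain ⟨Y, hY, F, hF, hFc, hYX, h1, h2, hEeq⟩ := exists_split_of_mem_pathSystems hE hr0 hr
    refine mem_biUnion.2 ⟨Y, mem_filter.2 ⟨hY, hYX, h1, h2⟩, mem_image.2 ⟨(_, _, F),
      mem_product.2 ⟨restrict_mem_pathSystems hE hYX, mem_product.2
        ⟨restrict_mem_pathSystems hE sdiff_subset, mem_filter.2 ⟨mem_powerset.2 fun e he => ?_,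
          hFc⟩⟩⟩, hEeq.symm⟩⟩
    obtain ⟨h, -⟩ := mem_pathSystems.1 hE
    exact mem_product.2 ⟨h.left e (hF he), h.right e (hF he)⟩
  have hcard : (#(pathSystems X) : ℝ) ≤
      #(cellSplits X (10 * r)) * (B * ((#X * #X + 1) ^ (30 * r) : ℕ)) := by
    refine (Nat.cast_le.2 ((card_le_card hsub).trans card_biUnion_le)).trans ?_
    rw [Nat.cast_sum]
    refine (sum_le_card_nsmul _ _ (B * ((#X * #X + 1) ^ (30 * r) : ℕ)) fun Y hY => ?_).trans ?_
    · obtain ⟨-, hYX, h1, h2⟩ := mem_filter.1 hY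
      refine (Nat.cast_le.2 card_image_le).trans ?_
      rw [card_product, card_product, ← card_product X X, Nat.cast_mul, Nat.cast_mul, ← mul_assoc]
      exact mul_le_mul (hB Y hYX h1 h2) (Nat.cast_le.2 (card_filter_card_le _ _)) (by positivity) hB0
    · rw [nsmul_eq_mul]
      exact mul_le_mul_of_nonneg_right (Nat.cast_le.2 (card_filter_le _ _)) (by positivity)
  rcases X.eq_empty_or_nonempty with rfl | hX
  · have h0 : #(pathSystems ∅) ≤ 1 := by simpa using card_pathSystems_le_two_pow ∅
    have h1 : 1 ≤ #(pathSystems ∅) := by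
      refine card_pos.2 ⟨∅, mem_pathSystems.2 ⟨⟨?_, ?_, ?_, ?_, ?_, ?_⟩, ?_, ?_⟩⟩ <;> simp
    have := hB ∅ subset_rfl (by simp) (by simp)
    have h2 : #(pathSystems (∅ : Finset (ℝ × ℝ))) = 1 := by omega
    simp only [sdiff_self, bot_eq_empty, h2, Nat.cast_one, mul_one] at this
    simpa [h2] using this
  obtain ⟨n, hn⟩ : ∃ n, #X = n := ⟨_, rfl⟩
  have hn1 : 1 ≤ n := hn ▸ card_pos.2 hX
  have hsplit := card_cellSplits_le X (10 * r)
  rw [hn] at hsplit hcard ⊢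
  have hnn : n * n + 1 ≤ (n + 1) ^ 2 := by nlinarith
  have h3 : #(cellSplits X (10 * r)) * (n * n + 1) ^ (30 * r) ≤ (n + 1) ^ (330 * r) := by
    calc #(cellSplits X (10 * r)) * (n * n + 1) ^ (30 * r)
        ≤ (n + 1) ^ (6 * (10 * r)) * ((n + 1) ^ 2) ^ (2 * (10 * r)) *
          (n + 1) ^ (16 * (10 * r) + 1) * ((n + 1) ^ 2) ^ (30 * r) := by
          refine Nat.mul_le_mul (hsplit.trans (Nat.mul_le_mul (Nat.mul_le_mul_left _ ?_) ?_)) ?_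
          · exact Nat.pow_le_pow_left hnn _
          · exact Nat.pow_le_pow_left (by omega) _
          · exact Nat.pow_le_pow_left hnn _
      _ = (n + 1) ^ (60 * r + 40 * r + (160 * r + 1) + 60 * r) := by
          rw [← pow_mul, ← pow_mul, pow_add, pow_add, pow_add]
          ring
      _ ≤ (n + 1) ^ (330 * r) := Nat.pow_le_pow_right (by omega) (by omega)
  calc (#(pathSystems X) : ℝ) ≤ _ := hcard
    _ = (#(cellSplits X (10 * r)) * (n * n + 1) ^ (30 * r) : ℕ) * B := by push_cast; ring
    _ ≤ ((n + 1) ^ (330 * r) : ℕ) * B := mul_le_mul_of_nonneg_right (Nat.cast_le.2 h3) hB0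
    _ = _ := by push_cast; ring

/-- There are exponentially many noncrossing path systems on a point set. -/
theorem exists_card_pathSystems_le :
    ∃ K : ℝ, 0 ≤ K ∧ ∀ X : Finset (ℝ × ℝ), (#(pathSystems X) : ℝ) ≤ Real.exp (K * #X) := by
  obtain ⟨q, hq⟩ : ∃ q : ℕ → ℝ, q = fun n : ℕ => √√(n : ℝ) := ⟨_, rfl⟩
  have hq0 : ∀ n, 0 ≤ q n := fun n => hq ▸ Real.sqrt_nonneg _
  have hq2 : ∀ n, q n ^ 2 = √n := fun n => hq ▸ Real.sq_sqrt (Real.sqrt_nonneg _)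
  have hq4 : ∀ n, q n ^ 4 = n := fun n => by
    rw [show q n ^ 4 = (q n ^ 2) ^ 2 by ring, hq2, Real.sq_sqrt (Nat.cast_nonneg n)]
  have hq1 : ∀ n, 1 ≤ n → 1 ≤ q n := by
    intro n hn
    by_contra! hlt
    have := pow_lt_one₀ (hq0 n) hlt (n := 4) (by norm_num)
    rw [hq4] at this
    exact absurd this (not_lt.2 (by exact_mod_cast hn))
  have hq34 : ∀ n, q n ^ 3 ≤ n := by
    intro n
    rcases n.eq_zero_or_pos with rfl | hn
    · simp [hq]
    · rw [← hq4 n, show q n ^ 4 = q n ^ 3 * q n by ring]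
      exact le_mul_of_one_le_right (pow_nonneg (hq0 n) 3) (hq1 n hn)
  have hgain : ∀ a b n, a + b = n → 4 * a ≤ 3 * n → 4 * b ≤ 3 * n →
      107 / 100 * q n ^ 3 ≤ q a ^ 3 + q b ^ 3 := by
    intro a b n hab ha hb
    rcases n.eq_zero_or_pos with rfl | hn
    · have : q 0 = 0 := by simp [hq]
      obtain rfl : a = 0 := by omega
      obtain rfl : b = 0 := by omega
      simp [this]
    have key : ∀ a, 4 * a ≤ 3 * n → 107 / 100 * q a ≤ q n := by
      intro a ha
      have ha' : 4 * (a : ℝ) ≤ 3 * n := by exact_mod_cast ha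
      refine le_of_pow_le_pow_left₀ (n := 4) (by norm_num) (hq0 n) ?_
      rw [mul_pow, hq4, hq4]
      have := Nat.cast_nonneg (α := ℝ) a
      norm_num
      linarith
    have h1 : ∀ a, 4 * a ≤ 3 * n → 107 / 100 * q a ^ 4 ≤ q a ^ 3 * q n := by
      intro a ha
      have := mul_le_mul_of_nonneg_left (key a ha) (pow_nonneg (hq0 a) 3)
      linarith [this, show q a ^ 3 * (107 / 100 * q a) = 107 / 100 * q a ^ 4 by ring]
    refine le_of_mul_le_mul_right ?_ (zero_lt_one.trans_le (hq1 n hn))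
    have e1 := h1 a ha
    have e2 := h1 b hb
    have e3 : q a ^ 4 + q b ^ 4 = q n ^ 4 := by
      rw [hq4, hq4, hq4, ← hab]; push_cast; ring
    calc 107 / 100 * q n ^ 3 * q n = 107 / 100 * q n ^ 4 := by ring
      _ = 107 / 100 * q a ^ 4 + 107 / 100 * q b ^ 4 := by rw [← e3]; ring
      _ ≤ _ := by linarith
  suffices ∀ n, ∀ X : Finset (ℝ × ℝ), #X = n →
      (#(pathSystems X) : ℝ) ≤ Real.exp (400036 * n - 400000 * q n ^ 3) by
    refine ⟨400036, by norm_num, fun X => (this _ X rfl).trans (Real.exp_le_exp.2 ?_)⟩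
    have := pow_nonneg (hq0 #X) 3
    linarith
  intro n
  induction n using Nat.strong_induction_on with
  | _ n ih =>
  intro X hX
  rcases lt_or_ge n 36 with hn | hn
  · have h1 : (#(pathSystems X) : ℝ) ≤ 2 ^ (n * n) := by
      exact_mod_cast hX ▸ card_pathSystems_le_two_pow X
    have h2 : (2 : ℝ) ^ (n * n) ≤ Real.exp 1 ^ (n * n) :=
      pow_le_pow_left₀ (by norm_num) (by linarith [Real.add_one_le_exp (1 : ℝ)]) _
    rw [← Real.exp_nat_mul] at h2
    refine h1.trans (h2.trans (Real.exp_le_exp.2 ?_))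
    have h3 : ((n * n : ℕ) : ℝ) ≤ 36 * n := by
      exact_mod_cast Nat.mul_le_mul_right n hn.le
    have := hq34 n
    linarith
  obtain ⟨s, hs⟩ : ∃ s, s = Nat.sqrt n := ⟨_, rfl⟩
  have hs1 : s * s ≤ n := hs ▸ Nat.sqrt_le n
  have hs2 : n < (s + 1) * (s + 1) := hs ▸ Nat.lt_succ_sqrt n
  have hstep := card_pathSystems_le_of_split (X := X) (r := 5 * (s + 1)) (by omega)
    (by rw [hX]; nlinarith) (B := Real.exp (400036 * n - 400000 * (107 / 100 * q n ^ 3)))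
    (Real.exp_pos _).le ?_
  · refine hstep.trans ?_
    rw [hX]
    have hy := hq1 n (by omega)
    have hlog : Real.log ((n : ℝ) + 1) ≤ 8 * q n := by
      have h1 : (n : ℝ) + 1 ≤ (2 * q n) ^ 4 := by
        rw [mul_pow, hq4]
        have : (36 : ℝ) ≤ n := by exact_mod_cast hn
        linarith
      have h2 := Real.log_le_log (by positivity) h1
      rw [Real.log_pow] at h2
      have h3 := Real.log_le_sub_one_of_pos (show 0 < 2 * q n by linarith)
      push_cast at h2
      linarith
    have hs3 : (s : ℝ) + 1 ≤ 2 * q n ^ 2 := by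
      have h1 : (s : ℝ) ≤ q n ^ 2 := by
        rw [hq2]
        refine Real.le_sqrt_of_sq_le ?_
        rw [sq]
        exact_mod_cast hs1
      have h2 : 1 ≤ q n ^ 2 := one_le_pow₀ hy
      linarith
    have hpow : ((n : ℝ) + 1) ^ (330 * (5 * (s + 1))) ≤ Real.exp (28000 * q n ^ 3) := by
      have hpos : (0 : ℝ) < (n : ℝ) + 1 := by positivity
      rw [← Real.exp_log hpos, ← Real.exp_nat_mul]
      refine Real.exp_le_exp.2 ?_
      push_cast
      calc 330 * (5 * ((s : ℝ) + 1)) * Real.log (n + 1)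
          ≤ 330 * (5 * (2 * q n ^ 2)) * (8 * q n) := by
            refine mul_le_mul (by linarith) hlog (Real.log_nonneg ?_) (by positivity)
            linarith [Nat.cast_nonneg (α := ℝ) n]
        _ = 26400 * q n ^ 3 := by ring
        _ ≤ _ := by
            have := pow_nonneg (hq0 n) 3
            linarith
    refine (mul_le_mul_of_nonneg_right hpow (Real.exp_pos _).le).trans ?_
    rw [← Real.exp_add]
    refine Real.exp_le_exp.2 ?_
    linarith
  · intro Y hY h1 h2
    have hc : #Y + #(X \ Y) = n := by
      rw [card_sdiff_of_subset hY, hX]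
      have := card_le_card hY
      omega
    rw [hX] at h1 h2
    have e1 := ih #Y (by omega) Y rfl
    have e2 := ih #(X \ Y) (by omega) (X \ Y) rfl
    refine (mul_le_mul e1 e2 (Nat.cast_nonneg _) (Real.exp_pos _).le).trans ?_
    rw [← Real.exp_add]
    refine Real.exp_le_exp.2 ?_
    have hg := hgain _ _ n hc (by omega) (by omega)
    have hc' : (#Y : ℝ) + #(X \ Y) = n := by exact_mod_cast hc
    linarith

/-- All fibers of `c` are convex. -/
def ConvexFibers {α : Type} (c : ℝ × ℝ → α) : Prop :=
  ∀ x y u, c x = c y → u ∈ segment ℝ x y → c u = c x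

/-- The pairs of consecutive points of `X` in the same fiber of `c`. -/
def fiberEdges {α : Type} (X : Finset (ℝ × ℝ)) (c : ℝ × ℝ → α) :
    Finset ((ℝ × ℝ) × (ℝ × ℝ)) :=
  (X ×ˢ X).filter fun e => e.1.1 < e.2.1 ∧ c e.1 = c e.2 ∧
    ∀ p ∈ X, c p = c e.1 → e.1.1 < p.1 → e.2.1 ≤ p.1

lemma mem_fiberEdges {α : Type} {X : Finset (ℝ × ℝ)} {c : ℝ × ℝ → α} {e : (ℝ × ℝ) × (ℝ × ℝ)} :
    e ∈ fiberEdges X c ↔ (e.1 ∈ X ∧ e.2 ∈ X) ∧ e.1.1 < e.2.1 ∧ c e.1 = c e.2 ∧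
      ∀ p ∈ X, c p = c e.1 → e.1.1 < p.1 → e.2.1 ≤ p.1 := by
  unfold fiberEdges
  rw [mem_filter, mem_product]

lemma Alive.mem_segment {e : (ℝ × ℝ) × (ℝ × ℝ)} {x : ℝ} (h : Alive e x) :
    (x, height e x) ∈ segment ℝ e.1 e.2 := by
  obtain ⟨h1, h2⟩ := h
  have hd : 0 < e.2.1 - e.1.1 := by linarith
  refine ⟨(e.2.1 - x) / (e.2.1 - e.1.1), (x - e.1.1) / (e.2.1 - e.1.1),
    div_nonneg (by linarith) hd.le, div_nonneg (by linarith) hd.le, ?_, ?_⟩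
  · rw [← add_div, div_eq_one_iff_eq hd.ne']
    ring
  · ext
    · simp only [Prod.fst_add, Prod.smul_fst, smul_eq_mul]
      field_simp
      ring
    · simp only [Prod.snd_add, Prod.smul_snd, smul_eq_mul, height]
      field_simp
      ring

lemma ConvexFibers.fiberEdges_mem {α : Type} {X : Finset (ℝ × ℝ)} {c : ℝ × ℝ → α}
    (hc : ConvexFibers c) (hX : Set.InjOn Prod.fst (X : Set (ℝ × ℝ))) :
    fiberEdges X c ∈ pathSystems X := by
  have hcross : ∀ e ∈ fiberEdges X c, ∀ p ∈ X, c p = c e.1 → e.1.1 < p.1 → ¬ p.1 < e.2.1 :=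
    fun e he p hp h1 h2 => not_lt.2 ((mem_fiberEdges.1 he).2.2.2 p hp h1 h2)
  have hfirst : ∀ e ∈ fiberEdges X c, ∀ f ∈ fiberEdges X c, c e.1 = c f.1 → f.1.1 < e.2.1 →
      e.1.1 < f.2.1 → e = f := by
    intro e he f hf hef h1 h2
    obtain ⟨⟨he1, he2⟩, -, hce, -⟩ := mem_fiberEdges.1 he
    obtain ⟨⟨hf1, hf2⟩, -, hcf, -⟩ := mem_fiberEdges.1 hf
    have e1 : e.1.1 = f.1.1 := by
      rcases lt_trichotomy e.1.1 f.1.1 with h | h | h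
      · exact absurd h1 (hcross e he f.1 hf1 hef.symm h)
      · exact h
      · exact absurd h2 (hcross f hf e.1 he1 hef h)
    have hlt := (mem_fiberEdges.1 he).2.1
    have hlt' := (mem_fiberEdges.1 hf).2.1
    have e2 : e.2.1 = f.2.1 := by
      rcases lt_trichotomy e.2.1 f.2.1 with h | h | h
      · exact absurd h (hcross f hf e.2 he2 (hce.symm.trans hef) (e1 ▸ hlt))
      · exact h
      · exact absurd h (hcross e he f.2 hf2 (hcf.symm.trans hef.symm) (e1 ▸ hlt'))
    exact Prod.ext (hX he1 hf1 e1) (hX he2 hf2 e2)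
  have hon : ∀ e ∈ fiberEdges X c, ∀ x, Alive e x → c (x, height e x) = c e.1 :=
    fun e he x hx => hc _ _ _ (mem_fiberEdges.1 he).2.2.1 hx.mem_segment
  refine mem_pathSystems.2 ⟨⟨fun e he => (mem_fiberEdges.1 he).2.1,
    fun e he => (mem_fiberEdges.1 he).1.1, fun e he => (mem_fiberEdges.1 he).1.2,
    fun p hp q hq h => hX hp hq h, ?_, ?_⟩, ?_, ?_⟩
  · intro e he f hf x hex hfx hh
    refine hfirst e he f hf ?_ (hfx.1.trans hex.2) (hex.1.trans hfx.2)
    rw [← hon e he x hex, ← hon f hf x hfx, hh]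
  · intro e he p hp hal hh
    refine hcross e he p hp ?_ hal.1 hal.2
    rw [← hon e he _ hal, hh]
  · intro e he f hf hef
    have h1 := (mem_fiberEdges.1 he).2.1
    have h2 := (mem_fiberEdges.1 hf).2.1
    have h3 : e.1 = f.1 := hef
    exact hfirst e he f hf (by rw [h3]) (h3 ▸ h1) (h3 ▸ h2)
  · intro e he f hf hef
    obtain ⟨-, h1, h1', -⟩ := mem_fiberEdges.1 he
    obtain ⟨-, h2, h2', -⟩ := mem_fiberEdges.1 hf
    have h3 : e.2 = f.2 := hef
    exact hfirst e he f hf (by rw [h1', h2', h3]) (h3 ▸ h2) (h3 ▸ h1)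

lemma exists_fiberEdge {α : Type} {X : Finset (ℝ × ℝ)} {c : ℝ × ℝ → α}
    {p q : ℝ × ℝ} (hp : p ∈ X) (hq : q ∈ X)
    (hpq : p.1 < q.1) (h : c p = c q) : ∃ e ∈ fiberEdges X c, e.2 = q := by
  obtain ⟨r, hr, hmax⟩ := exists_max_image (X.filter fun r => c r = c q ∧ r.1 < q.1) Prod.fst
    ⟨p, mem_filter.2 ⟨hp, h, hpq⟩⟩
  obtain ⟨hrX, hrc, hrq⟩ := mem_filter.1 hr
  refine ⟨(r, q), mem_fiberEdges.2 ⟨⟨hrX, hq⟩, hrq, hrc, fun s hs hsc hrs => ?_⟩, rfl⟩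
  by_contra! hlt
  exact absurd (hmax s (mem_filter.2 ⟨hs, hsc.trans hrc, hlt⟩)) (not_le.2 hrs)

/-- The number of colorings of a point set that are constant on the classes of a partition of the
plane into `T` convex sets. -/
theorem exists_card_convexColorings_le :
    ∃ K : ℝ, 0 ≤ K ∧ ∀ (n k T : ℕ) (π : Fin n → ℝ × ℝ) (𝒦 : Finset (Fin n → ℕ)), 1 ≤ k →
      Function.Injective (fun i => (π i).1) →
      (∀ κ ∈ 𝒦, (∀ i, κ i < k) ∧ ∃ c : ℝ × ℝ → Trapezoid, ConvexFibers c ∧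
        #((univ.image π).image c) ≤ T ∧ ∀ i j, c (π i) = c (π j) → κ i = κ j) →
      (#𝒦 : ℝ) ≤ Real.exp (K * n) * k ^ T := by
  obtain ⟨K, hK0, hK⟩ := exists_card_pathSystems_le
  refine ⟨K, hK0, fun n k T π 𝒦 hk hπ h𝒦 => ?_⟩
  obtain ⟨X, hX⟩ : ∃ X, X = univ.image π := ⟨_, rfl⟩
  have hmemX : ∀ i, π i ∈ X := fun i => hX ▸ mem_image_of_mem _ (mem_univ i)
  have hXinj : Set.InjOn Prod.fst (X : Set (ℝ × ℝ)) := by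
    intro p hp q hq h
    rw [hX, coe_image] at hp hq
    obtain ⟨i, -, rfl⟩ := hp
    obtain ⟨j, -, rfl⟩ := hq
    rw [hπ h]
  have hcard : #X = n := by
    rw [hX, card_image_of_injective _ fun i j h => hπ (congrArg Prod.fst h), card_univ,
      Fintype.card_fin]
  obtain ⟨R, hR⟩ : ∃ R : Finset ((ℝ × ℝ) × (ℝ × ℝ)) → Finset (Fin n),
      ∀ E i, i ∈ R E ↔ ∀ e ∈ E, e.2 ≠ π i :=
    ⟨fun E => univ.filter fun i => ∀ e ∈ E, e.2 ≠ π i, fun E i => by simp⟩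
  obtain ⟨C, hC⟩ : ∃ C : Finset ((ℝ × ℝ) × (ℝ × ℝ)) → Finset (Fin n → ℕ),
      ∀ E κ, κ ∈ C E ↔ κ ∈ 𝒦 ∧ ∀ i j, (π i, π j) ∈ E → κ i = κ j :=
    ⟨fun E => 𝒦.filter fun κ => ∀ i j, (π i, π j) ∈ E → κ i = κ j, fun E κ => by
      rw [mem_filter]⟩
  have hcount : ∀ E ∈ (pathSystems X).filter (fun E => #(R E) ≤ T), #(C E) ≤ k ^ T := by
    intro E hE
    obtain ⟨hE, hRT⟩ := mem_filter.1 hE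
    obtain ⟨hps, -⟩ := mem_pathSystems.1 hE
    have hpi : #(Fintype.piFinset fun _ : R E => range k) ≤ k ^ T := by
      rw [Fintype.card_piFinset]
      simp only [card_range, prod_const, card_univ, Fintype.card_coe]
      exact Nat.pow_le_pow_right hk hRT
    refine le_trans (card_le_card_of_injOn (fun κ (i : R E) => κ i)
      (fun κ hκ => ?_) ?_) hpi
    · rw [mem_coe, Fintype.mem_piFinset]
      exact fun i => mem_range.2 ((h𝒦 κ ((hC E κ).1 hκ).1).1 i)
    · intro κ hκ κ' hκ' heq
      by_contra hne
      obtain ⟨i, hi⟩ := Function.ne_iff.1 hne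
      obtain ⟨i, hi, hmin⟩ := exists_min_image (univ.filter fun i => κ i ≠ κ' i)
        (fun i => (π i).1) ⟨i, by simpa using hi⟩
      replace hi : κ i ≠ κ' i := by simpa using hi
      have hroot : i ∉ R E := fun hiR => hi (congrFun heq ⟨i, hiR⟩)
      rw [hR] at hroot
      push Not at hroot
      obtain ⟨⟨p, q⟩, he, rfl : q = π i⟩ := hroot
      have hp := hps.left _ he
      rw [hX] at hp
      obtain ⟨j, -, rfl⟩ := mem_image.1 hp
      have hlt : (π j).1 < (π i).1 := hps.lt _ he
      have hj : κ j ≠ κ' j := by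
        rw [((hC E κ).1 hκ).2 j i he, ((hC E κ').1 hκ').2 j i he]
        exact hi
      exact absurd (hmin j (by simpa using hj)) (not_le.2 hlt)
  have hsub : 𝒦 ⊆ ((pathSystems X).filter fun E => #(R E) ≤ T).biUnion C := by
    intro κ hκ
    obtain ⟨-, c, hc, hcT, hκc⟩ := h𝒦 κ hκ
    rw [← hX] at hcT
    refine mem_biUnion.2 ⟨fiberEdges X c, mem_filter.2 ⟨hc.fiberEdges_mem hXinj, ?_⟩,
      (hC _ _).2 ⟨hκ, fun i j hij => hκc i j (mem_fiberEdges.1 hij).2.2.1⟩⟩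
    refine le_trans (card_le_card_of_injOn (fun i => c (π i))
      (fun i _ => mem_image_of_mem _ (hmemX i)) ?_) hcT
    intro i hi j hj hij
    by_contra hne
    have hne' : (π i).1 ≠ (π j).1 := fun h => hne (hπ h)
    rcases hne'.lt_or_gt with h | h
    · obtain ⟨e, he, hej⟩ := exists_fiberEdge (hmemX i) (hmemX j) h hij
      exact (hR _ _).1 hj e he hej
    · obtain ⟨e, he, hei⟩ := exists_fiberEdge (hmemX j) (hmemX i) h hij.symm
      exact (hR _ _).1 hi e he hei
  have htotal : #𝒦 ≤ #(pathSystems X) * k ^ T := by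
    refine (card_le_card hsub).trans (card_biUnion_le.trans ((sum_le_card_nsmul _ _ _ hcount).trans ?_))
    rw [smul_eq_mul]
    exact Nat.mul_le_mul_right _ (card_filter_le _ _)
  have h1 := hK X
  rw [hcard] at h1
  calc (#𝒦 : ℝ) ≤ (#(pathSystems X) * k ^ T : ℕ) := Nat.cast_le.2 htotal
    _ = #(pathSystems X) * (k : ℝ) ^ T := by push_cast; ring
    _ ≤ _ := mul_le_mul_of_nonneg_right h1 (by positivity)

/-- Consecutive segments of the polyline meet only at the common point, and other segments are
disjoint. -/
def SimplePoly : List (ℝ × ℝ) → Prop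
  | [] => True
  | [_] => True
  | a :: b :: l => a ≠ b ∧ segment ℝ a b ∩ polylineOf (b :: l) ⊆ {b} ∧ SimplePoly (b :: l)

lemma polylineOf_singleton (a : ℝ × ℝ) : polylineOf [a] = ∅ := by simp [polylineOf]

lemma mem_polylineOf_of_mem {a b p : ℝ × ℝ} {l : List (ℝ × ℝ)} (hp : p ∈ a :: b :: l) :
    p ∈ polylineOf (a :: b :: l) := by
  induction l generalizing a b with
  | nil =>
    rw [polylineOf_cons_cons]
    simp only [List.mem_cons, List.not_mem_nil, or_false] at hp
    rcases hp with rfl | rfl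
    · exact Or.inl (left_mem_segment ℝ _ _)
    · exact Or.inl (right_mem_segment ℝ _ _)
  | cons c l ih =>
    rw [polylineOf_cons_cons]
    rcases List.mem_cons.1 hp with rfl | hp
    · exact Or.inl (left_mem_segment ℝ _ _)
    · exact Or.inr (ih hp)

/-- The part of a simple polyline after its last point in a compact convex set. -/
lemma SimplePoly.exists_last {I : Set (ℝ × ℝ)} (hI : IsCompact I) {s : ℝ × ℝ}
    {l : List (ℝ × ℝ)} (hs : SimplePoly (s :: l))
    (hne : (I ∩ ({s} ∪ polylineOf (s :: l))).Nonempty) :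
    ∃ x ∈ I, ∃ l', SimplePoly (x :: l') ∧ polylineOf (x :: l') ⊆ polylineOf (s :: l) ∧
      I ∩ polylineOf (x :: l') ⊆ {x} ∧ l'.length ≤ l.length ∧
      (x :: l').getLast (by simp) = (s :: l).getLast (by simp) := by
  induction l generalizing s with
  | nil =>
    rw [polylineOf_singleton, Set.union_empty] at hne
    obtain ⟨z, hz, rfl⟩ := hne
    exact ⟨z, hz, [], trivial, subset_rfl, by simp [polylineOf_singleton], le_rfl, rfl⟩
  | cons b l ih =>
    obtain ⟨hsb, hcap, hsb'⟩ := hs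
    by_cases htail : (I ∩ ({b} ∪ polylineOf (b :: l))).Nonempty
    · obtain ⟨x, hx, l', h1, h2, h3, h4, h5⟩ := ih hsb' htail
      refine ⟨x, hx, l', h1, h2.trans ?_, h3, h4.trans (Nat.le_succ _), by simpa using h5⟩
      rw [polylineOf_cons_cons]
      exact Set.subset_union_right
    rw [Set.not_nonempty_iff_eq_empty] at htail
    have hno : ∀ z ∈ I, z ≠ b ∧ z ∉ polylineOf (b :: l) := by
      intro z hz
      constructor
      · rintro rfl
        exact (htail ▸ (⟨hz, Or.inl rfl⟩ : z ∈ I ∩ ({z} ∪ polylineOf (z :: l))) : z ∈ (∅ : Set _))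
      · intro h
        exact (htail ▸ (⟨hz, Or.inr h⟩ : z ∈ I ∩ ({b} ∪ polylineOf (b :: l))) : z ∈ (∅ : Set _))
    have hne' : (I ∩ segment ℝ s b).Nonempty := by
      obtain ⟨z, hz, hz'⟩ := hne
      rw [polylineOf_cons_cons] at hz'
      rcases hz' with rfl | hz' | hz'
      · exact ⟨z, hz, left_mem_segment ℝ _ _⟩
      · exact ⟨z, hz, hz'⟩
      · exact absurd hz' (hno z hz).2
    have hclosed : IsClosed (segment ℝ s b) := by
      rw [segment_eq_image_lineMap]
      exact (isCompact_Icc.image (by fun_prop)).isClosed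
    obtain ⟨x, ⟨hxI, hxs⟩, hmin⟩ := (hI.inter_right hclosed).exists_isMinOn hne'
      (f := fun z => dist z b) (by fun_prop)
    have hsub : segment ℝ x b ⊆ segment ℝ s b :=
      (convex_segment s b).segment_subset hxs (right_mem_segment ℝ s b)
    refine ⟨x, hxI, b :: l, ⟨(hno x hxI).1, ?_, hsb'⟩, ?_, ?_, le_rfl, by simp⟩
    · exact (Set.inter_subset_inter_left _ hsub).trans hcap
    · rw [polylineOf_cons_cons, polylineOf_cons_cons]
      exact Set.union_subset_union_left _ hsub
    · rintro u ⟨huI, hu⟩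
      rw [polylineOf_cons_cons] at hu
      rcases hu with hu | hu
      · have h1 : dist x b ≤ dist u b := hmin ⟨huI, hsub hu⟩
        have h2 := dist_add_dist_of_mem_segment hu
        have h3 : dist x u = 0 := le_antisymm (by linarith) dist_nonneg
        exact (dist_eq_zero.1 h3).symm
      · exact absurd hu (hno u huI).2

/-- Loop erasure: every polyline contains a simple polyline with the same end points and at most
as many segments. -/
lemma exists_simplePoly (a : ℝ × ℝ) (l : List (ℝ × ℝ)) :
    ∃ l', SimplePoly (a :: l') ∧ polylineOf (a :: l') ⊆ polylineOf (a :: l) ∧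
      l'.length ≤ l.length ∧ (a :: l').getLast (by simp) = (a :: l).getLast (by simp) := by
  induction l generalizing a with
  | nil => exact ⟨[], trivial, subset_rfl, le_rfl, rfl⟩
  | cons p l ih =>
    obtain ⟨s, h1, h2, h3, h4⟩ := ih p
    have hcomp : IsCompact (segment ℝ a p) := by
      rw [segment_eq_image_lineMap]
      exact isCompact_Icc.image (by fun_prop)
    obtain ⟨x, hx, l', g1, g2, g3, g4, g5⟩ := h1.exists_last hcomp
      ⟨p, right_mem_segment ℝ a p, Or.inl rfl⟩
    by_cases hax : a = x
    · subst hax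
      refine ⟨l', g1, ?_, by simp only [List.length_cons]; omega, ?_⟩
      · rw [polylineOf_cons_cons]
        exact (g2.trans h2).trans Set.subset_union_right
      · exact (g5.trans h4).trans (List.getLast_cons (by simp)).symm
    · have hsub : segment ℝ a x ⊆ segment ℝ a p :=
        (convex_segment a p).segment_subset (left_mem_segment ℝ a p) hx
      refine ⟨x :: l', ⟨hax, (Set.inter_subset_inter_left _ hsub).trans g3, g1⟩, ?_,
        by simp only [List.length_cons]; omega, ?_⟩
      · rw [polylineOf_cons_cons, polylineOf_cons_cons]
        exact Set.union_subset_union hsub (g2.trans h2)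
      · exact (List.getLast_cons (by simp)).trans
          ((g5.trans h4).trans (List.getLast_cons (by simp)).symm)

/-- A noncrossing family `D` of segments with end points in `Q` such that every point starts at most
one segment and ends at most one segment. -/
structure PathFamily (Q : Finset (ℝ × ℝ)) (D : Finset ((ℝ × ℝ) × (ℝ × ℝ))) : Prop where
  left : ∀ e ∈ D, e.1 ∈ Q
  right : ∀ e ∈ D, e.2 ∈ Q
  ne : ∀ e ∈ D, e.1 ≠ e.2
  nc : ∀ e ∈ D, ∀ f ∈ D, ∀ z ∈ openSegment ℝ e.1 e.2, z ∈ openSegment ℝ f.1 f.2 → e = f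
  np : ∀ e ∈ D, ∀ p ∈ Q, p ∉ openSegment ℝ e.1 e.2
  fst_inj : ∀ e ∈ D, ∀ f ∈ D, e.1 = f.1 → e = f
  snd_inj : ∀ e ∈ D, ∀ f ∈ D, e.2 = f.2 → e = f

lemma SimplePoly.pathFamily {l : List (ℝ × ℝ)} (h : SimplePoly l) :
    l.Nodup ∧ PathFamily l.toFinset (l.zip l.tail).toFinset := by
  induction l with
  | nil => exact ⟨List.nodup_nil, by constructor <;> simp⟩
  | cons a l ih =>
    cases l with
    | nil =>
      exact ⟨List.nodup_singleton a, by constructor <;> simp⟩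
    | cons b l =>
      obtain ⟨hab, hcap, hl⟩ := h
      obtain ⟨hnd, hpf⟩ := ih hl
      obtain ⟨Q, hQ⟩ : ∃ Q, Q = (b :: l).toFinset := ⟨_, rfl⟩
      obtain ⟨D, hD⟩ : ∃ D, D = ((b :: l).zip (b :: l).tail).toFinset := ⟨_, rfl⟩
      have hmeet : ∀ p ∈ b :: l, p ∈ segment ℝ a b → p = b := by
        intro p hp hps
        cases l with
        | nil => simpa using hp
        | cons c l => exact hcap ⟨hps, mem_polylineOf_of_mem hp⟩
      have hal : a ∉ b :: l := fun ha => hab (hmeet a ha (left_mem_segment ℝ a b))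
      have hDsub : ∀ e ∈ D, segment ℝ e.1 e.2 ⊆ polylineOf (b :: l) := by
        intro e he z hz
        rw [hD, List.mem_toFinset] at he
        exact Set.mem_biUnion he hz
      have hab0 : b ∉ openSegment ℝ a b := by
        rw [right_mem_openSegment_iff]
        exact hab
      have haa0 : a ∉ openSegment ℝ a b := by
        rw [left_mem_openSegment_iff]
        exact hab
      have hcross : ∀ f ∈ D, ∀ z ∈ openSegment ℝ a b, z ∉ segment ℝ f.1 f.2 := by
        intro f hf z hz hz'
        obtain rfl := hcap ⟨openSegment_subset_segment ℝ _ _ hz, hDsub f hf hz'⟩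
        exact hab0 hz
      have hsnd : ∀ e ∈ D, e.2 ∈ l := by
        intro e he
        rw [hD, List.mem_toFinset] at he
        exact (List.of_mem_zip he).2
      have hfst : ∀ e ∈ D, e.1 ≠ a := by
        intro e he h
        refine hal (h ▸ ?_)
        rw [hD, List.mem_toFinset] at he
        exact (List.of_mem_zip he).1
      have hbl : b ∉ l := (List.nodup_cons.1 hnd).1
      refine ⟨List.nodup_cons.2 ⟨hal, hnd⟩, ?_⟩
      have e1 : (a :: b :: l).toFinset = insert a Q := by rw [hQ, List.toFinset_cons]
      have e2 : ((a :: b :: l).zip (a :: b :: l).tail).toFinset = insert (a, b) D := by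
        rw [hD, ← List.toFinset_cons]
        rfl
      rw [← hQ, ← hD] at hpf
      rw [e1, e2]
      have hbQ : b ∈ Q := by rw [hQ]; simp
      refine ⟨?_, ?_, ?_, ?_, ?_, ?_, ?_⟩
      · intro e he
        rcases mem_insert.1 he with rfl | he
        · exact mem_insert_self _ _
        · exact mem_insert_of_mem (hpf.left e he)
      · intro e he
        rcases mem_insert.1 he with rfl | he
        · exact mem_insert_of_mem hbQ
        · exact mem_insert_of_mem (hpf.right e he)
      · intro e he
        rcases mem_insert.1 he with rfl | he
        · exact hab
        · exact hpf.ne e he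
      · intro e he f hf z hz hz'
        rcases mem_insert.1 he with rfl | he <;> rcases mem_insert.1 hf with rfl | hf
        · rfl
        · exact absurd (openSegment_subset_segment ℝ _ _ hz') (hcross f hf z hz)
        · exact absurd (openSegment_subset_segment ℝ _ _ hz) (hcross e he z hz')
        · exact hpf.nc e he f hf z hz hz'
      · intro e he p hp hpe
        rcases mem_insert.1 he with rfl | hD <;> rcases mem_insert.1 hp with rfl | hp
        · exact haa0 hpe
        · rw [hQ, List.mem_toFinset] at hp
          obtain rfl := hmeet p hp (openSegment_subset_segment ℝ _ _ hpe)
          exact hab0 hpe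
        · exact hab (hcap ⟨left_mem_segment ℝ p b,
            hDsub e hD (openSegment_subset_segment ℝ _ _ hpe)⟩)
        · exact hpf.np e hD p hp hpe
      · intro e he f hf hef
        rcases mem_insert.1 he with rfl | he <;> rcases mem_insert.1 hf with rfl | hf
        · rfl
        · exact absurd hef.symm (hfst f hf)
        · exact absurd hef (hfst e he)
        · exact hpf.fst_inj e he f hf hef
      · intro e he f hf hef
        rcases mem_insert.1 he with rfl | he <;> rcases mem_insert.1 hf with rfl | hf
        · rfl
        · exact absurd (hsnd f hf) fun h => hbl ((show b = f.2 from hef) ▸ h)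
        · exact absurd (hsnd e he) fun h => hbl ((show e.2 = b from hef) ▸ h)
        · exact hpf.snd_inj e he f hf hef

lemma eq_getLast_of_zip_tail {α : Type} (g : ℝ × ℝ → α) (a : ℝ × ℝ) (l : List (ℝ × ℝ))
    (hg : ∀ e ∈ (a :: l).zip l, g e.1 = g e.2) : g a = g ((a :: l).getLast (by simp)) := by
  induction l generalizing a with
  | nil => rfl
  | cons b l ih =>
    rw [List.getLast_cons (by simp), ← ih b fun e he => hg e (List.mem_cons_of_mem _ he)]
    exact hg (a, b) List.mem_cons_self

/-- Every polyline between distinct points contains the segments of a simple path. -/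
theorem exists_pathFamily {a b : ℝ × ℝ} (hab : a ≠ b) (l : List (ℝ × ℝ)) :
    ∃ Q D, PathFamily Q D ∧ a ∈ Q ∧ b ∈ Q ∧ (Q : Set (ℝ × ℝ)) ⊆ polylineOf (a :: (l ++ [b])) ∧
      (∀ e ∈ D, segment ℝ e.1 e.2 ⊆ polylineOf (a :: (l ++ [b]))) ∧ #Q ≤ l.length + 2 ∧
      #D ≤ l.length + 1 ∧ ∀ g : ℝ × ℝ → ℕ, (∀ e ∈ D, g e.1 = g e.2) → g a = g b := by
  obtain ⟨l', h1, h2, h3, h4⟩ := exists_simplePoly a (l ++ [b])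
  have hb : (a :: (l ++ [b])).getLast (by simp) = b := by
    rw [List.getLast_cons (by simp), List.getLast_append_singleton]
  rw [hb] at h4
  rw [List.length_append, List.length_singleton] at h3
  cases l' with
  | nil => exact absurd h4 hab
  | cons c l' =>
    refine ⟨_, _, h1.pathFamily.2, by simp, ?_, ?_, ?_, ?_, ?_, ?_⟩
    · rw [List.mem_toFinset, ← h4]
      exact List.getLast_mem _
    · intro p hp
      exact h2 (mem_polylineOf_of_mem (List.mem_toFinset.1 (mem_coe.1 hp)))
    · intro e he z hz
      exact h2 (Set.mem_biUnion (List.mem_toFinset.1 he) hz)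
    · refine (List.toFinset_card_le _).trans ?_
      simp only [List.length_cons] at h3 ⊢
      omega
    · refine (List.toFinset_card_le _).trans ?_
      simp only [List.length_zip, List.length_cons, List.tail_cons] at h3 ⊢
      omega
    · intro g hg
      rw [← h4]
      exact eq_getLast_of_zip_tail g a (c :: l') fun e he => hg e (List.mem_toFinset.2 he)

/-- The union of path families carried by pairwise disjoint curves. -/
lemma PathFamily.biUnion {ι : Type} {S : Finset ι} {X : Finset (ℝ × ℝ)} {C : ι → Set (ℝ × ℝ)}
    {Q : ι → Finset (ℝ × ℝ)} {D : ι → Finset ((ℝ × ℝ) × (ℝ × ℝ))}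
    (h : ∀ v ∈ S, PathFamily (Q v) (D v)) (hQ : ∀ v ∈ S, ∀ q ∈ Q v, q ∈ C v)
    (hD : ∀ v ∈ S, ∀ e ∈ D v, segment ℝ e.1 e.2 ⊆ C v)
    (hC : ∀ u ∈ S, ∀ v ∈ S, ∀ z, z ∈ C u → z ∈ C v → u = v)
    (hX : ∀ v ∈ S, ∀ x ∈ X, x ∈ C v → x ∈ Q v) :
    PathFamily (X ∪ S.biUnion Q) (S.biUnion D) := by
  have hpt : ∀ u ∈ S, ∀ v ∈ S, ∀ e ∈ D u, ∀ f ∈ D v, ∀ z ∈ segment ℝ e.1 e.2,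
      z ∈ segment ℝ f.1 f.2 → u = v := fun u hu v hv e he f hf z hz hz' =>
    hC u hu v hv z (hD u hu e he hz) (hD v hv f hf hz')
  refine ⟨?_, ?_, ?_, ?_, ?_, ?_, ?_⟩
  · intro e he
    obtain ⟨v, hv, he⟩ := mem_biUnion.1 he
    exact mem_union_right _ (mem_biUnion.2 ⟨v, hv, (h v hv).left e he⟩)
  · intro e he
    obtain ⟨v, hv, he⟩ := mem_biUnion.1 he
    exact mem_union_right _ (mem_biUnion.2 ⟨v, hv, (h v hv).right e he⟩)
  · intro e he
    obtain ⟨v, hv, he⟩ := mem_biUnion.1 he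
    exact (h v hv).ne e he
  · intro e he f hf z hz hz'
    obtain ⟨u, hu, he⟩ := mem_biUnion.1 he
    obtain ⟨v, hv, hf⟩ := mem_biUnion.1 hf
    obtain rfl := hpt u hu v hv e he f hf z (openSegment_subset_segment ℝ _ _ hz)
      (openSegment_subset_segment ℝ _ _ hz')
    exact (h u hu).nc e he f hf z hz hz'
  · intro e he p hp hpe
    obtain ⟨u, hu, he⟩ := mem_biUnion.1 he
    have hpC := hD u hu e he (openSegment_subset_segment ℝ _ _ hpe)
    refine (h u hu).np e he p ?_ hpe
    rcases mem_union.1 hp with hp | hp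
    · exact hX u hu p hp hpC
    · obtain ⟨v, hv, hp⟩ := mem_biUnion.1 hp
      obtain rfl := hC u hu v hv p hpC (hQ v hv p hp)
      exact hp
  · intro e he f hf hef
    obtain ⟨u, hu, he⟩ := mem_biUnion.1 he
    obtain ⟨v, hv, hf⟩ := mem_biUnion.1 hf
    obtain rfl := hpt u hu v hv e he f hf e.1 (left_mem_segment ℝ _ _)
      (hef ▸ left_mem_segment ℝ _ _)
    exact (h u hu).fst_inj e he f hf hef
  · intro e he f hf hef
    obtain ⟨u, hu, he⟩ := mem_biUnion.1 he
    obtain ⟨v, hv, hf⟩ := mem_biUnion.1 hf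
    obtain rfl := hpt u hu v hv e he f hf e.2 (right_mem_segment ℝ _ _)
      (hef ▸ right_mem_segment ℝ _ _)
    exact (h u hu).snd_inj e he f hf hef

/-- The paths of the matching edges of a drawing. -/
theorem IsPolylineDrawing.exists_pathFamily {n : ℕ} {G : SimpleGraph (Fin n)}
    {π : Fin n → ℝ × ℝ} {bends : Fin n → Fin n → List (ℝ × ℝ)} (h : IsPolylineDrawing G π bends)
    (hπ : Function.Injective π) {f : Fin n → Fin n} (hf : FitsMatching f G) :
    ∃ Q, ∃ D : Fin n → Finset ((ℝ × ℝ) × (ℝ × ℝ)), PathFamily Q ((moved f).biUnion D) ∧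
      univ.image π ⊆ Q ∧ #Q ≤ 3 * n + ∑ v ∈ moved f, (bends v (f v)).length ∧
      #((moved f).biUnion D) ≤ n + ∑ v ∈ moved f, (bends v (f v)).length ∧
      (∀ u ∈ moved f, ∀ v ∈ moved f, ∀ e, e ∈ D u → e ∈ D v → u = v) ∧
      ∀ v ∈ moved f, ∀ g : ℝ × ℝ → ℕ, (∀ e ∈ D v, g e.1 = g e.2) → g (π v) = g (π (f v)) := by
  have hne : ∀ v ∈ moved f, π v ≠ π (f v) := fun v hv he => mem_moved.1 hv (hπ he).symm
  have hex : ∀ v, ∃ Q D, v ∈ moved f → PathFamily Q D ∧ π v ∈ Q ∧ π (f v) ∈ Q ∧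
      (Q : Set (ℝ × ℝ)) ⊆ edgeCurve π bends v (f v) ∧
      (∀ e ∈ D, segment ℝ e.1 e.2 ⊆ edgeCurve π bends v (f v)) ∧
      #Q ≤ (bends v (f v)).length + 2 ∧ #D ≤ (bends v (f v)).length + 1 ∧
      ∀ g : ℝ × ℝ → ℕ, (∀ e ∈ D, g e.1 = g e.2) → g (π v) = g (π (f v)) := by
    intro v
    by_cases hv : v ∈ moved f
    · obtain ⟨Q, D, hQ⟩ := _root_.exists_pathFamily (hne v hv) (bends v (f v))
      exact ⟨Q, D, fun _ => hQ⟩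
    · exact ⟨∅, ∅, fun h => absurd h hv⟩
  choose Q D hQD using hex
  have hC : ∀ u ∈ moved f, ∀ v ∈ moved f, ∀ z, z ∈ edgeCurve π bends u (f u) →
      z ∈ edgeCurve π bends v (f v) → u = v := by
    intro u hu v hv z hzu hzv
    by_contra huv
    have h1 : u ≠ f v := by
      rintro rfl
      exact mem_moved.1 hu (hf.idem v)
    have h2 : f u ≠ v := by
      rintro rfl
      exact mem_moved.1 hv (hf.idem u)
    have h3 : f u ≠ f v := fun h => huv (hf.inj u v (mem_moved.1 hu) (mem_moved.1 hv) h)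
    have h4 : s(u, f u) ≠ s(v, f v) := by
      simp [huv, h1]
    have hz : z ∈ edgeCurve π bends u (f u) ∩ edgeCurve π bends v (f v) := ⟨hzu, hzv⟩
    rw [h.inter u (f u) v (f v) (hf.adj u (mem_moved.1 hu)) (hf.adj v (mem_moved.1 hv)) h4] at hz
    obtain ⟨w, ⟨hw1, hw2⟩, -⟩ := hz
    rcases hw1 with rfl | rfl <;> rcases hw2 with hw2 | hw2
    · exact huv hw2
    · exact h1 hw2
    · exact h2 hw2
    · exact h3 hw2
  have hcard : #(moved f) ≤ n := (card_le_univ _).trans_eq (Fintype.card_fin n)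
  refine ⟨univ.image π ∪ (moved f).biUnion Q, D, ?_, subset_union_left, ?_, ?_, ?_, ?_⟩
  · refine PathFamily.biUnion (C := fun v => edgeCurve π bends v (f v))
      (fun v hv => (hQD v hv).1) (fun v hv q hq => (hQD v hv).2.2.2.1 hq)
      (fun v hv => (hQD v hv).2.2.2.2.1) hC ?_
    intro v hv x hx hxC
    obtain ⟨w, -, rfl⟩ := mem_image.1 hx
    by_cases h1 : w = v
    · subst h1
      exact (hQD w hv).2.1
    by_cases h2 : w = f v
    · subst h2
      exact (hQD v hv).2.2.1
    · exact absurd hxC (h.noVertex v (f v) w (hf.adj v (mem_moved.1 hv)) h1 h2)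
  · have h1 : #(univ.image π) ≤ n := card_image_le.trans_eq (by simp)
    have h2 : #((moved f).biUnion Q) ≤ ∑ v ∈ moved f, ((bends v (f v)).length + 2) :=
      card_biUnion_le.trans (sum_le_sum fun v hv => (hQD v hv).2.2.2.2.2.1)
    rw [sum_add_distrib, sum_const, smul_eq_mul] at h2
    have h3 := card_union_le (univ.image π) ((moved f).biUnion Q)
    omega
  · have h2 : #((moved f).biUnion D) ≤ ∑ v ∈ moved f, ((bends v (f v)).length + 1) :=
      card_biUnion_le.trans (sum_le_sum fun v hv => (hQD v hv).2.2.2.2.2.2.1)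
    rw [sum_add_distrib, sum_const, smul_eq_mul] at h2
    omega
  · intro u hu v hv e heu hev
    exact hC u hu v hv e.1 ((hQD u hu).2.2.2.2.1 e heu (left_mem_segment ℝ _ _))
      ((hQD v hv).2.2.2.2.1 e hev (left_mem_segment ℝ _ _))
  · exact fun v hv => (hQD v hv).2.2.2.2.2.2.2

lemma sum_length_le_totalBends {n : ℕ} {G : SimpleGraph (Fin n)}
    {bends : Fin n → Fin n → List (ℝ × ℝ)} {f : Fin n → Fin n} (hf : FitsMatching f G) :
    ((∑ v ∈ moved f, (bends v (f v)).length : ℕ) : ℝ) ≤ 2 * totalBends G bends := by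
  rw [totalBends, mul_div_cancel₀ _ two_ne_zero, Nat.cast_sum]
  refine (sum_le_sum fun v hv => ?_).trans
    (sum_le_sum_of_subset_of_nonneg (subset_univ (moved f)) fun v _ _ => ?_)
  · refine le_trans ?_ (single_le_sum (f := fun w => if G.Adj v w then ((bends v w).length : ℝ)
      else 0) (fun w _ => ?_) (mem_univ (f v)))
    · rw [if_pos (hf.adj v (mem_moved.1 hv))]
    · split_ifs <;> positivity
  · exact sum_nonneg fun w _ => by split_ifs <;> positivity

/-- The shear with slope `t`. -/
def shear (t : ℝ) : (ℝ × ℝ) ≃ₗ[ℝ] (ℝ × ℝ) where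
  toFun p := (p.1 + t * p.2, p.2)
  invFun p := (p.1 - t * p.2, p.2)
  map_add' p q := by ext <;> simp; ring
  map_smul' a p := by ext <;> simp; ring
  left_inv p := by ext <;> simp
  right_inv p := by ext <;> simp

lemma exists_shear (Q : Finset (ℝ × ℝ)) :
    ∃ t : ℝ, Set.InjOn (fun q => (shear t q).1) Q := by
  obtain ⟨t, ht⟩ := Infinite.exists_notMem_finset
    ((Q ×ˢ Q).image fun z => (z.1.1 - z.2.1) / (z.2.2 - z.1.2))
  refine ⟨t, fun p hp q hq hpq => ?_⟩
  by_contra hne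
  have hpq' : p.1 + t * p.2 = q.1 + t * q.2 := hpq
  have h2 : q.2 - p.2 ≠ 0 := by
    intro h0
    have h2 : p.2 = q.2 := by linarith
    rw [h2] at hpq'
    exact hne (Prod.ext (by linarith) h2)
  refine ht (mem_image.2 ⟨(p, q), mem_product.2 ⟨hp, hq⟩, ?_⟩)
  rw [div_eq_iff h2]
  linarith

lemma LinearEquiv.mem_segment_symm (σ : (ℝ × ℝ) ≃ₗ[ℝ] (ℝ × ℝ)) {x y u : ℝ × ℝ}
    (h : u ∈ segment ℝ x y) : σ u ∈ segment ℝ (σ x) (σ y) := by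
  obtain ⟨a, b, ha, hb, hab, rfl⟩ := h
  exact ⟨a, b, ha, hb, hab, by simp⟩

lemma ConvexFibers.comp {α : Type} {c : ℝ × ℝ → α} (h : ConvexFibers c)
    (σ : (ℝ × ℝ) ≃ₗ[ℝ] (ℝ × ℝ)) : ConvexFibers fun z => c (σ z) :=
  fun _ _ _ hxy hu => h _ _ _ hxy (σ.mem_segment_symm hu)

lemma Alive.mem_openSegment {e : (ℝ × ℝ) × (ℝ × ℝ)} {x : ℝ} (h : Alive e x) :
    (x, height e x) ∈ openSegment ℝ e.1 e.2 := by
  refine mem_openSegment_of_ne_left_right ?_ ?_ h.mem_segment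
  · intro hx
    exact h.1.ne (congrArg Prod.fst hx)
  · intro hx
    exact h.2.ne' (congrArg Prod.fst hx)

/-- The image of a segment under `σ`, directed from left to right. -/
def leftToRight (σ : (ℝ × ℝ) ≃ₗ[ℝ] (ℝ × ℝ)) (e : (ℝ × ℝ) × (ℝ × ℝ)) : (ℝ × ℝ) × (ℝ × ℝ) :=
  if (σ e.1).1 < (σ e.2).1 then (σ e.1, σ e.2) else (σ e.2, σ e.1)

lemma leftToRight_eq (σ : (ℝ × ℝ) ≃ₗ[ℝ] (ℝ × ℝ)) (e : (ℝ × ℝ) × (ℝ × ℝ)) :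
    leftToRight σ e = (σ e.1, σ e.2) ∨ leftToRight σ e = (σ e.2, σ e.1) := by
  rw [leftToRight]
  split_ifs <;> simp

lemma mem_openSegment_of_leftToRight {σ : (ℝ × ℝ) ≃ₗ[ℝ] (ℝ × ℝ)} {e : (ℝ × ℝ) × (ℝ × ℝ)} {z : ℝ × ℝ}
    (h : z ∈ openSegment ℝ (leftToRight σ e).1 (leftToRight σ e).2) :
    σ.symm z ∈ openSegment ℝ e.1 e.2 := by
  rcases leftToRight_eq σ e with h' | h' <;> rw [h'] at h
  · obtain ⟨a, b, ha, hb, hab, rfl⟩ := h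
    exact ⟨a, b, ha, hb, hab, by simp⟩
  · rw [openSegment_symm]
    obtain ⟨a, b, ha, hb, hab, rfl⟩ := h
    exact ⟨a, b, ha, hb, hab, by simp⟩

lemma PathFamily.pslg {Q : Finset (ℝ × ℝ)} {D : Finset ((ℝ × ℝ) × (ℝ × ℝ))} (h : PathFamily Q D)
    {σ : (ℝ × ℝ) ≃ₗ[ℝ] (ℝ × ℝ)} (hσ : Set.InjOn (fun q => (σ q).1) Q) :
    PSLG (Q.image σ) (D.image (leftToRight σ)) where
  lt e' he' := by
    obtain ⟨e, he, rfl⟩ := mem_image.1 he'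
    rw [leftToRight]
    split_ifs with hlt
    · exact hlt
    · exact lt_of_le_of_ne (not_lt.1 hlt) fun h' =>
        h.ne e he (hσ (h.right e he) (h.left e he) h').symm
  left e' he' := by
    obtain ⟨e, he, rfl⟩ := mem_image.1 he'
    rcases leftToRight_eq σ e with h' | h' <;> rw [h']
    · exact mem_image_of_mem σ (h.left e he)
    · exact mem_image_of_mem σ (h.right e he)
  right e' he' := by
    obtain ⟨e, he, rfl⟩ := mem_image.1 he'
    rcases leftToRight_eq σ e with h' | h' <;> rw [h']
    · exact mem_image_of_mem σ (h.right e he)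
    · exact mem_image_of_mem σ (h.left e he)
  inj p' hp' q' hq' hpq := by
    obtain ⟨p, hp, rfl⟩ := mem_image.1 hp'
    obtain ⟨q, hq, rfl⟩ := mem_image.1 hq'
    rw [hσ hp hq hpq]
  nc e' he' f' hf' x hxe hxf hh := by
    obtain ⟨e, he, rfl⟩ := mem_image.1 he'
    obtain ⟨f, hf, rfl⟩ := mem_image.1 hf'
    have h1 := mem_openSegment_of_leftToRight hxe.mem_openSegment
    have h2 := mem_openSegment_of_leftToRight hxf.mem_openSegment
    rw [← hh] at h2
    rw [h.nc e he f hf _ h1 h2]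
  np e' he' p' hp' hx hh := by
    obtain ⟨e, he, rfl⟩ := mem_image.1 he'
    obtain ⟨p, hp, rfl⟩ := mem_image.1 hp'
    have h1 := mem_openSegment_of_leftToRight hx.mem_openSegment
    rw [hh, Prod.mk.eta, LinearEquiv.symm_apply_apply] at h1
    exact h.np e he p hp h1

lemma PathFamily.degree_le {Q : Finset (ℝ × ℝ)} {D : Finset ((ℝ × ℝ) × (ℝ × ℝ))}
    (h : PathFamily Q D) (σ : (ℝ × ℝ) ≃ₗ[ℝ] (ℝ × ℝ)) (p : ℝ × ℝ) :
    #((D.image (leftToRight σ)).filter fun e => e.1 = p ∨ e.2 = p) ≤ 2 := by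
  have hsub : ((D.image (leftToRight σ)).filter fun e => e.1 = p ∨ e.2 = p) ⊆
      (D.filter fun e => e.1 = σ.symm p).image (leftToRight σ) ∪
        (D.filter fun e => e.2 = σ.symm p).image (leftToRight σ) := by
    intro e' he'
    obtain ⟨he', hp⟩ := mem_filter.1 he'
    obtain ⟨e, he, rfl⟩ := mem_image.1 he'
    have : e.1 = σ.symm p ∨ e.2 = σ.symm p := by
      rcases leftToRight_eq σ e with h' | h' <;> rw [h'] at hp <;> rcases hp with hp | hp
      · exact Or.inl (σ.eq_symm_apply.2 hp)
      · exact Or.inr (σ.eq_symm_apply.2 hp)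
      · exact Or.inr (σ.eq_symm_apply.2 hp)
      · exact Or.inl (σ.eq_symm_apply.2 hp)
    rcases this with h' | h'
    · exact mem_union_left _ (mem_image_of_mem _ (mem_filter.2 ⟨he, h'⟩))
    · exact mem_union_right _ (mem_image_of_mem _ (mem_filter.2 ⟨he, h'⟩))
  refine (card_le_card hsub).trans ((card_union_le _ _).trans ?_)
  have h1 : #(D.filter fun e => e.1 = σ.symm p) ≤ 1 := card_le_one.2 fun e he f hf => by
    rw [mem_filter] at he hf
    exact h.fst_inj e he.1 f hf.1 (he.2.trans hf.2.symm)
  have h2 : #(D.filter fun e => e.2 = σ.symm p) ≤ 1 := card_le_one.2 fun e he f hf => by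
    rw [mem_filter] at he hf
    exact h.snd_inj e he.1 f hf.1 (he.2.trans hf.2.symm)
  have h3 := card_image_le (s := D.filter fun e => e.1 = σ.symm p) (f := leftToRight σ)
  have h4 := card_image_le (s := D.filter fun e => e.2 = σ.symm p) (f := leftToRight σ)
  omega

/-- A matching drawn with few bends is almost monochromatic for a balanced colouring of the
vertices which is constant on few convex classes. -/
theorem IsPolylineDrawing.exists_convexColoring {n : ℕ} {G : SimpleGraph (Fin n)}
    {π : Fin n → ℝ × ℝ} {bends : Fin n → Fin n → List (ℝ × ℝ)} (h : IsPolylineDrawing G π bends)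
    (hπ : Function.Injective π) {f : Fin n → Fin n} (hf : FitsMatching f G) (J : ℕ) {r m : ℕ}
    (hr0 : 0 < r)
    (hr : 5 * (4 * (∑ v ∈ moved f, (bends v (f v)).length) + 8 * n + 1) ≤ r * r)
    (hm : m = 2 ^ J * (5 * r)) :
    ∃ κ : Fin n → ℕ, (∀ i, κ i < 2 ^ J) ∧
      (∃ c : ℝ × ℝ → Trapezoid, ConvexFibers c ∧ #((univ.image π).image c) ≤ 16 * m + 1 ∧
        ∀ i j, c (π i) = c (π j) → κ i = κ j) ∧
      (∀ q, 3 ^ J * #(univ.filter fun i => κ i = q) ≤ 2 ^ J * n + 3 ^ (J + 1)) ∧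
      #((moved f).filter fun v => κ v ≠ κ (f v)) ≤ 3 * m := by
  obtain ⟨Q, D, hQD, hπQ, hQ, hDc, hdisj, hg⟩ := h.exists_pathFamily hπ hf
  obtain ⟨t, ht⟩ := exists_shear Q
  obtain ⟨σ, hσ⟩ : ∃ σ, σ = shear t := ⟨_, rfl⟩
  rw [← hσ] at ht
  have hE := hQD.pslg ht
  have hcQ := card_image_le (s := Q) (f := σ)
  have hcD := card_image_le (s := (moved f).biUnion D) (f := leftToRight σ)
  have hX : (univ.image π).image σ ⊆ Q.image σ := image_subset_image hπQ
  obtain ⟨P', hP', E', hE', κ, F, hF, hpslg, hP'c, hE'c, hκ, hcell, hFc, hκF, hbal⟩ :=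
    hE.exists_descriptor (hQD.degree_le σ) hX J hr0 (le_trans (by omega) hr) hm
  have hσπ : Function.Injective fun i => σ (π i) := σ.injective.comp hπ
  have hXc : #((univ.image π).image σ) ≤ n :=
    card_image_le.trans (card_image_le.trans_eq (by simp))
  refine ⟨fun i => κ (σ (π i)), fun i => hκ _, ⟨fun z => cell P' E' (σ z), ?_, ?_, ?_⟩, ?_, ?_⟩
  · have hcf : ConvexFibers (cell P' E') := fun x y u hxy hu => cell_segment hpslg hxy hu
    exact hcf.comp σ
  · have := hpslg.card_image_cell_le ((univ.image π).image σ)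
    rw [image_image] at this
    have heq : (cell P' E' ∘ σ) = fun z => cell P' E' (σ z) := rfl
    rw [heq] at this
    omega
  · exact fun i j hij => hcell _ _ hij
  · intro q
    have h1 : #(univ.filter fun i => κ (σ (π i)) = q) ≤
        #(((univ.image π).image σ).filter fun x => κ x = q) := by
      refine card_le_card_of_injOn (fun i => σ (π i)) ?_ hσπ.injOn
      intro i hi
      rw [mem_coe, mem_filter] at hi ⊢
      exact ⟨mem_image_of_mem _ (mem_image_of_mem _ (mem_univ i)), hi.2⟩
    calc _ ≤ 3 ^ J * #(((univ.image π).image σ).filter fun x => κ x = q) :=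
          Nat.mul_le_mul_left _ h1
      _ ≤ _ := hbal q
      _ ≤ _ := Nat.add_le_add_right (Nat.mul_le_mul_left _ hXc) _
  · refine le_trans ?_ hFc
    have hbad : ∀ v ∈ (moved f).filter (fun v => κ (σ (π v)) ≠ κ (σ (π (f v)))),
        ∃ e ∈ D v, leftToRight σ e ∈ F := by
      intro v hv
      obtain ⟨hv, hne⟩ := mem_filter.1 hv
      by_contra hcon
      push Not at hcon
      refine hne (hg v hv (fun z => κ (σ z)) fun e he => ?_)
      have h1 := hκF (leftToRight σ e) (mem_image_of_mem _ (mem_biUnion.2 ⟨v, hv, he⟩)) (hcon e he)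
      rcases leftToRight_eq σ e with h' | h' <;> rw [h'] at h1
      · exact h1
      · exact h1.symm
    choose! e he heF using hbad
    refine card_le_card_of_injOn (fun v => leftToRight σ (e v)) (fun v hv => heF v hv) ?_
    intro u hu v hv huv
    have hu' := mem_filter.1 (mem_coe.1 hu)
    have hv' := mem_filter.1 (mem_coe.1 hv)
    refine hdisj u hu'.1 v hv'.1 (e u) (he u hu) ?_
    have hDu := mem_biUnion.2 ⟨u, hu'.1, he u hu⟩
    have hDv := mem_biUnion.2 ⟨v, hv'.1, he v hv⟩
    suffices e u = e v by rw [this]; exact he v hv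
    have hz : midpoint ℝ (leftToRight σ (e u)).1 (leftToRight σ (e u)).2 ∈
        openSegment ℝ (leftToRight σ (e u)).1 (leftToRight σ (e u)).2 :=
      ⟨2⁻¹, 2⁻¹, by norm_num, by norm_num, by norm_num, by
        rw [midpoint_eq_smul_add, invOf_eq_inv, smul_add]⟩
    have h1 := mem_openSegment_of_leftToRight hz
    have huv' : leftToRight σ (e u) = leftToRight σ (e v) := huv
    rw [huv'] at hz
    have h2 := mem_openSegment_of_leftToRight hz
    rw [← huv'] at h2
    exact hQD.nc _ hDu _ hDv _ h1 h2

theorem exists_card_convexColorings_le_of_injective :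
    ∃ K : ℝ, 0 ≤ K ∧ ∀ (n k T : ℕ) (π : Fin n → ℝ × ℝ) (𝒦 : Finset (Fin n → ℕ)), 1 ≤ k →
      Function.Injective π →
      (∀ κ ∈ 𝒦, (∀ i, κ i < k) ∧ ∃ c : ℝ × ℝ → Trapezoid, ConvexFibers c ∧
        #((univ.image π).image c) ≤ T ∧ ∀ i j, c (π i) = c (π j) → κ i = κ j) →
      (#𝒦 : ℝ) ≤ Real.exp (K * n) * k ^ T := by
  obtain ⟨K, hK0, hK⟩ := exists_card_convexColorings_le
  refine ⟨K, hK0, fun n k T π 𝒦 hk hπ h𝒦 => ?_⟩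
  obtain ⟨t, ht⟩ := exists_shear (univ.image π)
  refine hK n k T (fun i => shear t (π i)) 𝒦 hk (fun i j hij => hπ (ht ?_ ?_ hij))
    fun κ hκ => ?_
  · exact mem_coe.2 (mem_image_of_mem π (mem_univ i))
  · exact mem_coe.2 (mem_image_of_mem π (mem_univ j))
  · obtain ⟨h1, c, hc, hcT, hcκ⟩ := h𝒦 κ hκ
    refine ⟨h1, fun z => c ((shear t).symm z), hc.comp _, ?_, fun i j hij => hcκ i j ?_⟩
    · rw [image_image] at hcT ⊢
      refine le_trans (card_le_card ?_) hcT
      intro x hx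
      obtain ⟨i, hi, rfl⟩ := mem_image.1 hx
      exact mem_image.2 ⟨i, hi, by simp⟩
    · simpa using hij

/-- The maps moving exactly `a` points, at most `b` of them out of their colour class. -/
def nearlyMonochromatic {n : ℕ} (κ : Fin n → ℕ) (a b : ℕ) : Finset (Fin n → Fin n) :=
  (mapsMoving (Fin n) a).filter fun f => #((moved f).filter fun v => κ v ≠ κ (f v)) ≤ b

lemma card_nearlyMonochromatic_le {n a b s : ℕ} (κ : Fin n → ℕ) (hba : b ≤ a) (hsn : s ≤ n)
    (hs : ∀ q, #(univ.filter fun i => κ i = q) ≤ s) :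
    #(nearlyMonochromatic κ a b) ≤ 4 ^ n * (s ^ (a - b) * n ^ b) := by
  obtain ⟨t, ht⟩ : ∃ t : Finset (Fin n) × Finset (Fin n) → Fin n → Finset (Fin n),
    t = fun z v => if v ∈ z.1 then if v ∈ z.2 then univ else univ.filter fun i => κ i = κ v
      else {v} := ⟨_, rfl⟩
  obtain ⟨I, hI⟩ : ∃ I : Finset (Finset (Fin n) × Finset (Fin n)),
    I = univ.filter fun z => z.2 ⊆ z.1 ∧ #z.1 = a ∧ #z.2 ≤ b := ⟨_, rfl⟩
  have hsub : nearlyMonochromatic κ a b ⊆ I.biUnion fun z => Fintype.piFinset (t z) := by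
    intro f hf
    rw [nearlyMonochromatic, mem_filter, mem_mapsMoving] at hf
    refine mem_biUnion.2 ⟨(moved f, (moved f).filter fun v => κ v ≠ κ (f v)), ?_, ?_⟩
    · rw [hI, mem_filter]
      exact ⟨mem_univ _, filter_subset _ _, hf.1, hf.2⟩
    · rw [Fintype.mem_piFinset]
      intro v
      rw [ht]
      dsimp only
      split_ifs with h1 h2
      · exact mem_univ _
      · rw [mem_filter, not_and, not_not] at h2
        exact mem_filter.2 ⟨mem_univ _, (h2 h1).symm⟩
      · rw [mem_moved, not_not] at h1
        exact mem_singleton.2 h1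
  have hI4 : #I ≤ 4 ^ n := by
    refine (card_le_univ _).trans_eq ?_
    rw [Fintype.card_prod, Fintype.card_finset, Fintype.card_fin, ← mul_pow]
    norm_num
  have hcard : ∀ z ∈ I, #(Fintype.piFinset (t z)) ≤ s ^ (a - b) * n ^ b := by
    rintro ⟨S, B⟩ hz
    rw [hI, mem_filter] at hz
    obtain ⟨-, hBS, hS, hB⟩ := hz
    dsimp only at hBS hS hB
    rw [Fintype.card_piFinset]
    have h1 : ∏ v, #(t (S, B) v) = ∏ v ∈ S, #(t (S, B) v) := by
      refine (prod_subset (subset_univ S) fun v _ hv => ?_).symm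
      rw [ht]
      simp only [if_neg hv, card_singleton]
    have h2 : ∏ v ∈ S \ B, #(t (S, B) v) ≤ s ^ #(S \ B) := by
      refine prod_le_pow_card _ _ _ fun v hv => ?_
      rw [mem_sdiff] at hv
      rw [ht]
      simp only [if_pos hv.1, if_neg hv.2]
      exact hs (κ v)
    have h3 : ∏ v ∈ B, #(t (S, B) v) ≤ n ^ #B :=
      prod_le_pow_card _ _ _ fun v _ => (card_le_univ _).trans_eq (Fintype.card_fin n)
    rw [h1, ← prod_sdiff hBS]
    have h4 : #(S \ B) = (a - b) + (b - #B) := by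
      rw [card_sdiff_of_subset hBS, hS]
      omega
    calc _ ≤ s ^ #(S \ B) * n ^ #B := Nat.mul_le_mul h2 h3
      _ = s ^ (a - b) * (s ^ (b - #B) * n ^ #B) := by rw [h4, pow_add, mul_assoc]
      _ ≤ s ^ (a - b) * (n ^ (b - #B) * n ^ #B) := by gcongr
      _ = _ := by rw [← pow_add, Nat.sub_add_cancel hB]
  calc _ ≤ #(I.biUnion fun z => Fintype.piFinset (t z)) := card_le_card hsub
    _ ≤ ∑ z ∈ I, #(Fintype.piFinset (t z)) := card_biUnion_le
    _ ≤ #I * (s ^ (a - b) * n ^ b) := by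
        rw [← smul_eq_mul]
        exact sum_le_card_nsmul _ _ _ hcard
    _ ≤ _ := Nat.mul_le_mul_right _ hI4

/-- Few matchings with a given number of edges can be drawn with few bends on given points. -/
theorem exists_card_fewBendMatchings_le :
    ∃ K : ℝ, 0 ≤ K ∧ ∀ (n J r m a β s : ℕ) (π : Fin n → ℝ × ℝ) (M : Finset (Fin n → Fin n)),
      Function.Injective π → 0 < r → 5 * (4 * β + 8 * n + 1) ≤ r * r → m = 2 ^ J * (5 * r) →
      (∀ x, 3 ^ J * x ≤ 2 ^ J * n + 3 ^ (J + 1) → x ≤ s) → s ≤ n → 3 * m ≤ a →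
      (∀ f ∈ M, #(moved f) = a ∧ ∃ (G : SimpleGraph (Fin n))
        (bends : Fin n → Fin n → List (ℝ × ℝ)), IsPolylineDrawing G π bends ∧
        FitsMatching f G ∧ ∑ v ∈ moved f, (bends v (f v)).length ≤ β) →
      (#M : ℝ) ≤ Real.exp (K * n) * (2 ^ J) ^ (16 * m + 1) *
        (4 ^ n * (s ^ (a - 3 * m) * n ^ (3 * m))) := by
  obtain ⟨K, hK0, hK⟩ := exists_card_convexColorings_le_of_injective
  refine ⟨K, hK0, fun n J r m a β s π M hπ hr0 hr hm hs hsn hma hM => ?_⟩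
  have hex : ∀ f ∈ M, ∃ κ : Fin n → ℕ, (∀ i, κ i < 2 ^ J) ∧
      (∃ c : ℝ × ℝ → Trapezoid, ConvexFibers c ∧ #((univ.image π).image c) ≤ 16 * m + 1 ∧
        ∀ i j, c (π i) = c (π j) → κ i = κ j) ∧
      (∀ q, 3 ^ J * #(univ.filter fun i => κ i = q) ≤ 2 ^ J * n + 3 ^ (J + 1)) ∧
      #((moved f).filter fun v => κ v ≠ κ (f v)) ≤ 3 * m := by
    intro f hf
    obtain ⟨-, G, bends, hG, hfG, hβ⟩ := hM f hf
    exact hG.exists_convexColoring hπ hfG J hr0 (le_trans (by omega) hr) hm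
  choose! κ hκ using hex
  have h1 := hK n (2 ^ J) (16 * m + 1) π (M.image κ) Nat.one_le_two_pow hπ fun κ' hκ' => by
    obtain ⟨f, hf, rfl⟩ := mem_image.1 hκ'
    exact ⟨(hκ f hf).1, (hκ f hf).2.1⟩
  push_cast at h1
  have h2 : #M ≤ #(M.image κ) * (4 ^ n * (s ^ (a - 3 * m) * n ^ (3 * m))) := by
    have hsub : M ⊆ (M.image κ).biUnion fun κ' => nearlyMonochromatic κ' a (3 * m) := by
      intro f hf
      refine mem_biUnion.2 ⟨κ f, mem_image_of_mem κ hf, ?_⟩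
      rw [nearlyMonochromatic, mem_filter, mem_mapsMoving]
      exact ⟨(hM f hf).1, (hκ f hf).2.2.2⟩
    refine (card_le_card hsub).trans (card_biUnion_le.trans ?_)
    rw [← smul_eq_mul]
    refine sum_le_card_nsmul _ _ _ fun κ' hκ' => ?_
    obtain ⟨f, hf, rfl⟩ := mem_image.1 hκ'
    exact card_nearlyMonochromatic_le _ hma hsn fun q => hs _ ((hκ f hf).2.2.1 q)
  calc (#M : ℝ) ≤ #(M.image κ) * (4 ^ n * (s ^ (a - 3 * m) * n ^ (3 * m))) := by exact_mod_cast h2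
    _ ≤ _ := by gcongr

lemma pow_self_le_factorial_mul_exp (n : ℕ) : (n : ℝ) ^ n ≤ n.factorial * Real.exp n := by
  have h := Real.pow_div_factorial_le_exp (n : ℝ) (Nat.cast_nonneg n) n
  rwa [div_le_iff₀' (by positivity)] at h

lemma retract_bound {K n m : ℕ} (hK : 1 ≤ K) (hm : 48 * (K : ℝ) * m ≤ n) :
    (2 : ℝ) ^ n * (K ^ m * m ^ n) ≤ n.factorial / 2 ^ n * (1 / 4) ^ n := by
  have hK' : (1 : ℝ) ≤ K := by exact_mod_cast hK
  have hmn : m ≤ n := by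
    have h0 : (0 : ℝ) ≤ m := Nat.cast_nonneg m
    have : (m : ℝ) ≤ n := by nlinarith
    exact_mod_cast this
  have he : Real.exp n ≤ 3 ^ n := by
    rw [← mul_one (n : ℝ), Real.exp_nat_mul]
    exact pow_le_pow_left₀ (Real.exp_pos 1).le (Real.exp_one_lt_d9.le.trans (by norm_num)) n
  have h1 : (K : ℝ) ^ m * m ^ n ≤ (n / 48) ^ n := by
    calc (K : ℝ) ^ m * m ^ n ≤ K ^ n * m ^ n := by gcongr
      _ = (K * m) ^ n := by rw [mul_pow]
      _ ≤ (n / 48) ^ n := by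
        refine pow_le_pow_left₀ (by positivity) ?_ n
        linarith
  calc (2 : ℝ) ^ n * (K ^ m * m ^ n) ≤ 2 ^ n * (n / 48) ^ n := by gcongr
    _ = n ^ n * (1 / 24) ^ n := by
        rw [← mul_pow, ← mul_pow]
        ring
    _ ≤ n.factorial * 3 ^ n * (1 / 24) ^ n := by
        gcongr
        exact (pow_self_le_factorial_mul_exp n).trans (by gcongr)
    _ = n.factorial / 2 ^ n * (1 / 4) ^ n := by
        rw [mul_assoc, ← mul_pow, div_mul_eq_mul_div, mul_div_assoc, ← div_pow]
        norm_num

lemma matching_bound {K n J m a s : ℕ} {L B A ε : ℝ} (hA : 8 * (K : ℝ) * 2 ^ 64 ≤ Real.exp A)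
    (hK : 1 ≤ K) (hn : 0 < n) (hJ : 2 * (2 / 3 : ℝ) ^ J ≤ Real.exp (-B)) (hB0 : 0 ≤ B)
    (hB : B * ε = 2 * (L + A + 3)) (hm : 1 ≤ m) (hmn : 17 * (J : ℝ) * m ≤ n)
    (hma : 6 * (m : ℝ) ≤ ε * n) (haε : ε * n ≤ a) (han : a ≤ n)
    (hs : (s : ℝ) ≤ 2 * (2 / 3) ^ J * n) :
    Real.exp (L * n) * (2 ^ J) ^ (16 * m + 1) * (4 ^ n * (s ^ (a - 3 * m) * n ^ (3 * m))) *
      ((K : ℝ) ^ (n - a) * (n : ℝ) ^ (n - a) * 2 ^ (64 * n)) ≤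
      n.factorial / 2 ^ n * Real.exp (-n) := by
  have hK' : (1 : ℝ) ≤ K := by exact_mod_cast hK
  have h3ma : 3 * m ≤ a := by
    have : (3 * m : ℝ) ≤ a := by
      have : (0 : ℝ) ≤ m := Nat.cast_nonneg m
      linarith
    exact_mod_cast this
  have h2 : ((2 : ℝ) ^ J) ^ (16 * m + 1) ≤ Real.exp n := by
    have h2e : (2 : ℝ) ≤ Real.exp 1 := by
      have := Real.add_one_le_exp 1
      linarith
    calc ((2 : ℝ) ^ J) ^ (16 * m + 1) = 2 ^ (J * (16 * m + 1)) := by rw [← pow_mul]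
      _ ≤ Real.exp 1 ^ (J * (16 * m + 1)) := pow_le_pow_left₀ (by norm_num) h2e _
      _ = Real.exp ((J * (16 * m + 1) : ℕ) : ℝ) := by rw [← Real.exp_nat_mul, mul_one]
      _ ≤ Real.exp n := by
        refine Real.exp_le_exp.2 (le_trans ?_ hmn)
        have h : J * (16 * m + 1) ≤ 17 * J * m := by nlinarith
        exact_mod_cast h
  have h3 : (s : ℝ) ^ (a - 3 * m) ≤ Real.exp (-(L + A + 3) * n) * n ^ (a - 3 * m) := by
    calc (s : ℝ) ^ (a - 3 * m) ≤ (Real.exp (-B) * n) ^ (a - 3 * m) := by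
          refine pow_le_pow_left₀ (by positivity) (hs.trans ?_) _
          gcongr
      _ = Real.exp (((a - 3 * m : ℕ) : ℝ) * -B) * n ^ (a - 3 * m) := by
          rw [mul_pow, ← Real.exp_nat_mul]
      _ ≤ _ := by
          refine mul_le_mul_of_nonneg_right (Real.exp_le_exp.2 ?_) (by positivity)
          rw [Nat.cast_sub h3ma]
          push_cast
          have h4 : ε * n / 2 ≤ a - 3 * m := by linarith
          have h5 : (L + A + 3) * n = B * (ε * n / 2) := by
            rw [← mul_div_assoc, ← mul_assoc, hB]
            ring
          have h6 := mul_le_mul_of_nonneg_left h4 hB0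
          linarith
  have h4 : (4 : ℝ) ^ n * K ^ (n - a) * 2 ^ (64 * n) * 2 ^ n ≤ Real.exp (A * n) := by
    calc (4 : ℝ) ^ n * K ^ (n - a) * 2 ^ (64 * n) * 2 ^ n
        ≤ 4 ^ n * K ^ n * (2 ^ 64) ^ n * 2 ^ n := by
          rw [pow_mul]
          gcongr
          omega
      _ = (8 * (K : ℝ) * 2 ^ 64) ^ n := by
          rw [← mul_pow, ← mul_pow, ← mul_pow]
          ring
      _ ≤ Real.exp A ^ n := pow_le_pow_left₀ (by positivity) hA n
      _ = Real.exp (A * n) := by rw [← Real.exp_nat_mul, mul_comm]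
  have h5 : (n : ℝ) ^ (a - 3 * m) * n ^ (3 * m) * n ^ (n - a) = n ^ n := by
    rw [← pow_add, ← pow_add]
    congr 1
    omega
  rw [div_mul_eq_mul_div, le_div_iff₀ (by positivity)]
  calc _ ≤ Real.exp (L * n) * Real.exp n *
        (4 ^ n * (Real.exp (-(L + A + 3) * n) * n ^ (a - 3 * m) * n ^ (3 * m))) *
        ((K : ℝ) ^ (n - a) * (n : ℝ) ^ (n - a) * 2 ^ (64 * n)) * 2 ^ n := by gcongr
    _ = Real.exp (L * n) * Real.exp n * Real.exp (-(L + A + 3) * n) *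
        (4 ^ n * K ^ (n - a) * 2 ^ (64 * n) * 2 ^ n) *
        ((n : ℝ) ^ (a - 3 * m) * n ^ (3 * m) * n ^ (n - a)) := by ring
    _ ≤ Real.exp (L * n) * Real.exp n * Real.exp (-(L + A + 3) * n) * Real.exp (A * n) *
        (n.factorial * Real.exp n) := by
        rw [h5]
        gcongr
        exact pow_self_le_factorial_mul_exp n
    _ = n.factorial * Real.exp (-n) := by
        rw [mul_comm (n.factorial : ℝ) (Real.exp n), ← mul_assoc, ← Real.exp_add, ← Real.exp_add,
          ← Real.exp_add, ← Real.exp_add, mul_comm]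
        congr 2
        ring

lemma exists_radius (J : ℕ) (hJ : 2 * (2 / 3 : ℝ) ^ J ≤ 1) {η : ℝ} (hη : 0 < η) :
    ∃ c : ℝ, 0 < c ∧ ∃ N : ℕ, ∀ n, N ≤ n → ∃ r m s : ℕ, 0 < r ∧ m = 2 ^ J * (5 * r) ∧
      (∀ β : ℕ, (β : ℝ) ≤ 2 * c * n ^ 2 → 5 * (4 * β + 8 * n + 1) ≤ r * r) ∧
      (∀ x, 3 ^ J * x ≤ 2 ^ J * n + 3 ^ (J + 1) → x ≤ s) ∧ s ≤ n ∧
      (s : ℝ) ≤ 2 * (2 / 3) ^ J * n ∧ (m : ℝ) ≤ η * n := by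
  obtain ⟨θ, hθ⟩ : ∃ θ, θ = η / (5 * 2 ^ J) := ⟨_, rfl⟩
  have hθ0 : 0 < θ := hθ ▸ by positivity
  have hρ : (0 : ℝ) < (2 / 3) ^ J := by positivity
  refine ⟨θ ^ 2 / 320, by positivity,
    ⌈2 / θ⌉₊ + ⌈360 / θ ^ 2⌉₊ + ⌈3 / (2 / 3 : ℝ) ^ J⌉₊ + 1, fun n hn => ?_⟩
  have h1 : 2 / θ ≤ n := (Nat.le_ceil _).trans (by exact_mod_cast (by omega))
  have h2 : 360 / θ ^ 2 ≤ n := (Nat.le_ceil _).trans (by exact_mod_cast (by omega))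
  have h3 : 3 / (2 / 3 : ℝ) ^ J ≤ n := (Nat.le_ceil _).trans (by exact_mod_cast (by omega))
  have hn1 : (1 : ℝ) ≤ n := by exact_mod_cast (by omega : 1 ≤ n)
  rw [div_le_iff₀ (by positivity)] at h1 h2 h3
  have hrl : (n : ℝ) * θ / 2 ≤ ⌊n * θ⌋₊ := by
    have := Nat.lt_floor_add_one (n * θ)
    linarith
  have hru : (⌊n * θ⌋₊ : ℝ) ≤ n * θ := Nat.floor_le (by positivity)
  have hs : (((2 ^ J * n + 3 ^ (J + 1)) / 3 ^ J : ℕ) : ℝ) ≤ 2 * (2 / 3) ^ J * n := by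
    refine Nat.cast_div_le.trans ?_
    push_cast
    rw [div_le_iff₀ (by positivity)]
    have h4 : (2 / 3 : ℝ) ^ J * 3 ^ J = 2 ^ J := by rw [← mul_pow]; norm_num
    have h5 : (3 : ℝ) ^ (J + 1) ≤ 2 ^ J * n := by
      rw [pow_succ', ← h4]
      have := mul_le_mul_of_nonneg_right h3 (by positivity : (0 : ℝ) ≤ 3 ^ J)
      linarith
    have h6 : 2 * (2 / 3 : ℝ) ^ J * n * 3 ^ J = 2 * (2 ^ J * n) := by rw [← h4]; ring
    linarith
  refine ⟨⌊n * θ⌋₊, _, (2 ^ J * n + 3 ^ (J + 1)) / 3 ^ J, ?_, rfl, ?_, ?_, ?_, hs, ?_⟩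
  · have h4 : (0 : ℝ) < ⌊n * θ⌋₊ := by linarith
    exact_mod_cast h4
  · intro β hβ
    have h4 : (n * θ / 2) * (n * θ / 2) ≤ (⌊n * θ⌋₊ : ℝ) * ⌊n * θ⌋₊ :=
      mul_self_le_mul_self (by positivity) hrl
    have h5 := mul_le_mul_of_nonneg_right h2 (by positivity : (0 : ℝ) ≤ n)
    have h6 : (5 * (4 * β + 8 * n + 1) : ℝ) ≤ (⌊n * θ⌋₊ : ℝ) * ⌊n * θ⌋₊ := by
      nlinarith
    exact_mod_cast h6
  · intro x hx
    rw [Nat.le_div_iff_mul_le (by positivity), mul_comm]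
    exact hx
  · have h4 : (((2 ^ J * n + 3 ^ (J + 1)) / 3 ^ J : ℕ) : ℝ) ≤ n := hs.trans (by nlinarith)
    exact_mod_cast h4
  · push_cast
    calc (2 : ℝ) ^ J * (5 * ⌊n * θ⌋₊) ≤ 2 ^ J * (5 * (n * θ)) := by gcongr
      _ = η * n := by
        rw [hθ]
        field_simp

lemma card_fewBendGraphs_le {n a m : ℕ} {c : ℝ} {π : Fin n → ℝ × ℝ} (hm : m = (2 ^ 18 + 2) * a + 1)
    {M : Finset (Fin n → Fin n)}
    (hM : M = univ.filter fun f => #(moved f) = a ∧ ∃ (G : SimpleGraph (Fin n))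
      (bends : Fin n → Fin n → List (ℝ × ℝ)), IsPolylineDrawing G π bends ∧ FitsMatching f G ∧
        ∑ v ∈ moved f, (bends v (f v)).length ≤ ⌊2 * c * (n : ℝ) ^ 2⌋₊) :
    Nat.card {G : SimpleGraph (Fin n) // ∃ bends : Fin n → Fin n → List (ℝ × ℝ),
      IsPolylineDrawing G π bends ∧ totalBends G bends ≤ c * (n : ℝ) ^ 2} ≤
      #M * (#(k5FreeGraphs (Fin (n - a))) * 2 ^ (64 * n)) + #(retractGraphs (Fin n) m) := by
  rw [Nat.card_eq_fintype_card, Fintype.card_subtype]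
  have hsub : (univ.filter fun G : SimpleGraph (Fin n) =>
      ∃ bends : Fin n → Fin n → List (ℝ × ℝ),
        IsPolylineDrawing G π bends ∧ totalBends G bends ≤ c * (n : ℝ) ^ 2) ⊆
      graphsFitting M ∪ retractGraphs (Fin n) m := by
    intro G hG
    obtain ⟨-, bends, hd, hb⟩ := mem_filter.1 hG
    rw [mem_union, mem_graphsFitting, mem_retractGraphs]
    by_cases h : ∃ f, FitsMatching f G ∧ a ≤ #(moved f)
    · obtain ⟨f, hf, hfa⟩ := h
      obtain ⟨g, hg, hga⟩ := hf.restrict hfa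
      refine Or.inl ⟨hd.k5Free, g, ?_, hg⟩
      rw [hM, mem_filter]
      refine ⟨mem_univ _, hga, G, bends, hd, hg, Nat.le_floor ?_⟩
      linarith [sum_length_le_totalBends (bends := bends) hg]
    · push Not at h
      exact Or.inr ⟨hd.k5Free, hm ▸ hd.k5Free.exists_retraction h⟩
  have h1 := card_exists_fits_le M a fun f hf => by
    rw [hM, mem_filter] at hf
    exact hf.2.1
  rw [Fintype.card_fin] at h1
  exact (card_le_card hsub).trans ((card_union_le _ _).trans (Nat.add_le_add_right h1 _))

/-- There are constants `c > 0` and `N` such that for all `n ≥ N` and every injective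
vertex mapping `π : Fin n → ℝ²`, fewer than `n!/2^n` simple graphs on `Fin n` admit a
polyline drawing with vertex mapping `π` and at most `c·n²` total bends. -/
theorem count_few_bend_graphs_lt_factorial_div_pow :
    ∃ c : ℝ, 0 < c ∧ ∃ N : ℕ, ∀ n : ℕ, N ≤ n →
      ∀ π : Fin n → ℝ × ℝ, Function.Injective π →
      (Nat.card {G : SimpleGraph (Fin n) //
          ∃ bends : Fin n → Fin n → List (ℝ × ℝ),
            IsPolylineDrawing G π bends ∧ totalBends G bends ≤ c * (n : ℝ) ^ 2} : ℝ) <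
        (n.factorial : ℝ) / 2 ^ n := by
  obtain ⟨K, hK1, hK⟩ := exists_card_k5FreeGraphs_le
  obtain ⟨L, hL0, hL⟩ := exists_card_fewBendMatchings_le
  have hK' : (1 : ℝ) ≤ K := by exact_mod_cast hK1
  obtain ⟨ε, hε⟩ : ∃ ε : ℝ, ε * (48 * K * 2 ^ 20) = 1 :=
    ⟨(48 * K * 2 ^ 20)⁻¹, inv_mul_cancel₀ (by positivity)⟩
  have hε0 : 0 < ε := by
    by_contra h
    have : ε * (48 * K * 2 ^ 20) ≤ 0 := mul_nonpos_of_nonpos_of_nonneg (not_lt.1 h) (by positivity)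
    linarith
  have hε1 : ε ≤ 1 := by nlinarith
  obtain ⟨A, hA0, hA⟩ : ∃ A : ℝ, 0 ≤ A ∧ 8 * (K : ℝ) * 2 ^ 64 ≤ Real.exp A :=
    ⟨8 * (K : ℝ) * 2 ^ 64, by positivity, by linarith [Real.add_one_le_exp (8 * (K : ℝ) * 2 ^ 64)]⟩
  obtain ⟨B, hB0, hB⟩ : ∃ B : ℝ, 0 ≤ B ∧ B * ε = 2 * (L + A + 3) :=
    ⟨2 * (L + A + 3) / ε, by positivity, div_mul_cancel₀ _ hε0.ne'⟩
  obtain ⟨J, hJ⟩ : ∃ J : ℕ, 2 * (2 / 3 : ℝ) ^ J ≤ Real.exp (-B) := by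
    obtain ⟨J, hJ⟩ := exists_pow_lt_of_lt_one (half_pos (Real.exp_pos (-B)))
      (by norm_num : (2 / 3 : ℝ) < 1)
    exact ⟨J, by linarith⟩
  have hJ1 : 2 * (2 / 3 : ℝ) ^ J ≤ 1 :=
    hJ.trans (Real.exp_le_one_iff.2 (neg_nonpos.2 hB0))
  obtain ⟨η, hη0, hη1, hη2⟩ : ∃ η : ℝ, 0 < η ∧ 6 * η ≤ ε ∧ 17 * (J : ℝ) * η ≤ 1 := by
    refine ⟨min (ε / 6) (1 / (17 * J + 1)), by positivity, ?_, ?_⟩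
    · linarith [min_le_left (ε / 6) (1 / (17 * (J : ℝ) + 1))]
    · calc 17 * (J : ℝ) * min (ε / 6) (1 / (17 * J + 1))
          ≤ (17 * J + 1) * (1 / (17 * J + 1)) := by
            gcongr
            · linarith
            · exact min_le_right _ _
        _ = 1 := mul_one_div_cancel (by positivity)
  obtain ⟨c, hc, N, hN⟩ := exists_radius J hJ1 hη0
  refine ⟨c, hc, N + ⌈1 / ε⌉₊ + 1, fun n hn π hπ => ?_⟩
  obtain ⟨r, m, s, hr0, hm, hβ, hs, hsn, hsρ, hmη⟩ := hN n (by omega)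
  have hnε : 1 / ε ≤ n := (Nat.le_ceil _).trans (by exact_mod_cast (by omega))
  rw [div_le_iff₀ hε0, mul_comm] at hnε
  have hn0 : 0 < n := by omega
  have hn1 : (1 : ℝ) ≤ n := by exact_mod_cast hn0
  have hm1 : 1 ≤ m := by
    rw [hm]
    exact Nat.one_le_iff_ne_zero.2 (by positivity)
  have hm6 : 6 * (m : ℝ) ≤ ε * n := by nlinarith
  have hm17 : 17 * (J : ℝ) * m ≤ n := by
    calc 17 * (J : ℝ) * m ≤ 17 * J * (η * n) := by gcongr
      _ = 17 * J * η * n := by ring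
      _ ≤ 1 * n := by gcongr
      _ = n := one_mul _
  obtain ⟨a, ha⟩ : ∃ a, a = ⌈ε * n⌉₊ := ⟨_, rfl⟩
  have haε : ε * n ≤ a := ha ▸ Nat.le_ceil _
  have ha1 : (a : ℝ) < ε * n + 1 := ha ▸ Nat.ceil_lt_add_one (by positivity)
  have han : a ≤ n := by
    rw [ha]
    exact Nat.ceil_le.2 (by nlinarith)
  have h3m : 3 * m ≤ a := by
    have : (3 * m : ℝ) ≤ a := by linarith [(Nat.cast_nonneg m : (0 : ℝ) ≤ m)]
    exact_mod_cast this
  obtain ⟨M, hM⟩ : ∃ M : Finset (Fin n → Fin n), M = univ.filter fun f => #(moved f) = a ∧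
      ∃ (G : SimpleGraph (Fin n)) (bends : Fin n → Fin n → List (ℝ × ℝ)),
        IsPolylineDrawing G π bends ∧ FitsMatching f G ∧
        ∑ v ∈ moved f, (bends v (f v)).length ≤ ⌊2 * c * (n : ℝ) ^ 2⌋₊ := ⟨_, rfl⟩
  obtain ⟨q, hq⟩ : ∃ q, q = (2 ^ 18 + 2) * a + 1 := ⟨_, rfl⟩
  have hcard := card_fewBendGraphs_le hq hM
  have hMc := hL n J r m a _ s π M hπ hr0 (hβ _ (Nat.floor_le (by positivity))) hm hs hsn h3m
    fun f hf => by
      rw [hM, mem_filter] at hf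
      exact hf.2
  have hR := card_retract_le (V := Fin n) (m := q) hK1 fun k _ => hK k
  rw [Fintype.card_fin] at hR
  have hqn : 48 * (K : ℝ) * q ≤ n := by
    have h1 : (q : ℝ) ≤ 2 ^ 20 * (ε * n) := by
      rw [hq]
      push_cast
      nlinarith
    calc 48 * (K : ℝ) * q ≤ 48 * K * (2 ^ 20 * (ε * n)) := by gcongr
      _ = ε * (48 * K * 2 ^ 20) * n := by ring
      _ = n := by rw [hε, one_mul]
  have hRn := retract_bound hK1 hqn
  have hMn := matching_bound hA hK1 hn0 hJ hB0 hB hm1 hm17 hm6 haε han hsρ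
  have hKa : (#(k5FreeGraphs (Fin (n - a))) : ℝ) ≤ (K : ℝ) ^ (n - a) * (n : ℝ) ^ (n - a) := by
    calc (#(k5FreeGraphs (Fin (n - a))) : ℝ) ≤ (K : ℝ) ^ (n - a) * ((n - a : ℕ) : ℝ) ^ (n - a) := by
          exact_mod_cast hK (n - a)
      _ ≤ _ := by
          gcongr
          exact Nat.sub_le n a
  have hX : (0 : ℝ) < n.factorial / 2 ^ n := by positivity
  have hexp : Real.exp (-n) < 1 / 2 := by
    calc Real.exp (-n) ≤ Real.exp (-1) := Real.exp_le_exp.2 (by linarith)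
      _ < 1 / 2 := Real.exp_neg_one_lt_half
  have hquarter : (1 / 4 : ℝ) ^ n ≤ 1 / 4 := pow_le_of_le_one (by norm_num) (by norm_num) hn0.ne'
  calc _ ≤ (#M : ℝ) * (#(k5FreeGraphs (Fin (n - a))) * 2 ^ (64 * n)) +
        #(retractGraphs (Fin n) q) := by exact_mod_cast hcard
    _ ≤ Real.exp (L * n) * (2 ^ J) ^ (16 * m + 1) * (4 ^ n * (s ^ (a - 3 * m) * n ^ (3 * m))) *
        ((K : ℝ) ^ (n - a) * (n : ℝ) ^ (n - a) * 2 ^ (64 * n)) +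
        2 ^ n * (K ^ q * q ^ n) := by
        gcongr
        exact_mod_cast hR
    _ ≤ n.factorial / 2 ^ n * Real.exp (-n) + n.factorial / 2 ^ n * (1 / 4) ^ n :=
        add_le_add hMn hRn
    _ < n.factorial / 2 ^ n := by nlinarith
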